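/- arXiv:0906.1162 — 7 statements merged into one kernel-verified Lean document; each statement's English description precedes it below -/
import Mathlib

section
/- Let f ∈ L_1(ℝ) and let Λ ⊆ ℝ be uniformly discrete. Then X_1(f, Λ), the closed linear span in L_1(ℝ) of the translates {f_(λ) : λ ∈ Λ}, is a proper subspace of L_1(ℝ). -/
open MeasureTheory ENNReal

lemma sep_sum : ∃ K : ℝ, 0 < K ∧ ∀ (δ : ℝ) (_ : 0 < δ) (S : Finset ℝ)
    (_ : ∀ l ∈ S, ∀ l' ∈ S, l ≠ l' → δ ≤ |l - l'|) (l : ℝ) (_ : l ∈ S),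
    ∑ l' ∈ S, 4 / (l - l')^2 ≤ K / δ^2 := by
  have hs : Summable (fun n : ℤ => 16 * (1 / (n:ℝ)^2)) :=
    (Real.summable_one_div_int_pow.mpr (by norm_num)).mul_left 16
  refine ⟨∑' n : ℤ, 16 * (1 / (n:ℝ)^2) + 1, ?_, ?_⟩
  · have : 0 ≤ ∑' n : ℤ, 16 * (1 / (n:ℝ)^2) := tsum_nonneg (fun n => by positivity)
    linarith
  intro δ hδ S hS l hl
  classical
  have h1 : ∑ l' ∈ S, 4 / (l - l')^2 ≤ ∑ l' ∈ S, (16 * (1 / ((⌊(l' - l)/δ⌋ : ℤ):ℝ)^2)) / δ^2 := by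
    apply Finset.sum_le_sum
    intro l' hl'
    by_cases h : l = l'
    · subst h; simp
    have hd := hS l hl l' hl' h
    set t := (l' - l)/δ with ht
    have hlt : l - l' = - (t * δ) := by rw [ht]; field_simp; ring
    rw [hlt, abs_neg, abs_mul, abs_of_pos hδ] at hd
    have ht1 : 1 ≤ |t| := by
      by_contra hc
      push Not at hc
      nlinarith
    have hn0 : ⌊t⌋ ≠ 0 := by
      intro h0
      rw [Int.floor_eq_zero_iff] at h0
      rw [abs_of_nonneg h0.1] at ht1
      exact absurd h0.2 (not_lt.mpr ht1)
    have hn0' : ((⌊t⌋ : ℤ) : ℝ) ≠ 0 := by exact_mod_cast hn0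
    have hb : |((⌊t⌋ : ℤ) : ℝ)| ≤ 2 * |t| := by
      have a1 := Int.floor_le t
      have a2 := Int.lt_floor_add_one t
      rw [abs_le]
      have a3 := le_abs_self t
      have a4 := neg_abs_le t
      constructor <;> linarith
    have ht0 : t ≠ 0 := by intro h; rw [h] at ht1; norm_num at ht1
    have hb2 : ((⌊t⌋ : ℤ) : ℝ)^2 ≤ 4 * t^2 := by
      rw [← sq_abs, ← sq_abs t]
      nlinarith [abs_nonneg ((⌊t⌋ : ℤ) : ℝ)]
    rw [hlt, neg_sq, mul_pow, ← div_div]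
    apply div_le_div_of_nonneg_right _ (by positivity)
    rw [mul_one_div, div_le_div_iff₀ (by positivity) (by positivity)]
    nlinarith
  refine h1.trans ?_
  rw [← Finset.sum_div]
  apply div_le_div_of_nonneg_right _ (by positivity)
  have hinj : Set.InjOn (fun l' : ℝ => ⌊(l' - l)/δ⌋) S := by
    intro a ha b hb hab
    by_contra hne
    have := hS a ha b hb hne
    have h2 := Int.abs_sub_lt_one_of_floor_eq_floor hab
    rw [← sub_div, abs_div, abs_of_pos hδ, div_lt_one hδ] at h2
    have e : a - l - (b - l) = a - b := by ring
    rw [e] at h2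
    linarith
  have h3 := Finset.sum_image (s := S) (f := fun n : ℤ => 16 * (1 / (n:ℝ)^2)) hinj
  rw [← h3]
  have := hs.sum_le_tsum (S.image (fun l' : ℝ => ⌊(l' - l)/δ⌋)) (fun n _ => by positivity)
  linarith

lemma J_eq (a R : ℝ) (ha : a ≠ 0) :
    ∫ x in (0:ℝ)..R, ∫ y in (0:ℝ)..R, Real.cos (a * (x - y)) = (2 - 2 * Real.cos (a * R)) / a^2 := by
  have hc : ∫ x in (0:ℝ)..R, Real.cos (a * x) = Real.sin (a * R) / a := by
    rw [intervalIntegral.integral_comp_mul_left (fun x => Real.cos x) ha]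
    simp; ring
  have hs : ∫ x in (0:ℝ)..R, Real.sin (a * x) = (1 - Real.cos (a * R)) / a := by
    rw [intervalIntegral.integral_comp_mul_left (fun x => Real.sin x) ha]
    simp; ring
  have : ∀ x y, Real.cos (a * (x - y)) = Real.cos (a*x) * Real.cos (a*y) + Real.sin (a*x) * Real.sin (a*y) := by
    intro x y; rw [mul_sub, Real.cos_sub]
  simp_rw [this]
  have h2 : ∀ x, ∫ y in (0:ℝ)..R, (Real.cos (a*x) * Real.cos (a*y) + Real.sin (a*x) * Real.sin (a*y))
      = Real.cos (a*x) * (Real.sin (a * R) / a) + Real.sin (a*x) * ((1 - Real.cos (a * R)) / a) := by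
    intro x
    rw [intervalIntegral.integral_add (Continuous.intervalIntegrable (by fun_prop) _ _)
      (Continuous.intervalIntegrable (by fun_prop) _ _), intervalIntegral.integral_const_mul,
      intervalIntegral.integral_const_mul, hc, hs]
  simp_rw [h2]
  rw [intervalIntegral.integral_add (Continuous.intervalIntegrable (by fun_prop) _ _)
      (Continuous.intervalIntegrable (by fun_prop) _ _), intervalIntegral.integral_mul_const,
      intervalIntegral.integral_mul_const, hc, hs]
  field_simp
  nlinarith [Real.sin_sq_add_cos_sq (a * R)]

lemma J_bound (a R : ℝ) (ha : a ≠ 0) :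
    |∫ x in (0:ℝ)..R, ∫ y in (0:ℝ)..R, Real.cos (a * (x - y))| ≤ 4 / a^2 := by
  rw [J_eq a R ha, abs_div, abs_of_nonneg (sq_nonneg a)]
  apply div_le_div_of_nonneg_right _ (by positivity)
  rw [abs_le]
  constructor <;> linarith [Real.cos_le_one (a*R), Real.neg_one_le_cos (a*R)]

lemma ingham (δ : ℝ) (hδ : 0 < δ) : ∃ R : ℝ, 0 < R ∧ ∀ (S : Finset ℝ)
    (_ : ∀ l ∈ S, ∀ l' ∈ S, l ≠ l' → δ ≤ |l - l'|) (c : ℝ → ℝ) (B : ℝ)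
    (_ : ∀ z, |z| ≤ R → (∑ l ∈ S, c l * Real.cos (l * z))^2 + (∑ l ∈ S, c l * Real.sin (l * z))^2 ≤ B),
    ∑ l ∈ S, (c l)^2 ≤ 2 * B := by
  obtain ⟨K, hK, hsum⟩ := sep_sum
  have hM : 0 < K / δ^2 := by positivity
  refine ⟨Real.sqrt (2 * (K / δ^2)), by positivity, ?_⟩
  set R := Real.sqrt (2 * (K / δ^2)) with hR
  have hR2 : R^2 = 2 * (K / δ^2) := Real.sq_sqrt (by positivity)
  have hR0 : 0 ≤ R := Real.sqrt_nonneg _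
  intro S hS c B hB
  have hP : ∀ z, (∑ l ∈ S, c l * Real.cos (l * z))^2 + (∑ l ∈ S, c l * Real.sin (l * z))^2
      = ∑ l ∈ S, ∑ l' ∈ S, c l * c l' * Real.cos ((l - l') * z) := by
    intro z
    rw [sq, sq, Finset.sum_mul_sum, Finset.sum_mul_sum, ← Finset.sum_add_distrib]
    refine Finset.sum_congr rfl fun l _ => ?_
    rw [← Finset.sum_add_distrib]
    refine Finset.sum_congr rfl fun l' _ => ?_
    rw [sub_mul, Real.cos_sub]; ring
  simp_rw [hP] at hB
  have hE : ∫ x in (0:ℝ)..R, ∫ y in (0:ℝ)..R, ∑ l ∈ S, ∑ l' ∈ S, c l * c l' * Real.cos ((l - l') * (x - y))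
      = ∑ l ∈ S, ∑ l' ∈ S, c l * c l' *
        ∫ x in (0:ℝ)..R, ∫ y in (0:ℝ)..R, Real.cos ((l - l') * (x - y)) := by
    have hin : ∀ x, ∫ y in (0:ℝ)..R, ∑ l ∈ S, ∑ l' ∈ S, c l * c l' * Real.cos ((l - l') * (x - y))
      = ∑ l ∈ S, ∑ l' ∈ S, c l * c l' * ∫ y in (0:ℝ)..R, Real.cos ((l - l') * (x - y)) := by
      intro x
      rw [intervalIntegral.integral_finsetSum (fun l _ => Continuous.intervalIntegrable (by fun_prop) _ _)]
      refine Finset.sum_congr rfl fun l _ => ?_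
      rw [intervalIntegral.integral_finsetSum (fun l _ => Continuous.intervalIntegrable (by fun_prop) _ _)]
      refine Finset.sum_congr rfl fun l' _ => ?_
      rw [intervalIntegral.integral_const_mul]
    simp_rw [hin]
    have hcont : ∀ a : ℝ, Continuous fun x => ∫ y in (0:ℝ)..R, Real.cos (a * (x - y)) := by
      intro a
      apply intervalIntegral.continuous_parametric_intervalIntegral_of_continuous' (by fun_prop)
    rw [intervalIntegral.integral_finsetSum (fun l _ => Continuous.intervalIntegrable (by fun_prop) _ _)]
    refine Finset.sum_congr rfl fun l _ => ?_
    rw [intervalIntegral.integral_finsetSum (fun l _ => Continuous.intervalIntegrable (by fun_prop) _ _)]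
    refine Finset.sum_congr rfl fun l' _ => ?_
    rw [intervalIntegral.integral_const_mul]
  have hup : ∫ x in (0:ℝ)..R, ∫ y in (0:ℝ)..R, ∑ l ∈ S, ∑ l' ∈ S, c l * c l' * Real.cos ((l - l') * (x - y))
      ≤ R^2 * B := by
    have hin : ∀ x ∈ Set.Icc 0 R, ∫ y in (0:ℝ)..R, ∑ l ∈ S, ∑ l' ∈ S, c l * c l' * Real.cos ((l - l') * (x - y))
      ≤ R * B := by
      intro x hx
      have := intervalIntegral.integral_mono_on (f := fun y => ∑ l ∈ S, ∑ l' ∈ S, c l * c l' * Real.cos ((l - l') * (x - y))) (g := fun _ => B) (μ := volume) hR0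
        (Continuous.intervalIntegrable (by fun_prop) _ _) (Continuous.intervalIntegrable (by fun_prop) _ _)
        (fun y hy => hB (x - y) (by
          rw [abs_le]; constructor <;> linarith [hx.1, hx.2, hy.1, hy.2]))
      simpa using this
    have hcont : Continuous fun x => ∫ y in (0:ℝ)..R, ∑ l ∈ S, ∑ l' ∈ S, c l * c l' * Real.cos ((l - l') * (x - y)) := by
      apply intervalIntegral.continuous_parametric_intervalIntegral_of_continuous' (by fun_prop)
    have := intervalIntegral.integral_mono_on (g := fun _ => R * B) (μ := volume) hR0
        (hcont.intervalIntegrable _ _) (Continuous.intervalIntegrable (by fun_prop) _ _) hin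
    simp at this
    linarith
  rw [hE] at hup
  have hlow : ∀ l ∈ S, ∀ l' ∈ S, (if l = l' then R^2 * (c l)^2 else 0)
      - ((c l)^2 / 2 * (4 / (l - l')^2) + (c l')^2 / 2 * (4 / (l' - l)^2)) ≤
      c l * c l' * ∫ x in (0:ℝ)..R, ∫ y in (0:ℝ)..R, Real.cos ((l - l') * (x - y)) := by
    intro l _ l' _
    by_cases h : l = l'
    · subst h
      simp
      linarith
    · have hb := J_bound (l - l') R (sub_ne_zero.mpr h)
      rw [if_neg h]
      have e : (l' - l)^2 = (l - l')^2 := by ring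
      rw [e]
      set k := 4 / (l - l')^2
      set J := ∫ x in (0:ℝ)..R, ∫ y in (0:ℝ)..R, Real.cos ((l - l') * (x - y))
      have h1 : |c l * c l' * J| ≤ ((c l)^2 / 2 + (c l')^2/2) * k := by
        rw [abs_mul]
        apply mul_le_mul _ hb (abs_nonneg _) (by positivity)
        rw [abs_le]
        constructor <;> nlinarith [sq_nonneg (c l - c l'), sq_nonneg (c l + c l')]
      have := (abs_le.mp h1).1
      linarith
  have h3 := Finset.sum_le_sum fun l hl => Finset.sum_le_sum fun l' hl' => hlow l hl l' hl'
  simp_rw [Finset.sum_sub_distrib, Finset.sum_add_distrib] at h3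
  rw [Finset.sum_comm (f := fun l l' => c l' ^ 2 / 2 * (4 / (l' - l) ^ 2))] at h3
  have h4 : ∑ l ∈ S, ∑ l' ∈ S, (c l)^2 / 2 * (4 / (l - l')^2) ≤ (K / δ^2) / 2 * ∑ l ∈ S, (c l)^2 := by
    rw [Finset.mul_sum]
    refine Finset.sum_le_sum fun l hl => ?_
    rw [← Finset.mul_sum]
    have := mul_le_mul_of_nonneg_left (hsum δ hδ S hS l hl) (by positivity : 0 ≤ (c l)^2/2)
    linarith
  have h5 : ∑ l ∈ S, ∑ l' ∈ S, (if l = l' then R^2 * (c l)^2 else 0) = R^2 * ∑ l ∈ S, (c l)^2 := by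
    rw [Finset.mul_sum]
    refine Finset.sum_congr rfl fun l hl => ?_
    simp [hl]
  rw [h5] at h3
  have h6 : (K / δ^2) * ∑ l ∈ S, (c l)^2 ≤ (K / δ^2) * (2 * B) := by
    rw [hR2] at h3 hup
    linarith
  exact le_of_mul_le_mul_left h6 hM

/-- The Fourier transform on real `L¹`. -/
noncomputable def ftr (z : ℝ) (g : ℝ → ℝ) : ℂ :=
  ∫ x : ℝ, Complex.exp (Complex.I * z * x) * (g x : ℂ)

lemma ftr_norm_exp (z x : ℝ) : ‖Complex.exp (Complex.I * z * x)‖ = 1 := by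
  have : Complex.I * z * x = ((z * x : ℝ) : ℂ) * Complex.I := by push_cast; ring
  rw [this, Complex.norm_exp_ofReal_mul_I]

lemma ftr_integrable (z : ℝ) {g : ℝ → ℝ} (hg : Integrable g) :
    Integrable (fun x : ℝ => Complex.exp (Complex.I * z * x) * (g x : ℂ)) := by
  refine hg.ofReal.bdd_mul (c := 1) (Continuous.aestronglyMeasurable (by fun_prop)) ?_
  exact Filter.Eventually.of_forall fun x => (ftr_norm_exp z x).le

lemma ftr_congr (z : ℝ) {g h : ℝ → ℝ} (e : g =ᵐ[volume] h) : ftr z g = ftr z h := by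
  apply integral_congr_ae
  filter_upwards [e] with x hx
  rw [hx]

lemma ftr_add (z : ℝ) (g h : Lp ℝ 1 (volume : Measure ℝ)) :
    ftr z (g + h : Lp ℝ 1 (volume : Measure ℝ)) = ftr z g + ftr z h := by
  rw [ftr_congr z (Lp.coeFn_add g h)]
  unfold ftr
  rw [← integral_add (ftr_integrable z (L1.integrable_coeFn g)) (ftr_integrable z (L1.integrable_coeFn h))]
  congr 1
  ext x
  simp [mul_add]

lemma ftr_smul (z : ℝ) (a : ℝ) (g : Lp ℝ 1 (volume : Measure ℝ)) :
    ftr z (a • g : Lp ℝ 1 (volume : Measure ℝ)) = a * ftr z g := by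
  rw [ftr_congr z (Lp.coeFn_smul a g)]
  unfold ftr
  rw [← integral_const_mul]
  congr 1
  ext x
  simp
  ring

lemma ftr_norm_le (z : ℝ) (g : Lp ℝ 1 (volume : Measure ℝ)) : ‖ftr z g‖ ≤ ‖g‖ := by
  rw [L1.norm_eq_integral_norm]
  refine (norm_integral_le_integral_norm _).trans (le_of_eq ?_)
  congr 1
  ext x
  rw [norm_mul, ftr_norm_exp, one_mul, Complex.norm_real]

lemma ftr_sub_norm_le (z : ℝ) (g h : Lp ℝ 1 (volume : Measure ℝ)) :
    ‖ftr z g - ftr z h‖ ≤ ‖g - h‖ := by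
  have e := ftr_add z (g - h) h
  rw [sub_add_cancel] at e
  rw [e, add_sub_cancel_right]
  exact ftr_norm_le z _

lemma ftr_translate (z l : ℝ) (g : ℝ → ℝ) :
    ftr z (fun x => g (x - l)) = Complex.exp (Complex.I * z * l) * ftr z g := by
  unfold ftr
  rw [← integral_const_mul, ← integral_add_right_eq_self _ l]
  congr 1
  ext x
  beta_reduce
  rw [add_sub_cancel_right, ← mul_assoc, ← Complex.exp_add]
  push_cast
  ring_nf

lemma ftr_continuous {g : ℝ → ℝ} (hg : Integrable g) : Continuous fun z => ftr z g := by
  refine continuous_of_dominated (bound := fun x => ‖g x‖) (fun z => (ftr_integrable z hg).1) ?_ hg.norm ?_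
  · intro z
    refine Filter.Eventually.of_forall fun x => ?_
    rw [norm_mul, ftr_norm_exp, one_mul, Complex.norm_real]
  · exact Filter.Eventually.of_forall fun x => by fun_prop

lemma ftr_gauss (z : ℝ) : ftr z (fun x => Real.exp (-1 * x^2)) ≠ 0 := by
  have := fourierIntegral_gaussian (b := 1) (by simp) (z : ℂ)
  unfold ftr
  push_cast
  rw [this]
  apply mul_ne_zero _ (Complex.exp_ne_zero _)
  rw [Complex.cpow_ne_zero_iff]
  left
  simp [Real.pi_ne_zero]

lemma ftr_span (f : Lp ℝ 1 (volume : Measure ℝ)) (Λ : Set ℝ) (h : Lp ℝ 1 (volume : Measure ℝ))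
    (hh : h ∈ Submodule.span ℝ {g : Lp ℝ 1 (volume : Measure ℝ) |
        ∃ l ∈ Λ, (g : ℝ → ℝ) =ᵐ[volume] fun x => f (x - l)}) :
    ∃ c : ℝ →₀ ℝ, (∀ l ∈ c.support, l ∈ Λ) ∧ ∀ z : ℝ, ftr z h =
      (c.sum fun l a => (a : ℂ) * Complex.exp (Complex.I * z * l)) * ftr z f := by
  classical
  induction hh using Submodule.span_induction with
  | mem g hg =>
    obtain ⟨l, hl, e⟩ := hg
    refine ⟨Finsupp.single l 1, ?_, fun z => ?_⟩
    · intro l' hl'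
      have := Finsupp.support_single_subset hl'
      rw [Finset.mem_singleton] at this
      rwa [this]
    · rw [ftr_congr z e, ftr_translate, Finsupp.sum_single_index (by simp)]
      simp
  | zero =>
    refine ⟨0, by simp, fun z => ?_⟩
    rw [ftr_congr z (Lp.coeFn_zero ..)]
    simp [ftr]
  | add g h _ _ ihg ihh =>
    obtain ⟨c, hc, ec⟩ := ihg
    obtain ⟨d, hd, ed⟩ := ihh
    refine ⟨c + d, ?_, fun z => ?_⟩
    · intro l hl
      rcases Finset.mem_union.mp (Finsupp.support_add hl) with h | h
      · exact hc l h
      · exact hd l h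
    · rw [ftr_add, ec, ed, Finsupp.sum_add_index' (by simp) (by intros; push_cast; ring), add_mul]
  | smul a g _ ih =>
    obtain ⟨c, hc, ec⟩ := ih
    refine ⟨a • c, fun l hl => hc l (Finsupp.support_smul hl), fun z => ?_⟩
    rw [ftr_smul, ec, Finsupp.sum_smul_index' (by simp), ← mul_assoc, Finsupp.mul_sum]
    congr 1
    refine Finset.sum_congr rfl fun l _ => ?_
    simp
    ring

lemma exists_sep (Λ : Set ℝ)
    (hΛ : ∃ δ > (0 : ℝ), ∀ l ∈ Λ, ∀ l' ∈ Λ, l ≠ l' → δ ≤ |l - l'|) :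
    ∃ m : ℝ, m ∉ Λ ∧ ∃ δ > (0 : ℝ), ∀ l ∈ insert m Λ, ∀ l' ∈ insert m Λ, l ≠ l' → δ ≤ |l - l'| := by
  obtain ⟨δ, hδ, h⟩ := hΛ
  have key : ∃ m : ℝ, ∀ l ∈ Λ, δ / 2 ≤ |m - l| := by
    rcases Λ.eq_empty_or_nonempty with he | ⟨l0, hl0⟩
    · exact ⟨0, by simp [he]⟩
    · refine ⟨l0 + δ / 2, fun l hl => ?_⟩
      by_cases e : l0 = l
      · subst e
        rw [add_sub_cancel_left, abs_of_pos (by positivity)]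
      · have h1 := h l0 hl0 l hl e
        have h2 : |l0 - l| ≤ |l0 + δ/2 - l| + |δ/2| := by
          have := abs_sub (l0 + δ/2 - l) (δ/2)
          have e : l0 + δ/2 - l - δ/2 = l0 - l := by ring
          rwa [e] at this
        rw [abs_of_pos (by positivity : 0 < δ/2)] at h2
        linarith
  obtain ⟨m, hm⟩ := key
  refine ⟨m, fun hmem => ?_, δ / 2, by positivity, ?_⟩
  · have := hm m hmem
    simp at this
    linarith
  · intro l hl l' hl' hne
    rcases hl with rfl | hl <;> rcases hl' with rfl | hl'
    · exact absurd rfl hne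
    · exact hm l' hl'
    · rw [abs_sub_comm]; exact hm l hl
    · linarith [h l hl l' hl' hne]

/-- If `f ∈ L_1(ℝ)` and `Λ ⊆ ℝ` is uniformly discrete, then the closed linear
span `X_1(f,Λ)` of the translates `{f_(λ) : λ ∈ Λ}` is a proper subspace of
`L_1(ℝ)`. -/
theorem closed_span_translates_ne_top_L1
    (f : Lp ℝ 1 (volume : Measure ℝ)) (Λ : Set ℝ)
    (hΛ : ∃ δ > (0 : ℝ), ∀ l ∈ Λ, ∀ l' ∈ Λ, l ≠ l' → δ ≤ |l - l'|) :
    closure (Submodule.span ℝ {g : Lp ℝ 1 (volume : Measure ℝ) |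
        ∃ l ∈ Λ, (g : ℝ → ℝ) =ᵐ[volume] fun x => f (x - l)} :
      Set (Lp ℝ 1 (volume : Measure ℝ))) ≠ Set.univ := by
  intro htop
  have happrox : ∀ g : Lp ℝ 1 (volume : Measure ℝ), ∀ ε > 0, ∃ c : ℝ →₀ ℝ,
      (∀ l ∈ c.support, l ∈ Λ) ∧ ∀ z : ℝ, ‖ftr z g -
      (c.sum fun l a => (a : ℂ) * Complex.exp (Complex.I * z * l)) * ftr z f‖ ≤ ε := by
    intro g ε hε
    have hg : g ∈ closure (Submodule.span ℝ {g : Lp ℝ 1 (volume : Measure ℝ) |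
        ∃ l ∈ Λ, (g : ℝ → ℝ) =ᵐ[volume] fun x => f (x - l)} :
        Set (Lp ℝ 1 (volume : Measure ℝ))) := by rw [htop]; trivial
    obtain ⟨h, hh, hd⟩ := Metric.mem_closure_iff.mp hg ε hε
    obtain ⟨c, hc, e⟩ := ftr_span f Λ h hh
    refine ⟨c, hc, fun z => ?_⟩
    rw [← e z]
    rw [dist_eq_norm] at hd
    exact (ftr_sub_norm_le z g h).trans hd.le
  have hne : ∀ z, ftr z f ≠ 0 := by
    intro z hz
    have hG : MemLp (fun x : ℝ => Real.exp (-1 * x^2)) 1 volume :=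
      memLp_one_iff_integrable.mpr (integrable_exp_neg_mul_sq one_pos)
    have hG0 := ftr_gauss z
    rw [← ftr_congr z hG.coeFn_toLp] at hG0
    obtain ⟨c, -, hc⟩ := happrox hG.toLp (‖ftr z hG.toLp‖ / 2) (by positivity)
    have := hc z
    rw [hz, mul_zero, sub_zero] at this
    have : 0 < ‖ftr z hG.toLp‖ := by positivity
    linarith
  obtain ⟨m, hmΛ, δ, hδ, hsep⟩ := exists_sep Λ hΛ
  obtain ⟨R, hR, hing⟩ := ingham δ hδ
  have hfi := L1.integrable_coeFn f
  obtain ⟨z0, -, hz0⟩ := (isCompact_Icc (a := -R) (b := R)).exists_isMinOn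
    ⟨0, by constructor <;> linarith⟩ (ftr_continuous hfi).norm.continuousOn
  have hM : 0 < ‖ftr z0 f‖ := norm_pos_iff.mpr (hne z0)
  have hT : MemLp (fun x : ℝ => f (x - m)) 1 volume :=
    memLp_one_iff_integrable.mpr (hfi.comp_sub_right m)
  obtain ⟨c, hcΛ, hc⟩ := happrox hT.toLp (‖ftr z0 f‖ / 2) (by positivity)
  have hcm : c m = 0 := by
    by_contra h
    exact hmΛ (hcΛ m (Finsupp.mem_support_iff.mpr h))
  have hms : m ∉ c.support := by simpa using hcm
  classical
  have hfin := hing (insert m c.support) (fun l hl l' hl' => hsep l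
      (by
        rcases Finset.mem_insert.mp hl with h | h
        · exact Or.inl h
        · exact Or.inr (hcΛ l h)) l'
      (by
        rcases Finset.mem_insert.mp hl' with h | h
        · exact Or.inl h
        · exact Or.inr (hcΛ l' h)))
    (fun l => if l = m then -1 else c l) (1/4) (by
      intro z hz
      have h1 := hc z
      rw [ftr_congr z hT.coeFn_toLp, ftr_translate, ← sub_mul, norm_mul] at h1
      have h2 : ‖ftr z0 f‖ ≤ ‖ftr z f‖ := hz0 (abs_le.mp hz)
      set q := Complex.exp (Complex.I * z * m) -
        c.sum fun l a => (a : ℂ) * Complex.exp (Complex.I * z * l) with hq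
      have h3 : ‖q‖ ≤ 1/2 := by
        have := mul_le_mul_of_nonneg_left h2 (norm_nonneg q)
        have h4 : ‖q‖ * ‖ftr z0 f‖ ≤ 1/2 * ‖ftr z0 f‖ := by linarith
        exact le_of_mul_le_mul_right h4 hM
      have hqe : -q = ∑ l ∈ insert m c.support, (((if l = m then -1 else c l : ℝ)) : ℂ) *
          Complex.exp (Complex.I * z * l) := by
        rw [Finset.sum_insert hms, hq, Finsupp.sum]
        have : ∑ l ∈ c.support, (((if l = m then -1 else c l : ℝ)) : ℂ) *
          Complex.exp (Complex.I * z * l) = ∑ l ∈ c.support, (c l : ℂ) *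
          Complex.exp (Complex.I * z * l) := by
          refine Finset.sum_congr rfl fun l hl => ?_
          rw [if_neg (by rintro rfl; exact hms hl)]
        rw [this]
        simp
        ring
      have hexp : ∀ l : ℝ, Complex.exp (Complex.I * z * l) =
          (Real.cos (l * z) : ℂ) + (Real.sin (l * z) : ℂ) * Complex.I := by
        intro l
        have : Complex.I * z * l = ((l * z : ℝ) : ℂ) * Complex.I := by push_cast; ring
        rw [this, Complex.exp_mul_I, Complex.ofReal_cos, Complex.ofReal_sin]
      have hre : (-q).re = ∑ l ∈ insert m c.support, (if l = m then -1 else c l : ℝ) * Real.cos (l * z) := by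
        rw [hqe, Complex.re_sum]
        refine Finset.sum_congr rfl fun l _ => ?_
        rw [hexp, Complex.re_ofReal_mul]
        simp [-Complex.ofReal_cos, -Complex.ofReal_sin]
      have him : (-q).im = ∑ l ∈ insert m c.support, (if l = m then -1 else c l : ℝ) * Real.sin (l * z) := by
        rw [hqe, Complex.im_sum]
        refine Finset.sum_congr rfl fun l _ => ?_
        rw [hexp, Complex.im_ofReal_mul]
        simp [-Complex.ofReal_cos, -Complex.ofReal_sin]
      rw [← hre, ← him]
      have hn : ‖-q‖^2 = (-q).re^2 + (-q).im^2 := by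
        rw [Complex.sq_norm, Complex.normSq_apply]; ring
      rw [← hn, norm_neg]
      nlinarith [norm_nonneg q])
  rw [Finset.sum_insert hms] at hfin
  have hnn : 0 ≤ ∑ l ∈ c.support, (if l = m then -1 else c l : ℝ)^2 :=
    Finset.sum_nonneg fun _ _ => sq_nonneg _
  simp only [if_true] at hfin
  linarith
end

section
/- Let 1 < p < ∞ with conjugate exponent q. Let f ∈ L_p(ℝ) ∩ L_1(ℝ), let (λ_i)_{i≥1} be uniformly discrete, and set f_i = f_(λ_i). Then (f_i) is not a fundamental bounded minimal system for L_p(ℝ): there do not exist g_i ∈ L_q(ℝ) with ∫_ℝ f_i g_j = δ_{ij} for all i, j, sup_i ‖g_i‖_q < ∞, and the closed linear span of (f_i)_{i≥1} equal to all of L_p(ℝ). -/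
open MeasureTheory ENNReal

open Filter Topology in
/-- Riemann–Lebesgue for real cosines. -/
lemma rl_cos (u : ℝ → ℝ) (hu : Integrable u) :
    Tendsto (fun n : ℕ => ∫ x, Real.cos (2 * Real.pi * (x * n)) * u x) atTop (𝓝 0) := by
  have h := Real.tendsto_integral_exp_smul_cocompact (fun x => (u x : ℂ))
  have h2 : Tendsto (fun n : ℕ => (n : ℝ)) atTop (cocompact ℝ) :=
    tendsto_natCast_atTop_atTop.mono_right atTop_le_cocompact
  have h3 := (Complex.continuous_re.tendsto 0).comp (h.comp h2)
  simp only [Complex.zero_re] at h3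
  refine h3.congr fun n => ?_
  simp only [Function.comp]
  have hi : Integrable (fun v : ℝ => Real.fourierChar (-(v * (n : ℝ))) • (u v : ℂ)) := by
    refine Integrable.mono' hu.norm ?_ ?_
    · refine AEStronglyMeasurable.fun_smul ?_ hu.ofReal.aestronglyMeasurable
      exact (by fun_prop : Continuous fun v : ℝ => Real.fourierChar (-(v * (n : ℝ)))).aestronglyMeasurable
    · exact Eventually.of_forall fun x => by rw [Circle.smul_def, norm_smul, Circle.norm_coe, one_mul, Complex.norm_real]
  have := integral_re hi
  simp only [RCLike.re_to_complex] at this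
  rw [← this]
  congr 1; ext v
  rw [Circle.smul_def, Real.fourierChar_apply, smul_eq_mul, Complex.re_mul_ofReal,
    Complex.exp_ofReal_mul_I_re, ← Real.cos_neg]
  congr 2; ring

/-- The oscillating test functions. -/
noncomputable def osc (d : ℝ) (n : ℕ) : ℝ → ℝ :=
  (Set.Ico 0 d).indicator (fun x => Real.cos (2 * Real.pi * (x * n)))

lemma osc_memLp (d : ℝ) (n : ℕ) (p : ℝ≥0∞) : MemLp (osc d n) p volume := by
  unfold osc
  rw [memLp_indicator_iff_restrict measurableSet_Ico]
  refine MemLp.of_bound ?_ 1 ?_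
  · exact (by fun_prop : Continuous fun x : ℝ => Real.cos (2 * Real.pi * (x * n))).aestronglyMeasurable
  · exact Filter.Eventually.of_forall fun x => Real.abs_cos_le_one _

open Filter Topology in
lemma osc_mul_tendsto (d : ℝ) (u : ℝ → ℝ) (hu : IntegrableOn u (Set.Ico 0 d)) :
    Tendsto (fun n : ℕ => ∫ x, osc d n x * u x) atTop (𝓝 0) := by
  refine (rl_cos ((Set.Ico 0 d).indicator u)
    (hu.integrable_indicator measurableSet_Ico)).congr fun n => ?_
  congr 1; ext x
  by_cases hx : x ∈ Set.Ico 0 d <;> simp [osc, hx]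

open Filter Topology in
lemma osc_sq_tendsto (d : ℝ) (hd : 0 < d) :
    Tendsto (fun n : ℕ => ∫ x, osc d n x * osc d n x) atTop (𝓝 (d / 2)) := by
  have h1 : Integrable ((Set.Ico 0 d).indicator (fun _ : ℝ => (1 / 2 : ℝ))) :=
    IntegrableOn.integrable_indicator (by simp) measurableSet_Ico
  have h2 : Tendsto (fun n : ℕ => 2 * n) atTop atTop :=
    tendsto_id.const_mul_atTop' (by norm_num)
  have h := ((rl_cos _ h1).comp h2).const_add (d / 2)
  rw [add_zero] at h
  refine h.congr fun n => ?_
  have h3 : ∫ x, (Set.Ico 0 d).indicator (fun _ : ℝ => (1 / 2 : ℝ)) x = d / 2 := by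
    rw [integral_indicator measurableSet_Ico]
    simp [hd.le]; ring
  simp only [Function.comp]
  rw [← h3, ← integral_add h1]
  · congr 1; ext x
    by_cases hx : x ∈ Set.Ico 0 d
    · simp only [osc, hx, Set.indicator_of_mem]
      have : 2 * Real.pi * (x * ((2 * n : ℕ) : ℝ)) = 2 * (2 * Real.pi * (x * n)) := by
        push_cast; ring
      rw [this, Real.cos_two_mul]; ring
    · simp [osc, hx]
  · refine h1.norm.mono' ?_ ?_
    · exact (by fun_prop : Continuous fun x : ℝ =>
        Real.cos (2 * Real.pi * (x * ((2 * n : ℕ) : ℝ)))).aestronglyMeasurable.mul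
          h1.aestronglyMeasurable
    · refine Eventually.of_forall fun x => ?_
      rw [norm_mul]
      exact mul_le_of_le_one_left (norm_nonneg _) (Real.abs_cos_le_one _)

lemma summable_restrict (f : ℝ → ℝ) (hf : Integrable f) (lam : ℕ → ℝ) (d : ℝ)
    (h : ∀ i j : ℕ, i ≠ j → d ≤ |lam i - lam j|) :
    Summable fun i => ∫ x in Set.Ico 0 d, ‖f (x - lam i)‖ := by
  have hs := hasSum_integral_iUnion (μ := volume) (f := fun x => ‖f x‖)
    (s := fun i => Set.Ico (-lam i) (d - lam i)) (fun i => measurableSet_Ico) (by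
      intro i j hij
      rw [Function.onFun, Set.disjoint_left]
      rintro x ⟨h1, h2⟩ ⟨h3, h4⟩
      have := h i j hij
      rcases le_abs.1 this with h5 | h5 <;> linarith) hf.norm.integrableOn
  refine hs.summable.congr fun i => ?_
  rw [← integral_indicator measurableSet_Ico, ← integral_indicator measurableSet_Ico,
    ← integral_sub_right_eq_self _ (lam i)]
  congr 1; ext x
  simp only [Set.indicator, Set.mem_Ico]
  congr 1
  apply propext; constructor <;> rintro ⟨_, _⟩ <;> constructor <;> linarith

/-- Let `1 < p < ∞` with conjugate exponent `q`, let `f ∈ L_p(ℝ) ∩ L_1(ℝ)`, and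
let `(f_i)` be a uniformly discrete sequence of translates of `f`. Then `(f_i)`
is not a fundamental bounded minimal system for `L_p(ℝ)`. -/
theorem no_fundamental_bounded_minimal_system_of_translates
    (p q : ℝ≥0∞) [Fact (1 ≤ p)] [Fact (1 ≤ q)] (hp : 1 < p) (hp' : p ≠ ∞)
    (hpq : p⁻¹ + q⁻¹ = 1)
    (f : Lp ℝ p (volume : Measure ℝ)) (hf1 : Integrable (f : ℝ → ℝ) volume)
    (lam : ℕ → ℝ)
    (hlam : ∃ δ > (0 : ℝ), ∀ i j : ℕ, i ≠ j → δ ≤ |lam i - lam j|)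
    (F : ℕ → Lp ℝ p (volume : Measure ℝ))
    (hF : ∀ i : ℕ, (F i : ℝ → ℝ) =ᵐ[volume] fun x => f (x - lam i)) :
    ¬ ∃ g : ℕ → Lp ℝ q (volume : Measure ℝ),
        (∀ i j : ℕ, (∫ t : ℝ, F i t * g j t) = if i = j then (1 : ℝ) else 0) ∧
        (∃ C : ℝ, ∀ i : ℕ, ‖g i‖ ≤ C) ∧
        closure (Submodule.span ℝ (Set.range F) : Set (Lp ℝ p (volume : Measure ℝ)))
          = Set.univ := by

  rintro ⟨g, hbi, ⟨C, hC⟩, hcl⟩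
  obtain ⟨d, hd, hlam⟩ := hlam
  haveI : ENNReal.HolderConjugate p q := ENNReal.holderConjugate_iff.2 hpq
  let L := (ContinuousLinearMap.mul ℝ ℝ).lpPairing (volume : Measure ℝ) p q
  have hL : ∀ (u : Lp ℝ p (volume : Measure ℝ)) (v : Lp ℝ q (volume : Measure ℝ)),
      L u v = ∫ x, u x * v x := fun u v =>
    ContinuousLinearMap.lpPairing_eq_integral (ContinuousLinearMap.mul ℝ ℝ) u v
  let H : ℕ → Lp ℝ p (volume : Measure ℝ) := fun n => (osc_memLp d n p).toLp _
  let K : ℕ → Lp ℝ q (volume : Measure ℝ) := fun n => (osc_memLp d n q).toLp _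
  have hH : ∀ n, (H n : ℝ → ℝ) =ᵐ[volume] osc d n := fun n => MemLp.coeFn_toLp _
  have hK : ∀ n, (K n : ℝ → ℝ) =ᵐ[volume] osc d n := fun n => MemLp.coeFn_toLp _
  let a : ℕ → ℝ := fun i => ∫ x in Set.Ico 0 d, ‖(f : ℝ → ℝ) (x - lam i)‖
  have ha : Summable a := summable_restrict _ hf1 lam d hlam
  have hFK : ∀ i n, ‖L (F i) (K n)‖ ≤ a i := by
    intro i n
    rw [hL]
    have e : ∫ x, F i x * K n x
        = ∫ x in Set.Ico 0 d, f (x - lam i) * Real.cos (2 * Real.pi * (x * n)) := by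
      rw [← integral_indicator measurableSet_Ico]
      refine integral_congr_ae ?_
      filter_upwards [hF i, hK n] with x h1 h2
      rw [h1, h2]
      by_cases hx : x ∈ Set.Ico 0 d <;> simp [osc, hx]
    rw [e]
    refine norm_integral_le_of_norm_le (hf1.comp_sub_right (lam i)).norm.integrableOn ?_
    refine Filter.Eventually.of_forall fun x => ?_
    rw [norm_mul]
    exact mul_le_of_le_one_right (norm_nonneg _) (Real.abs_cos_le_one _)
  have hC0 : 0 ≤ C := (norm_nonneg _).trans (hC 0)
  let φ : ℕ → (Lp ℝ p (volume : Measure ℝ) →L[ℝ] ℝ) := fun i => L.flip (g i)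
  have hφ : ∀ i, ‖φ i‖ ≤ ‖L.flip‖ * C := fun i =>
    (L.flip.le_opNorm _).trans (mul_le_mul_of_nonneg_left (hC i) (norm_nonneg _))
  have hφF : ∀ i j, φ j (F i) = if i = j then (1 : ℝ) else 0 := fun i j => by
    rw [← hbi i j, ← hL]; rfl
  have hsum : ∀ n, Summable fun i => L (F i) (K n) • φ i := by
    intro n
    refine Summable.of_norm_bounded (ha.mul_right (‖L.flip‖ * C)) fun i => ?_
    rw [norm_smul]
    exact mul_le_mul (hFK i n) (hφ i) (norm_nonneg _) ((norm_nonneg _).trans (hFK i n))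
  have happ : ∀ n u, (∑' i, L (F i) (K n) • φ i) u = ∑' i, L (F i) (K n) * φ i u := by
    intro n u
    have := (ContinuousLinearMap.apply ℝ ℝ u).map_tsum (hsum n)
    simpa using this
  have hrep : ∀ n, L.flip (K n) = ∑' i, L (F i) (K n) • φ i := by
    intro n
    refine ContinuousLinearMap.ext_on (s := Set.range F) ?_ ?_
    · exact dense_iff_closure_eq.2 hcl
    · rintro _ ⟨j, rfl⟩
      rw [happ, tsum_eq_single j]
      · simp [hφF]
      · intro i hi
        simp [hφF, hi.symm]
  have hmain : ∀ n, ∫ x, osc d n x * osc d n x = ∑' i, L (F i) (K n) * φ i (H n) := by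
    intro n
    rw [← happ, ← hrep, ContinuousLinearMap.flip_apply, hL]
    refine integral_congr_ae ?_
    filter_upwards [hH n, hK n] with x h1 h2
    rw [h1, h2]
  have hHn : ∀ n, ‖H n‖ ≤ ((volume (Set.Ico 0 d)) ^ p.toReal⁻¹).toReal := by
    intro n
    have hb : eLpNorm (osc d n) p volume ≤ (volume (Set.Ico 0 d)) ^ p.toReal⁻¹ := by
      unfold osc
      rw [eLpNorm_indicator_eq_eLpNorm_restrict measurableSet_Ico]
      refine (eLpNorm_le_of_ae_bound (C := 1) (Filter.Eventually.of_forall fun x =>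
        Real.abs_cos_le_one _)).trans ?_
      simp
    rw [Lp.norm_toLp]
    refine ENNReal.toReal_mono ?_ hb
    exact ENNReal.rpow_ne_top_of_nonneg (by positivity) (by simp)
  set M := ((volume (Set.Ico 0 d)) ^ p.toReal⁻¹).toReal with hM
  have hlim : ∀ i, Filter.Tendsto (fun n => φ i (H n)) Filter.atTop (nhds 0) := by
    intro i
    have hloc : IntegrableOn (g i) (Set.Ico 0 d) := by
      have : MemLp (g i) 1 (volume.restrict (Set.Ico 0 d)) :=
        ((Lp.memLp (g i)).restrict _).mono_exponent Fact.out
      exact memLp_one_iff_integrable.1 this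
    refine (osc_mul_tendsto d (g i) hloc).congr fun n => ?_
    change _ = L (H n) (g i)
    rw [hL]
    refine integral_congr_ae ?_
    filter_upwards [hH n] with x h1
    rw [h1]
  have hzero : Filter.Tendsto (fun n => ∑' i, L (F i) (K n) * φ i (H n)) Filter.atTop
      (nhds (∑' _ : ℕ, (0 : ℝ))) := by
    refine tendsto_tsum_of_dominated_convergence (ha.mul_right (‖L.flip‖ * C * M)) ?_ ?_
    · intro i
      refine squeeze_zero_norm (a := fun n => a i * ‖φ i (H n)‖) (fun n => ?_) ?_
      · rw [norm_mul]
        exact mul_le_mul_of_nonneg_right (hFK i n) (norm_nonneg _)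
      · simpa using (hlim i).norm.const_mul (a i)
    · refine Filter.Eventually.of_forall fun n i => ?_
      rw [norm_mul]
      refine mul_le_mul (hFK i n) ?_ (norm_nonneg _) ((norm_nonneg _).trans (hFK i n))
      refine ((φ i).le_opNorm _).trans ?_
      exact mul_le_mul (hφ i) (hHn n) (norm_nonneg _) ((norm_nonneg _).trans (hφ i))
  rw [tsum_zero] at hzero
  have := tendsto_nhds_unique (hzero.congr fun n => (hmain n).symm) (osc_sq_tendsto d hd)
  linarith
end

section
/- Let 1 ≤ p < ∞ and let (f_i, g_i)_{i≥1} be a Schauder frame for a closed subspace X of L_p(ℝ) satisfying condition (*): for every ε > 0 and every bounded interval I ⊆ ℝ there exists n ∈ ℕ such that for all m ≥ n and all f ∈ X, ‖χ_I · (f − Σ_{i=1}^m ⟨f, g_i⟩ f_i)‖_p ≤ ε ‖f‖_p (equivalently, the tail Σ_{i=m+1}^∞ ⟨f, g_i⟩ f_i restricted to I has L_p norm at most ε‖f‖_p). Then X embeds almost isometrically into ℓ_p: for every ε > 0 there is a linear map T : X → ℓ_p with (1+ε)^{−1}‖f‖_p ≤ ‖Tf‖ ≤ (1+ε)‖f‖_p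 for all f ∈ X. -/
open MeasureTheory ENNReal Filter Topology


theorem local_approx
    (p q : ℝ≥0∞) [Fact (1 ≤ p)] [Fact (1 ≤ q)] (hp' : p ≠ ∞)
    (hpq : p⁻¹ + q⁻¹ = 1)
    (X : Submodule ℝ (Lp ℝ p (volume : Measure ℝ)))
    (F : ℕ → Lp ℝ p (volume : Measure ℝ)) (G : ℕ → Lp ℝ q (volume : Measure ℝ))
    (hstar : ∀ ε > (0 : ℝ), ∀ a b : ℝ, ∃ n : ℕ, ∀ m ≥ n, ∀ f ∈ X,
      eLpNorm ((Set.Icc a b).indicator (fun t : ℝ =>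
          f t - (∑ i ∈ Finset.range m, (∫ s : ℝ, f s * G i s) • F i : Lp ℝ p (volume : Measure ℝ)) t))
        p volume ≤ ENNReal.ofReal (ε * ‖f‖)) (η : ℝ) (hη : 0 < η) (a b : ℝ) :
    ∃ (m : ℕ) (s : SimpleFunc ℝ (Fin m → ℝ)) (c : X →ₗ[ℝ] (Fin m → ℝ)), ∀ f : X,
      eLpNorm (fun t => (f : Lp ℝ p (volume : Measure ℝ)) t - ∑ i, c f i * s t i) p
        (volume.restrict (Set.Icc a b)) ≤ ENNReal.ofReal (η * ‖f‖) := by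
  have : HolderConjugate p q := ⟨by simpa using hpq⟩
  have hp1 : 1 ≤ p := Fact.out
  let L : ℕ → Lp ℝ p (volume : Measure ℝ) →L[ℝ] ℝ := fun i =>
    ((ContinuousLinearMap.mul ℝ ℝ).lpPairing volume p q).flip (G i)
  have hL : ∀ i f, L i f = ∫ t, f t * G i t := fun i f => by
    simp [L, ContinuousLinearMap.lpPairing_eq_integral]
  obtain ⟨m, hm⟩ := hstar (η / 2) (by positivity) a b
  have hH : MemLp (fun t (i : Fin m) => F i t) p volume :=
    memLp_pi_iff.2 fun i => Lp.memLp (F i)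
  let C : ℝ := ∑ i : Fin m, ‖L i‖
  have hC : 0 ≤ C := Finset.sum_nonneg fun _ _ => norm_nonneg _
  obtain ⟨s, hs, hs'⟩ := hH.exists_simpleFunc_eLpNorm_sub_lt hp'
    (ε := ENNReal.ofReal (η / 2 / (1 + C))) (by simpa using (by positivity))
  let c : X →ₗ[ℝ] (Fin m → ℝ) := LinearMap.pi fun i => (L i).toLinearMap ∘ₗ X.subtype
  have hc : ∀ f i, c f i = L i f := fun f i => rfl
  refine ⟨m, s, c, fun f => ?_⟩
  have h1 := hm m le_rfl f f.2
  rw [eLpNorm_indicator_eq_eLpNorm_restrict measurableSet_Icc] at h1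
  simp_rw [← hL] at h1
  have hsum : ⇑(∑ i ∈ Finset.range m, L i f • F i) =ᵐ[volume] fun t => ∑ i : Fin m, c f i * F i t := by
    have h2 : ∀ᵐ t ∂volume, ∀ i : ℕ, (L i f • F i) t = L i f * F i t := by
      rw [ae_all_iff]; intro i
      filter_upwards [Lp.coeFn_smul (L i f) (F i)] with t ht
      simpa using ht
    filter_upwards [Lp.coeFn_finsetSum (Finset.range m) (fun i => L i f • F i), h2] with t ht ht2
    rw [ht, Finset.sum_range]
    simp [hc, ht2]
  have h3 : eLpNorm (fun t => ∑ i : Fin m, c f i * (F i t - s t i)) p volume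
      ≤ ENNReal.ofReal (C * ‖f‖) * ENNReal.ofReal (η / 2 / (1 + C)) := by
    refine (eLpNorm_le_mul_eLpNorm_of_ae_le_mul (g := (fun t (i : Fin m) => F i t) - ⇑s) (c := C * ‖f‖) (ae_of_all _ fun t => ?_) p).trans ?_
    · rw [mul_assoc, Finset.sum_mul]
      refine (norm_sum_le _ _).trans (Finset.sum_le_sum fun i _ => ?_)
      rw [norm_mul, ← mul_assoc]
      gcongr
      · exact (L i).le_opNorm f
      · exact norm_le_pi_norm (((fun t (i : Fin m) => F i t) - ⇑s) t) i
    · gcongr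
  have hm1 : ∀ i : Fin m, AEStronglyMeasurable (fun t => s t i) volume := fun i =>
    ((measurable_pi_apply i).comp s.measurable).aestronglyMeasurable
  have hm2 : AEStronglyMeasurable (fun t => ∑ i : Fin m, c f i * (F i t - s t i)) volume := by
    refine Finset.aestronglyMeasurable_fun_sum _ fun i _ => ?_
    exact ((Lp.aestronglyMeasurable (F i)).sub (hm1 i)).const_mul _
  calc _ = eLpNorm ((fun t => (f : Lp ℝ p (volume : Measure ℝ)) t - (∑ i ∈ Finset.range m, L i f • F i : Lp ℝ p (volume : Measure ℝ)) t)
            + fun t => ∑ i : Fin m, c f i * (F i t - s t i)) p (volume.restrict (Set.Icc a b)) := by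
        refine eLpNorm_congr_ae (ae_restrict_of_ae ?_)
        filter_upwards [hsum] with t ht
        simp only [Pi.add_apply, ht, mul_sub, Finset.sum_sub_distrib]
        ring
    _ ≤ _ := eLpNorm_add_le (((Lp.aestronglyMeasurable _).sub (Lp.aestronglyMeasurable _)).restrict) hm2.restrict hp1
    _ ≤ ENNReal.ofReal (η / 2 * ‖f‖) + ENNReal.ofReal (C * ‖f‖) * ENNReal.ofReal (η / 2 / (1 + C)) :=
        add_le_add h1 ((eLpNorm_mono_measure _ Measure.restrict_le_self).trans h3)
    _ ≤ _ := by
        rw [← ENNReal.ofReal_mul (by positivity), ← ENNReal.ofReal_add (by positivity) (by positivity)]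
        apply ENNReal.ofReal_le_ofReal
        have : C * (η / 2 / (1 + C)) ≤ η / 2 := by
          rw [mul_div_assoc', div_le_iff₀ (by positivity)]; nlinarith
        nlinarith [norm_nonneg f]

theorem lp_of_countable {ι V : Type*} [Countable ι] [AddCommGroup V] [Module ℝ V]
    (p : ℝ≥0∞) [Fact (1 ≤ p)] (hp' : p ≠ ∞) (T0 : V →ₗ[ℝ] (ι → ℝ))
    (h : ∀ x, ∑' i, ‖T0 x i‖ₑ ^ p.toReal ≠ ∞) :
    ∃ T : V →ₗ[ℝ] lp (fun _ : ℕ => ℝ) p, ∀ x,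
      ENNReal.ofReal ‖T x‖ = (∑' i, ‖T0 x i‖ₑ ^ p.toReal) ^ (1 / p.toReal) := by
  have hp1 : 1 ≤ p := Fact.out
  have hr : 0 < p.toReal := ENNReal.toReal_pos (zero_lt_one.trans_le hp1).ne' hp'
  obtain ⟨e, he⟩ := exists_injective_nat ι
  let T1 : V →ₗ[ℝ] (ℕ → ℝ) := Function.ExtendByZero.linearMap ℝ e ∘ₗ T0
  have hT1 : ∀ x, ∑' n, ‖T1 x n‖ₑ ^ p.toReal = ∑' i, ‖T0 x i‖ₑ ^ p.toReal := by
    intro x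
    rw [← tsum_extend_zero he]
    congr 1
    ext n
    by_cases hn : ∃ i, e i = n
    · obtain ⟨i, rfl⟩ := hn
      simp [T1, he.extend_apply]
    · simp [T1, Function.extend_apply' _ _ _ hn, hr]
  have henorm : ∀ y : ℝ, ENNReal.ofReal (‖y‖ ^ p.toReal) = ‖y‖ₑ ^ p.toReal := fun y => by
    rw [← ENNReal.ofReal_rpow_of_nonneg (norm_nonneg _) hr.le, ofReal_norm]
  have hsum : ∀ x, Summable fun n => ‖T1 x n‖ ^ p.toReal := by
    intro x
    have h2 := h x
    rw [← hT1] at h2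
    refine (ENNReal.summable_toReal h2).congr fun n => ?_
    rw [← henorm, ENNReal.toReal_ofReal (by positivity)]
  refine ⟨{ toFun := fun x => ⟨T1 x, memℓp_gen (hsum x)⟩
            map_add' := fun x y => by ext n; simp; rfl
            map_smul' := fun a x => by ext n; simp }, fun x => ?_⟩
  rw [lp.norm_eq_tsum_rpow hr, ← ENNReal.ofReal_rpow_of_nonneg (tsum_nonneg fun _ => by positivity) (by positivity), ← hT1]
  congr 1
  change ENNReal.ofReal (∑' n, ‖T1 x n‖ ^ p.toReal) = _
  rw [ENNReal.ofReal_tsum_of_nonneg (fun _ => by positivity) (hsum x)]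
  simp only [henorm]

theorem glue (p : ℝ≥0∞) [Fact (1 ≤ p)] (hp' : p ≠ ∞)
    (X : Submodule ℝ (Lp ℝ p (volume : Measure ℝ)))
    (happ : ∀ η > (0 : ℝ), ∀ a b : ℝ,
      ∃ (m : ℕ) (s : SimpleFunc ℝ (Fin m → ℝ)) (c : X →ₗ[ℝ] (Fin m → ℝ)), ∀ f : X,
      eLpNorm (fun t => (f : Lp ℝ p (volume : Measure ℝ)) t - ∑ i, c f i * s t i) p
        (volume.restrict (Set.Icc a b)) ≤ ENNReal.ofReal (η * ‖f‖)) (δ : ℝ) (hδ : 0 < δ) :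
    ∃ T : X →ₗ[ℝ] lp (fun _ : ℕ => ℝ) p, ∀ x : X, ‖x‖ ≤ ‖T x‖ + δ * ‖x‖ ∧ ‖T x‖ ≤ ‖x‖ + δ * ‖x‖ := by
  have hp1 : 1 ≤ p := Fact.out
  have hp0 : p ≠ 0 := (zero_lt_one.trans_le hp1).ne'
  have hr : 0 < p.toReal := ENNReal.toReal_pos hp0 hp'
  set r := p.toReal with hrdef
  have hη : ∀ k : ℕ, 0 < δ * ((1 / 2 : ℝ) ^ (k + 1)) ^ (1 / r) := fun k => by positivity
  choose m s c hc using fun k : ℕ => happ _ (hη k) (-(k + 1)) (k + 1)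
  let N : ℝ → ℕ := fun t => ⌊|t|⌋₊
  have hN : Measurable N := Nat.measurable_floor.comp measurable_norm
  let A : ℕ → Set ℝ := fun k => N ⁻¹' {k}
  have hA : ∀ k, MeasurableSet (A k) := fun k => hN (measurableSet_singleton k)
  have hAsub : ∀ k, A k ⊆ Set.Icc (-(k + 1 : ℝ)) (k + 1) := by
    intro k t ht
    have h1 : ⌊|t|⌋₊ = k := ht
    have h2 := (Nat.lt_floor_add_one |t|).le
    rw [h1] at h2
    exact abs_le.1 h2
  have hsplit : ∀ g : ℝ → ℝ≥0∞, ∫⁻ t, g t = ∑' k, ∫⁻ t in A k, g t := by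
    intro g
    rw [← lintegral_iUnion hA, ← setLIntegral_univ]
    · congr
      ext t; simp [A]
    · intro i j hij
      exact Set.disjoint_iff.2 fun t ⟨h1, h2⟩ => hij (h1.symm.trans h2)
  let u : ∀ k : ℕ, X → ℝ → ℝ := fun k f t => ∑ i, c k f i * s k t i
  let U : X → ℝ → ℝ := fun f t => u (N t) f t
  have hu : ∀ k f, Measurable (u k f) := fun k f => by
    refine Finset.measurable_fun_sum _ fun i _ => ?_
    exact ((measurable_pi_apply i).comp (s k).measurable).const_mul _
  have hU : ∀ f, Measurable (U f) := fun f => by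
    have : Measurable fun z : ℕ × ℝ => u z.1 f z.2 :=
      measurable_from_prod_countable_right fun k => hu k f
    exact this.comp (hN.prodMk measurable_id)
  -- approximation
  have herr : ∀ f : X, eLpNorm (fun t => (f : Lp ℝ p (volume : Measure ℝ)) t - U f t) p volume
      ≤ ENNReal.ofReal (δ * ‖f‖) := by
    intro f
    rw [eLpNorm_eq_lintegral_rpow_enorm_toReal hp0 hp', one_div,
      ENNReal.rpow_inv_le_iff hr, hsplit]
    calc _ ≤ ∑' k : ℕ, ENNReal.ofReal (δ * ‖f‖) ^ r * (2⁻¹ : ℝ≥0∞) ^ (k + 1) := by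
          refine ENNReal.tsum_le_tsum fun k => ?_
          have h1 := (eLpNorm_mono_measure _ (Measure.restrict_mono (hAsub k) le_rfl)).trans (hc k f)
          rw [eLpNorm_eq_lintegral_rpow_enorm_toReal hp0 hp', one_div,
            ENNReal.rpow_inv_le_iff hr] at h1
          refine (le_of_eq ?_).trans (h1.trans (le_of_eq ?_))
          · refine setLIntegral_congr_fun (hA k) fun t ht => ?_
            have : N t = k := ht
            simp only [U, u]
            subst this
            rfl
          · rw [mul_right_comm, ENNReal.ofReal_mul (by positivity), ENNReal.mul_rpow_of_nonneg _ _ hr.le]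
            congr 1
            rw [ENNReal.ofReal_rpow_of_nonneg (by positivity) hr.le, ← Real.rpow_mul (by positivity),
              ← hrdef, inv_mul_cancel₀ hr.ne', Real.rpow_one, ENNReal.ofReal_pow (by positivity), one_div,
              ENNReal.ofReal_inv_of_pos (by norm_num)]
            simp
      _ = _ := by
          rw [ENNReal.tsum_mul_left, ENNReal.tsum_geometric_add_one, ENNReal.one_sub_inv_two, inv_inv,
            ENNReal.inv_mul_cancel (by simp) (by simp), mul_one]
  -- the coordinates
  let ι := Σ k : ℕ, (s k).range
  let w : ι → ℝ≥0∞ := fun j => volume (s j.1 ⁻¹' {j.2.1} ∩ A j.1)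
  have hw : ∀ j, w j ≠ ∞ := fun j => by
    refine ((measure_mono (Set.inter_subset_right.trans (hAsub j.1))).trans_lt ?_).ne
    simp
  let T0 : X →ₗ[ℝ] (ι → ℝ) := LinearMap.pi fun j =>
    { toFun := fun f => (∑ i, c j.1 f i * j.2.1 i) * (w j).toReal ^ (1 / r)
      map_add' := fun f g => by simp [add_mul, Finset.sum_add_distrib]
      map_smul' := fun a f => by simp [Finset.mul_sum, mul_assoc, Finset.sum_mul] }
  have hT0 : ∀ f, ∑' j, ‖T0 f j‖ₑ ^ r = ∫⁻ t, ‖U f t‖ₑ ^ r := by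
    intro f
    have h1 : ∀ j : ι, ‖T0 f j‖ₑ ^ r = (fun (k : ℕ) (v : (s k).range) =>
        ‖∑ i, c k f i * v.1 i‖ₑ ^ r * volume (s k ⁻¹' {v.1} ∩ A k)) j.1 j.2 := by
      intro j
      change ‖(∑ i, c j.1 f i * j.2.1 i) * (w j).toReal ^ (1 / r)‖ₑ ^ r = _
      rw [enorm_mul, ENNReal.mul_rpow_of_nonneg _ _ hr.le]
      congr 1
      rw [Real.enorm_of_nonneg (by positivity), ENNReal.ofReal_rpow_of_nonneg (by positivity) hr.le,
        ← Real.rpow_mul (by positivity), one_div_mul_cancel hr.ne', Real.rpow_one,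
        ENNReal.ofReal_toReal (hw j)]
    rw [tsum_congr h1, hsplit]
    refine (ENNReal.tsum_sigma (fun (k : ℕ) (v : (s k).range) =>
        ‖∑ i, c k f i * v.1 i‖ₑ ^ r * volume (s k ⁻¹' {v.1} ∩ A k))).trans ?_
    refine tsum_congr fun k => ?_
    have h2 : ∫⁻ t in A k, ‖U f t‖ₑ ^ r = ∫⁻ t in A k, ((s k).map fun v => ‖∑ i, c k f i * v i‖ₑ ^ r) t := by
      refine setLIntegral_congr_fun (hA k) fun t ht => ?_
      have : N t = k := ht
      simp only [U, u]
      subst this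
      rfl
    rw [h2, SimpleFunc.lintegral_eq_lintegral, SimpleFunc.map_lintegral, tsum_fintype,
      Finset.sum_coe_sort (s k).range
        (fun v => ‖∑ i, c k f i * v i‖ₑ ^ r * volume (s k ⁻¹' {v} ∩ A k))]
    refine Finset.sum_congr rfl fun v _ => ?_
    rw [Measure.restrict_apply ((s k).measurableSet_preimage _)]
  have hT0' : ∀ f, (∑' j, ‖T0 f j‖ₑ ^ r) ^ (1 / r) = eLpNorm (U f) p volume := fun f => by
    rw [hT0, eLpNorm_eq_lintegral_rpow_enorm_toReal hp0 hp']
  have hf : ∀ f : X, eLpNorm (f : Lp ℝ p (volume : Measure ℝ)) p volume = ENNReal.ofReal ‖f‖ := fun f => by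
    rw [Submodule.coe_norm, Lp.norm_def, ENNReal.ofReal_toReal (Lp.eLpNorm_ne_top _)]
  have hle1 : ∀ f : X, eLpNorm (U f) p volume ≤ ENNReal.ofReal (‖f‖ + δ * ‖f‖) := by
    intro f
    have h1 : U f = ⇑(f : Lp ℝ p (volume : Measure ℝ)) - fun t => (f : Lp ℝ p (volume : Measure ℝ)) t - U f t := by
      ext t; simp
    rw [h1, ENNReal.ofReal_add (by positivity) (by positivity), ← hf]
    exact (eLpNorm_sub_le (Lp.aestronglyMeasurable _)
      ((Lp.aestronglyMeasurable _).sub (hU f).aestronglyMeasurable) hp1).trans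
      (add_le_add le_rfl (herr f))
  have hle2 : ∀ f : X, ENNReal.ofReal ‖f‖ ≤ eLpNorm (U f) p volume + ENNReal.ofReal (δ * ‖f‖) := by
    intro f
    have h1 : ⇑(f : Lp ℝ p (volume : Measure ℝ)) = U f + fun t => (f : Lp ℝ p (volume : Measure ℝ)) t - U f t := by
      ext t; simp
    rw [← hf]
    conv_lhs => rw [h1]
    exact (eLpNorm_add_le (hU f).aestronglyMeasurable
      ((Lp.aestronglyMeasurable _).sub (hU f).aestronglyMeasurable) hp1).trans
      (add_le_add le_rfl (herr f))
  obtain ⟨T, hT⟩ := lp_of_countable p hp' T0 (fun f => by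
    have h1 := (hle1 f).trans_lt ENNReal.ofReal_lt_top
    rw [← hT0'] at h1
    intro h2
    rw [← hrdef] at h2
    rw [h2, ENNReal.top_rpow_of_pos (by positivity)] at h1
    exact absurd h1 (lt_irrefl _))
  refine ⟨T, fun f => ?_⟩
  have hTf := (hT f).trans (hT0' f)
  constructor
  · have := hle2 f
    rw [← hTf, ← ENNReal.ofReal_add (by positivity) (by positivity)] at this
    exact (ENNReal.ofReal_le_ofReal_iff (by positivity)).1 this
  · have := hle1 f
    rw [← hTf] at this
    exact (ENNReal.ofReal_le_ofReal_iff (by positivity)).1 this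


/-- A Schauder frame `(f_i, g_i)` for a closed subspace `X` of `L_p(ℝ)`
(`1 ≤ p < ∞`) satisfying condition `(*)` (uniform smallness of tails on bounded
intervals) forces `X` to embed almost isometrically into `ℓ_p`. -/
theorem frame_with_star_embeds_almost_isometrically
    (p q : ℝ≥0∞) [Fact (1 ≤ p)] [Fact (1 ≤ q)] (hp : 1 ≤ p) (hp' : p ≠ ∞)
    (hpq : p⁻¹ + q⁻¹ = 1)
    (X : Submodule ℝ (Lp ℝ p (volume : Measure ℝ))) (hX : IsClosed (X : Set (Lp ℝ p (volume : Measure ℝ))))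
    (F : ℕ → Lp ℝ p (volume : Measure ℝ)) (G : ℕ → Lp ℝ q (volume : Measure ℝ))
    (hframe : ∀ f ∈ X,
      Tendsto (fun n : ℕ => ∑ i ∈ Finset.range n, (∫ t : ℝ, f t * G i t) • F i)
        atTop (𝓝 f))
    (hstar : ∀ ε > (0 : ℝ), ∀ a b : ℝ, ∃ n : ℕ, ∀ m ≥ n, ∀ f ∈ X,
      eLpNorm ((Set.Icc a b).indicator (fun t : ℝ =>
          f t - (∑ i ∈ Finset.range m, (∫ s : ℝ, f s * G i s) • F i : Lp ℝ p (volume : Measure ℝ)) t))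
        p volume ≤ ENNReal.ofReal (ε * ‖f‖)) :
    ∀ ε > (0 : ℝ), ∃ T : X →ₗ[ℝ] lp (fun _ : ℕ => ℝ) p,
      ∀ x : X, (1 + ε)⁻¹ * ‖x‖ ≤ ‖T x‖ ∧ ‖T x‖ ≤ (1 + ε) * ‖x‖ := by
  intro ε hε
  obtain ⟨T, hT⟩ := glue p hp' X (fun η hη a b => local_approx p q hp' hpq X F G hstar η hη a b)
    (ε / (1 + ε)) (by positivity)
  refine ⟨T, fun x => ?_⟩
  obtain ⟨h1, h2⟩ := hT x
  have h3 : ε / (1 + ε) = 1 - (1 + ε)⁻¹ := by field_simp; ring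
  have h4 : ε / (1 + ε) ≤ ε := div_le_self hε.le (by linarith)
  constructor
  · rw [h3] at h1
    linarith
  · nlinarith [norm_nonneg x]
end

section
/- Let f ∈ L_1(ℝ), let (λ_i)_{i≥1} be uniformly discrete, set f_i = f_(λ_i), and let X be the closed linear span of (f_i)_{i≥1} in L_1(ℝ). Suppose either (f_i, g_i)_{i≥1} is a Schauder frame for X for some g_i ∈ L_∞(ℝ), or there exist g_i ∈ L_∞(ℝ) with ∫_ℝ f_i g_j = δ_{ij} and sup_i ‖g_i‖_∞ < ∞. Then X embeds almost isometrically into ℓ_1: for every ε > 0 there is a linear map T : X → ℓ_1 with (1+ε)^{−1}‖f‖_1 ≤ ‖Tf‖ ≤ (1+ε)‖f‖_1 for all f ∈ X. -/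
open MeasureTheory ENNReal Filter Topology

lemma aux_cell_sum (f : ℝ → ℝ) (lam : ℕ → ℝ) (δ : ℝ) (hδ : 0 < δ)
    (hlam : ∀ i j : ℕ, i ≠ j → δ ≤ |lam i - lam j|)
    (F : ℕ → ℝ → ℝ) (hF : ∀ i, F i =ᵐ[volume] fun x => f (x - lam i)) (n : ℤ) :
    ∑' i, ∫⁻ x in {x : ℝ | ⌊x / δ⌋ = n}, ‖F i x‖ₑ ≤ ∫⁻ x, ‖f x‖ₑ := by
  have hJ : MeasurableSet {x : ℝ | ⌊x / δ⌋ = n} :=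
    (Int.measurable_floor.comp (measurable_id.div_const δ)) (measurableSet_singleton n)
  have h1 : ∀ i, ∫⁻ x in {x : ℝ | ⌊x / δ⌋ = n}, ‖F i x‖ₑ
      = ∫⁻ y in {y : ℝ | ⌊(y + lam i) / δ⌋ = n}, ‖f y‖ₑ := by
    intro i
    have hJ' : MeasurableSet {y : ℝ | ⌊(y + lam i) / δ⌋ = n} :=
      (measurable_id.add_const (lam i)) hJ
    rw [lintegral_congr_ae (g := fun x => ‖f (x - lam i)‖ₑ)]
    · rw [← lintegral_indicator hJ, ← lintegral_indicator hJ',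
        ← lintegral_sub_right_eq_self
          (Set.indicator {y : ℝ | ⌊(y + lam i) / δ⌋ = n} fun y => ‖f y‖ₑ) (lam i)]
      congr 1
      ext x
      simp [Set.indicator]
    · filter_upwards [ae_restrict_of_ae (hF i)] with x hx
      rw [hx]
  simp_rw [h1]
  rw [← lintegral_iUnion]
  · exact setLIntegral_le_lintegral _ _
  · intro i
    exact (measurable_id.add_const (lam i)) hJ
  · intro i j hij
    refine Set.disjoint_left.2 ?_
    intro y hy hy'
    simp only [Set.mem_ofPred_eq] at hy hy'
    have h := hlam i j hij
    have h2 := Int.abs_sub_lt_one_of_floor_eq_floor (hy.trans hy'.symm)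
    have h3 : (y + lam i) / δ - (y + lam j) / δ = (lam i - lam j) / δ := by ring
    rw [h3, abs_div, abs_of_pos hδ, div_lt_one hδ] at h2
    linarith

lemma aux_cell_vol (δ : ℝ) (hδ : 0 < δ) (n : ℤ) :
    volume {x : ℝ | ⌊x / δ⌋ = n} = ENNReal.ofReal δ := by
  have : {x : ℝ | ⌊x / δ⌋ = n} = Set.Ico (n * δ) ((n + 1) * δ) := by
    ext x
    simp [Int.floor_eq_iff, le_div_iff₀ hδ, div_lt_iff₀ hδ]
  rw [this, Real.volume_Ico]
  congr 1; ring

lemma aux_partition (F : ℕ → ℝ → ℝ) (hFm : ∀ i, Measurable (F i)) (δ : ℝ) (hδ : 0 < δ)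
    (hsum : ∀ n : ℤ, ∑' i, ∫⁻ x in {x : ℝ | ⌊x / δ⌋ = n}, ‖F i x‖ₑ ≠ ⊤)
    (η : ℝ≥0∞) (hη : η ≠ 0) :
    ∃ (φ : ℝ → ℕ) (h : ℕ → ℕ → ℝ), Measurable φ ∧
      ∑' i, ∫⁻ x, ‖F i x - h i (φ x)‖ₑ ≤ η := by
  obtain ⟨e, he, hes⟩ := ENNReal.exists_pos_sum_of_countable (ε := η / 2) (by simpa using hη) ℤ
  have hN : ∀ n : ℤ, ∃ N : ℕ, ∑' k, ∫⁻ x in {x : ℝ | ⌊x / δ⌋ = n}, ‖F (k + N) x‖ₑ < e n := by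
    intro n
    exact ((ENNReal.tendsto_sum_nat_add _ (hsum n)).eventually
      (gt_mem_nhds (by simpa using he n))).exists
  choose N hN using hN
  have hJ : ∀ n : ℤ, MeasurableSet {x : ℝ | ⌊x / δ⌋ = n} := fun n =>
    (Int.measurable_floor.comp (measurable_id.div_const δ)) (measurableSet_singleton n)
  let ρ : ℤ → ℝ := fun n => e n / ((N n + 1) * δ)
  have hρ : ∀ n, 0 < ρ n := fun n => by
    have := he n
    have : (0:ℝ) < e n := by exact_mod_cast this
    positivity
  let ψ : (n : ℤ) → ℝ → (Fin (N n) → ℤ) := fun n x i => ⌊F i x / ρ n⌋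
  have hψ : ∀ n, Measurable (ψ n) := fun n => measurable_pi_lambda _ fun i =>
    Int.measurable_floor.comp ((hFm i).div_const _)
  let θ : ℤ × ℝ → ℕ := fun p => Nat.pair (Encodable.encode p.1) (Encodable.encode (ψ p.1 p.2))
  have hθ : Measurable θ := by
    refine measurable_from_prod_countable_right fun n => ?_
    have : Measurable (fun v : Fin (N n) → ℤ => Nat.pair (Encodable.encode n) (Encodable.encode v)) :=
      measurable_of_countable _
    exact this.comp (hψ n)
  let s : ℕ → ℝ → ℝ := fun i x =>
    if i < N ⌊x / δ⌋ then ρ ⌊x / δ⌋ * (⌊F i x / ρ ⌊x / δ⌋⌋ : ℤ) else 0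
  let φ : ℝ → ℕ := fun x => θ (⌊x / δ⌋, x)
  have hφ : Measurable φ :=
    hθ.comp ((Int.measurable_floor.comp (measurable_id.div_const δ)).prodMk measurable_id)
  have hfac : ∀ i, Function.FactorsThrough (s i) φ := by
    intro i x y hxy
    simp only [φ, θ, Nat.pair_eq_pair] at hxy
    obtain ⟨h1, h2⟩ := hxy
    have h1 := Encodable.encode_injective h1
    simp only [s]
    generalize ⌊x / δ⌋ = n at *
    subst h1
    have h2 := Encodable.encode_injective h2
    split_ifs with hi
    · have := congrFun h2 ⟨i, hi⟩
      simp only [ψ] at this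
      rw [this]
    · rfl
  have hfac' : ∀ i, ∃ h : ℕ → ℝ, s i = h ∘ φ := fun i =>
    (Function.factorsThrough_iff _).1 (hfac i)
  choose h hh using hfac'
  refine ⟨φ, h, hφ, ?_⟩
  have hu : (⋃ n : ℤ, {x : ℝ | ⌊x / δ⌋ = n}) = Set.univ := by ext; simp
  have key : ∀ i, ∫⁻ x, ‖F i x - h i (φ x)‖ₑ
      = ∑' n : ℤ, ∫⁻ x in {x : ℝ | ⌊x / δ⌋ = n}, ‖F i x - s i x‖ₑ := by
    intro i
    rw [← lintegral_iUnion hJ, hu, setLIntegral_univ, hh i]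
    · rfl
    · intro a b hab
      refine Set.disjoint_left.2 fun x hx hx' => hab ?_
      exact hx.symm.trans hx'
  simp_rw [key]
  rw [ENNReal.tsum_comm]
  calc _ ≤ ∑' n : ℤ, ((e n : ℝ≥0∞) + e n) := by
        refine ENNReal.tsum_le_tsum fun n => ?_
        rw [← Summable.sum_add_tsum_nat_add' (k := N n) ENNReal.summable]
        refine add_le_add ?_ ?_
        · calc _ ≤ ∑ i ∈ Finset.range (N n), ENNReal.ofReal (ρ n) * ENNReal.ofReal δ := by
                refine Finset.sum_le_sum fun i hi => ?_
                rw [← aux_cell_vol δ hδ n, ← setLIntegral_const]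
                refine setLIntegral_mono measurable_const fun x hx => ?_
                simp only [Set.mem_ofPred_eq] at hx
                simp only [s, hx, if_pos (Finset.mem_range.1 hi)]
                rw [← ofReal_norm]
                refine ENNReal.ofReal_le_ofReal ?_
                have h1 := Int.floor_le (F i x / ρ n)
                have h2 := Int.lt_floor_add_one (F i x / ρ n)
                rw [le_div_iff₀ (hρ n)] at h1
                rw [div_lt_iff₀ (hρ n)] at h2
                rw [Real.norm_eq_abs, abs_le]
                constructor <;> linarith [hρ n]
          _ ≤ e n := by
                rw [Finset.sum_const, Finset.card_range, nsmul_eq_mul,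
                  ← ENNReal.ofReal_mul (hρ n).le, ← ENNReal.ofReal_natCast,
                  ← ENNReal.ofReal_mul (by positivity), ← ENNReal.ofReal_coe_nnreal]
                refine ENNReal.ofReal_le_ofReal ?_
                have : (N n : ℝ) * (ρ n * δ) = e n * (N n / (N n + 1)) := by
                  simp only [ρ]; field_simp
                rw [this]
                refine mul_le_of_le_one_right (by positivity) ?_
                rw [div_le_one (by positivity)]; linarith
        · refine le_trans (ENNReal.tsum_le_tsum fun i => ?_) (hN n).le
          refine setLIntegral_mono (hFm _).enorm fun x hx => ?_
          simp only [Set.mem_ofPred_eq] at hx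
          simp [s, hx]
    _ = (∑' n : ℤ, (e n : ℝ≥0∞)) + ∑' n : ℤ, (e n : ℝ≥0∞) := ENNReal.tsum_add
    _ ≤ η / 2 + η / 2 := add_le_add hes.le hes.le
    _ = η := ENNReal.add_halves η

lemma aux_cells (φ : ℝ → ℕ) (hφ : Measurable φ) (u : ℝ → ℝ) (hu : Integrable u) :
    HasSum (fun k => ∫ x in φ ⁻¹' {k}, u x) (∫ x, u x) := by
  have hU : (⋃ k, φ ⁻¹' {k}) = Set.univ := by ext; simp
  have := hasSum_integral_iUnion (f := u) (μ := volume) (s := fun k : ℕ => φ ⁻¹' {k})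
    (fun k => hφ (measurableSet_singleton k))
    (fun a b hab => Set.disjoint_left.2 fun x hx hx' => hab (by
      simp only [Set.mem_preimage, Set.mem_singleton_iff] at hx hx'
      exact hx.symm.trans hx')) (by rw [hU]; exact hu.integrableOn)
  rwa [hU, setIntegral_univ] at this

lemma aux_T (φ : ℝ → ℕ) (hφ : Measurable φ) :
    ∃ T : Lp ℝ 1 (volume : Measure ℝ) →ₗ[ℝ] lp (fun _ : ℕ => ℝ) 1,
      (∀ x, ‖T x‖ ≤ ‖x‖) ∧
      ∀ (x : Lp ℝ 1 (volume : Measure ℝ)) (h : ℕ → ℝ), x =ᵐ[volume] (fun t => h (φ t)) →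
        ‖T x‖ = ‖x‖ := by
  have hle : ∀ (x : Lp ℝ 1 (volume : Measure ℝ)) (k : ℕ),
      ‖∫ t in φ ⁻¹' {k}, x t‖ ≤ ∫ t in φ ⁻¹' {k}, ‖x t‖ :=
    fun x k => norm_integral_le_integral_norm _
  have hs := fun x : Lp ℝ 1 (volume : Measure ℝ) =>
    aux_cells φ hφ (fun t => ‖x t‖) (L1.integrable_coeFn x).norm
  have hsum : ∀ x : Lp ℝ 1 (volume : Measure ℝ),
      Summable fun k : ℕ => ‖∫ t in φ ⁻¹' {k}, x t‖ := fun x =>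
    Summable.of_nonneg_of_le (fun _ => norm_nonneg _) (hle x) (hs x).summable
  have hmem : ∀ x : Lp ℝ 1 (volume : Measure ℝ),
      Memℓp (fun k : ℕ => ∫ t in φ ⁻¹' {k}, x t) 1 := fun x =>
    memℓp_gen (by simpa using hsum x)
  let T : Lp ℝ 1 (volume : Measure ℝ) →ₗ[ℝ] lp (fun _ : ℕ => ℝ) 1 :=
    { toFun := fun x => ⟨fun k : ℕ => ∫ t in φ ⁻¹' {k}, x t, hmem x⟩
      map_add' := by
        intro x y
        ext k
        change ∫ t in φ ⁻¹' {k}, (x + y : Lp ℝ 1 (volume : Measure ℝ)) t = 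
          (∫ t in φ ⁻¹' {k}, x t) + ∫ t in φ ⁻¹' {k}, y t
        rw [← integral_add (L1.integrable_coeFn x).integrableOn (L1.integrable_coeFn y).integrableOn]
        exact integral_congr_ae (ae_restrict_of_ae (Lp.coeFn_add x y))
      map_smul' := by
        intro c x
        ext k
        change ∫ t in φ ⁻¹' {k}, (c • x : Lp ℝ 1 (volume : Measure ℝ)) t = 
          c • (∫ t in φ ⁻¹' {k}, x t)
        rw [← integral_smul]
        exact integral_congr_ae (ae_restrict_of_ae (Lp.coeFn_smul c x)) }
  have hT : ∀ x, ‖T x‖ = ∑' k : ℕ, ‖∫ t in φ ⁻¹' {k}, x t‖ := by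
    intro x
    rw [lp.norm_eq_tsum_rpow (by simp)]
    simp [T]
  refine ⟨T, fun x => ?_, fun x h hx => ?_⟩
  · rw [hT, L1.norm_eq_integral_norm, ← (hs x).tsum_eq]
    exact (hsum x).tsum_le_tsum (hle x) (hs x).summable
  · rw [hT, L1.norm_eq_integral_norm, ← (hs x).tsum_eq]
    congr 1
    ext k
    have hc : ∀ᵐ t ∂(volume.restrict (φ ⁻¹' {k})), x t = h k := by
      filter_upwards [ae_restrict_of_ae hx, ae_restrict_mem (hφ (measurableSet_singleton k))]
        with t ht ht'
      rw [ht]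
      simp only [Set.mem_preimage, Set.mem_singleton_iff] at ht'
      rw [ht']
    rw [integral_congr_ae (g := fun _ => h k) hc,
      integral_congr_ae (f := fun t => ‖x t‖) (g := fun _ => ‖h k‖)
        (by filter_upwards [hc] with t ht; rw [ht])]
    simp

lemma aux_const (φ : ℝ → ℕ) (S : ℕ → Lp ℝ 1 (volume : Measure ℝ)) (h : ℕ → ℕ → ℝ)
    (hS : ∀ i, S i =ᵐ[volume] fun t => h i (φ t)) (a : ℕ → ℝ) (n : ℕ) :
    (∑ i ∈ Finset.range n, a i • S i : Lp ℝ 1 (volume : Measure ℝ)) =ᵐ[volume]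
      fun t => (fun k => ∑ i ∈ Finset.range n, a i * h i k) (φ t) := by
  induction n with
  | zero =>
    simp only [Finset.range_zero, Finset.sum_empty]
    exact Lp.coeFn_zero _ _ _
  | succ n ih =>
    rw [Finset.sum_range_succ]
    filter_upwards [Lp.coeFn_add (∑ i ∈ Finset.range n, a i • S i) (a n • S n),
      Lp.coeFn_smul (a n) (S n), ih, hS n] with t h1 h2 h3 h4
    rw [h1, Pi.add_apply, h2, h3, Pi.smul_apply, h4, Finset.sum_range_succ, smul_eq_mul]

lemma aux_embed (F : ℕ → Lp ℝ 1 (volume : Measure ℝ)) (φ : ℝ → ℕ) (hφ : Measurable φ)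
    (h : ℕ → ℕ → ℝ) (η : ℝ) (hη : 0 ≤ η)
    (hsum : ∑' i, ∫⁻ x, ‖F i x - h i (φ x)‖ₑ ≤ ENNReal.ofReal η) :
    ∃ T : Lp ℝ 1 (volume : Measure ℝ) →ₗ[ℝ] lp (fun _ : ℕ => ℝ) 1,
      (∀ x, ‖T x‖ ≤ ‖x‖) ∧
      ∀ (x : Lp ℝ 1 (volume : Measure ℝ)) (a : ℕ → ℝ) (C : ℝ),
        Tendsto (fun n : ℕ => ∑ i ∈ Finset.range n, a i • F i) atTop (𝓝 x) →
        (∀ i, |a i| ≤ C) → ‖x‖ - 2 * (C * η) ≤ ‖T x‖ := by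
  obtain ⟨T, hT1, hT2⟩ := aux_T φ hφ
  refine ⟨T, hT1, ?_⟩
  have hfin : ∀ i, ∫⁻ x, ‖F i x - h i (φ x)‖ₑ ≤ ENNReal.ofReal η := fun i =>
    (ENNReal.le_tsum i).trans hsum
  have hhm : ∀ i, Measurable fun t => h i (φ t) := fun i =>
    (measurable_of_countable (h i)).comp hφ
  have hint' : ∀ i, Integrable (fun t => F i t - h i (φ t)) := fun i =>
    ⟨((Lp.stronglyMeasurable (F i)).measurable.sub (hhm i)).aestronglyMeasurable,
      (hfin i).trans_lt ENNReal.ofReal_lt_top⟩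
  have hint : ∀ i, Integrable (fun t => h i (φ t)) := fun i => by
    refine ((L1.integrable_coeFn (F i)).sub (hint' i)).congr (Eventually.of_forall fun t => ?_)
    simp
  let S : ℕ → Lp ℝ 1 (volume : Measure ℝ) := fun i => (hint i).toL1 _
  have hS : ∀ i, S i =ᵐ[volume] fun t => h i (φ t) := fun i => (hint i).coeFn_toL1
  have hd : ∀ i, ENNReal.ofReal ‖F i - S i‖ = ∫⁻ x, ‖F i x - h i (φ x)‖ₑ := by
    intro i
    rw [L1.ofReal_norm_eq_lintegral]
    refine lintegral_congr_ae ?_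
    filter_upwards [hS i, Lp.coeFn_sub (F i) (S i)] with t h1 h2
    rw [h2, Pi.sub_apply, h1]
  have hdn : ∀ n, ∑ i ∈ Finset.range n, ‖F i - S i‖ ≤ η := by
    intro n
    rw [← ENNReal.ofReal_le_ofReal_iff hη, ENNReal.ofReal_sum_of_nonneg fun _ _ => norm_nonneg _]
    simp_rw [hd]
    exact (ENNReal.sum_le_tsum _).trans hsum
  have hTc : Continuous T := (T.mkContinuous 1 (by simpa using hT1)).continuous
  intro x a C hx ha
  have hC : 0 ≤ C := (abs_nonneg _).trans (ha 0)
  refine le_of_tendsto_of_tendsto' (hx.norm.sub_const _) ((hTc.tendsto x).comp hx).norm fun n => ?_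
  simp only [Function.comp]
  set X := ∑ i ∈ Finset.range n, a i • F i
  set Y := ∑ i ∈ Finset.range n, a i • S i with hY
  have h1 : ‖T Y‖ = ‖Y‖ := hT2 Y (fun k => ∑ i ∈ Finset.range n, a i * h i k) (aux_const φ S h hS a n)
  have h2 : ‖X - Y‖ ≤ C * η := by
    simp only [X, Y]
    rw [← Finset.sum_sub_distrib]
    calc _ ≤ ∑ i ∈ Finset.range n, ‖a i • F i - a i • S i‖ := norm_sum_le _ _
      _ ≤ ∑ i ∈ Finset.range n, C * ‖F i - S i‖ := by
        refine Finset.sum_le_sum fun i _ => ?_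
        rw [← smul_sub, norm_smul]
        exact mul_le_mul_of_nonneg_right (ha i) (norm_nonneg _)
      _ ≤ C * η := by
        rw [← Finset.mul_sum]
        exact mul_le_mul_of_nonneg_left (hdn n) hC
  have h3 : ‖T X - T Y‖ ≤ ‖X - Y‖ := by rw [← map_sub]; exact hT1 _
  have h4 : ‖T Y‖ - ‖T X‖ ≤ ‖T X - T Y‖ := by
    rw [norm_sub_rev]; exact norm_sub_norm_le _ _
  have h5 : ‖X‖ - ‖Y‖ ≤ ‖X - Y‖ := norm_sub_norm_le _ _
  linarith

lemma aux_pair (g : Lp ℝ ⊤ (volume : Measure ℝ)) :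
    ∃ G : Lp ℝ 1 (volume : Measure ℝ) →ₗ[ℝ] ℝ,
      (∀ x, G x = ∫ t, x t * g t) ∧ ∀ x, ‖G x‖ ≤ ‖g‖ * ‖x‖ := by
  have hg : ∀ᵐ t, ‖g t‖ ≤ ‖g‖ := by
    have h := ae_le_eLpNormEssSup (f := (g : ℝ → ℝ)) (μ := volume)
    have hlt := (Lp.memLp g).2
    filter_upwards [h] with t ht
    rw [Lp.norm_def, ← toReal_enorm]
    exact ENNReal.toReal_mono hlt.ne (by simpa using ht)
  have hi : ∀ x : Lp ℝ 1 (volume : Measure ℝ), Integrable fun t => x t * g t := fun x =>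
    (L1.integrable_coeFn x).mul_bdd (Lp.aestronglyMeasurable g) hg
  refine ⟨{ toFun := fun x => ∫ t, x t * g t, map_add' := ?_, map_smul' := ?_ },
    fun x => rfl, ?_⟩
  · intro x y
    rw [← integral_add (hi x) (hi y)]
    refine integral_congr_ae ?_
    filter_upwards [Lp.coeFn_add x y] with t ht
    rw [ht, Pi.add_apply, add_mul]
  · intro c x
    rw [RingHom.id_apply, smul_eq_mul, ← integral_const_mul]
    refine integral_congr_ae ?_
    filter_upwards [Lp.coeFn_smul c x] with t ht
    rw [ht, Pi.smul_apply, smul_eq_mul, mul_assoc]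
  · intro x
    change ‖∫ t, x t * g t‖ ≤ _
    rw [L1.norm_eq_integral_norm, ← integral_const_mul]
    refine norm_integral_le_of_norm_le ((L1.integrable_coeFn x).norm.const_mul _) ?_
    filter_upwards [hg] with t ht
    rw [norm_mul, mul_comm]
    exact mul_le_mul_of_nonneg_right ht (norm_nonneg _)

lemma aux_coeff (f : Lp ℝ 1 (volume : Measure ℝ)) (lam : ℕ → ℝ)
    (F : ℕ → Lp ℝ 1 (volume : Measure ℝ))
    (hF : ∀ i : ℕ, (F i : ℝ → ℝ) =ᵐ[volume] fun x => f (x - lam i))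
    (hyp :
      (∃ g : ℕ → Lp ℝ ⊤ (volume : Measure ℝ),
        ∀ x ∈ (Submodule.span ℝ (Set.range F)).topologicalClosure,
          Tendsto (fun n : ℕ => ∑ i ∈ Finset.range n, (∫ t : ℝ, x t * g i t) • F i)
            atTop (𝓝 x)) ∨
      (∃ g : ℕ → Lp ℝ ⊤ (volume : Measure ℝ),
        (∀ i j : ℕ, (∫ t : ℝ, F i t * g j t) = if i = j then (1 : ℝ) else 0) ∧
        (∃ C : ℝ, ∀ i : ℕ, ‖g i‖ ≤ C))) :
    ∃ C : ℝ, 0 ≤ C ∧ ∀ x ∈ Submodule.span ℝ (Set.range F), ∃ a : ℕ → ℝ,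
      Tendsto (fun n : ℕ => ∑ i ∈ Finset.range n, a i • F i) atTop (𝓝 x) ∧
      ∀ i, |a i| ≤ C * ‖x‖ := by
  have hFn : ∀ i, ‖F i‖ = ‖f‖ := by
    intro i
    rw [L1.norm_eq_integral_norm, L1.norm_eq_integral_norm,
      integral_congr_ae (g := fun x => ‖f (x - lam i)‖)
        (by filter_upwards [hF i] with t ht; rw [ht])]
    exact integral_sub_right_eq_self (fun x => ‖f x‖) (lam i)
  rcases hyp with ⟨g, hg⟩ | ⟨g, hg, C, hC⟩
  · choose G hG1 hG2 using fun i => aux_pair (g i)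
    simp_rw [← hG1] at hg
    rcases eq_or_ne f 0 with hf | hf
    · refine ⟨0, le_rfl, fun x hx => ⟨fun _ => 0, ?_, by simp⟩⟩
      have hF0 : ∀ i, F i = 0 := fun i => by rw [← norm_eq_zero, hFn, hf, norm_zero]
      simpa [hF0] using hg x (Submodule.le_topologicalClosure _ hx)
    · set X := (Submodule.span ℝ (Set.range F)).topologicalClosure with hX
      have : CompleteSpace X :=
        (Submodule.isClosed_topologicalClosure _).completeSpace_coe
      let Gc : ℕ → Lp ℝ 1 (volume : Measure ℝ) →L[ℝ] ℝ := fun i => (G i).mkContinuous _ (hG2 i)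
      let P : ℕ → X →L[ℝ] Lp ℝ 1 (volume : Measure ℝ) := fun n =>
        ∑ i ∈ Finset.range n, ((Gc i).comp X.subtypeL).smulRight (F i)
      have hP : ∀ n x, P n x = ∑ i ∈ Finset.range n, G i x • F i := by
        intro n x
        simp [P, Gc]
      obtain ⟨K, hK⟩ := banach_steinhaus (g := P) (by
        intro x
        obtain ⟨M, hM⟩ := (hg x x.2).norm.bddAbove_range
        refine ⟨M, fun n => ?_⟩
        rw [hP]
        exact hM ⟨n, rfl⟩)
      have hK0 : 0 ≤ K := (norm_nonneg (P 0)).trans (hK 0)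
      have hfp : 0 < ‖f‖ := norm_pos_iff.2 hf
      refine ⟨2 * K / ‖f‖, by positivity, fun x hx => ⟨fun i => G i x, ?_, fun i => ?_⟩⟩
      · exact hg x (Submodule.le_topologicalClosure _ hx)
      · let y : X := ⟨x, Submodule.le_topologicalClosure _ hx⟩
        have h1 : G i x • F i = P (i + 1) y - P i y := by
          rw [hP, hP, Finset.sum_range_succ]; simp [y]
        have h2 : |G i x| * ‖f‖ ≤ K * ‖x‖ + K * ‖x‖ := by
          rw [← hFn i, ← Real.norm_eq_abs, ← norm_smul, h1]
          refine (norm_sub_le _ _).trans (add_le_add ?_ ?_)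
          · exact (P (i+1)).le_of_opNorm_le (hK _) y
          · exact (P i).le_of_opNorm_le (hK _) y
        rw [div_mul_eq_mul_div, le_div_iff₀ hfp]
        linarith
  · choose G hG1 hG2 using fun i => aux_pair (g i)
    refine ⟨C, (norm_nonneg _).trans (hC 0), fun x hx => ?_⟩
    obtain ⟨c, rfl⟩ := Finsupp.mem_span_range_iff_exists_finsupp.1 hx
    refine ⟨c, ?_, fun i => ?_⟩
    · refine tendsto_const_nhds.congr' ?_
      obtain ⟨M, hM⟩ := c.support.exists_nat_subset_range
      filter_upwards [eventually_ge_atTop M] with n hn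
      refine Finset.sum_subset (hM.trans (Finset.range_mono hn)) fun i _ hi => ?_
      simp [Finsupp.notMem_support_iff.1 hi]
    · have : c i = G i (c.sum fun i a => a • F i) := by
        rw [Finsupp.sum, map_sum]
        simp_rw [map_smul, hG1, hg]
        simp +contextual
      rw [← Real.norm_eq_abs, this]
      exact (hG2 i _).trans (mul_le_mul_of_nonneg_right (hC i) (norm_nonneg _))

/-- If `(f_i)` is a uniformly discrete sequence of translates of `f ∈ L_1(ℝ)`
which (together with suitable `g_i ∈ L_∞(ℝ)`) forms either a Schauder frame for
its closed linear span `X`, or a bounded biorthogonal (minimal) system, then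
`X` embeds almost isometrically into `ℓ_1`. -/
theorem translates_frame_or_bounded_minimal_embeds_ell1
    (f : Lp ℝ 1 (volume : Measure ℝ))
    (lam : ℕ → ℝ)
    (hlam : ∃ δ > (0 : ℝ), ∀ i j : ℕ, i ≠ j → δ ≤ |lam i - lam j|)
    (F : ℕ → Lp ℝ 1 (volume : Measure ℝ))
    (hF : ∀ i : ℕ, (F i : ℝ → ℝ) =ᵐ[volume] fun x => f (x - lam i))
    (hyp :
      (∃ g : ℕ → Lp ℝ ⊤ (volume : Measure ℝ),
        ∀ x ∈ (Submodule.span ℝ (Set.range F)).topologicalClosure,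
          Tendsto (fun n : ℕ => ∑ i ∈ Finset.range n, (∫ t : ℝ, x t * g i t) • F i)
            atTop (𝓝 x)) ∨
      (∃ g : ℕ → Lp ℝ ⊤ (volume : Measure ℝ),
        (∀ i j : ℕ, (∫ t : ℝ, F i t * g j t) = if i = j then (1 : ℝ) else 0) ∧
        (∃ C : ℝ, ∀ i : ℕ, ‖g i‖ ≤ C))) :
    ∀ ε > (0 : ℝ),
      ∃ T : (Submodule.span ℝ (Set.range F)).topologicalClosure →ₗ[ℝ] lp (fun _ : ℕ => ℝ) 1,
        ∀ x : (Submodule.span ℝ (Set.range F)).topologicalClosure,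
          (1 + ε)⁻¹ * ‖x‖ ≤ ‖T x‖ ∧ ‖T x‖ ≤ (1 + ε) * ‖x‖ := by
  intro ε hε
  obtain ⟨δ, hδ, hlam⟩ := hlam
  obtain ⟨C, hC0, hC⟩ := aux_coeff f lam F hF hyp
  set η : ℝ := ε / ((1 + ε) * (2 * C + 1)) with hη
  have hηp : 0 < η := by positivity
  obtain ⟨φ, h, hφ, hsum⟩ := aux_partition (fun i => F i)
    (fun i => (Lp.stronglyMeasurable (F i)).measurable) δ hδ
    (fun n => ((aux_cell_sum f lam δ hδ hlam (fun i => F i) hF n).trans_lt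
      (L1.integrable_coeFn f).2).ne)
    (ENNReal.ofReal η) (by simpa using hηp)
  obtain ⟨T, hT1, hT2⟩ := aux_embed F φ hφ h η hηp.le hsum
  have hTc : Continuous T := (T.mkContinuous 1 (by simpa using hT1)).continuous
  refine ⟨T.comp (Submodule.subtype _), fun x => ⟨?_, ?_⟩⟩
  · have hcl : IsClosed {y : Lp ℝ 1 (volume : Measure ℝ) | (1 + ε)⁻¹ * ‖y‖ ≤ ‖T y‖} :=
      isClosed_le (continuous_const.mul continuous_norm) hTc.norm
    have hsub : (Submodule.span ℝ (Set.range F) : Set (Lp ℝ 1 (volume : Measure ℝ))) ⊆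
        {y | (1 + ε)⁻¹ * ‖y‖ ≤ ‖T y‖} := by
      intro y hy
      obtain ⟨a, ha1, ha2⟩ := hC y hy
      have h1 := hT2 y a _ ha1 ha2
      have h2 : 2 * (C * η) ≤ 1 - (1 + ε)⁻¹ := by
        have : 1 - (1 + ε)⁻¹ - 2 * (C * η) = η := by
          rw [hη]; field_simp; ring
        linarith
      have h3 := mul_le_mul_of_nonneg_right h2 (norm_nonneg y)
      simp only [Set.mem_ofPred_eq]
      nlinarith
    have hx : (x : Lp ℝ 1 (volume : Measure ℝ)) ∈ closure
        (Submodule.span ℝ (Set.range F) : Set (Lp ℝ 1 (volume : Measure ℝ))) := by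
      rw [← Submodule.topologicalClosure_coe]; exact x.2
    exact closure_minimal hsub hcl hx
  · refine (hT1 x).trans ?_
    change ‖x‖ ≤ _
    nlinarith [norm_nonneg x]
end

section
/- Let 1 < p ≤ 2 with conjugate exponent q. Let f ∈ L_p(ℝ), let (λ_i)_{i≥1} be uniformly discrete, set f_i = f_(λ_i), and let (f_i, g_i)_{i≥1} be a Schauder frame for a closed subspace X of L_p(ℝ) admitting a lower ℓ_q-estimate: there is K < ∞ with (Σ_{i=1}^∞ |⟨x, g_i⟩|^q)^{1/q} ≤ K ‖x‖_p for all x ∈ X. Then X embeds almost isometrically into ℓ_p: for every ε > 0 there is a linear map T : X → ℓ_p with (1+ε)^{−1}‖x‖_p ≤ ‖Tx‖ ≤ (1+ε)‖x‖_p for all x ∈ X. -/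
open MeasureTheory ENNReal Filter Topology

lemma enorm_rpow_eq {p : ℝ} (hp : 1 < p) [Fact (1 ≤ ENNReal.ofReal p)] {μ : Measure ℝ} (g : ℝ → ℝ) :
    eLpNorm g (ENNReal.ofReal p) μ ^ p = ∫⁻ t, ‖g t‖ₑ ^ p ∂μ := by
  have h0 : (0:ℝ) < p := by linarith
  rw [eLpNorm_eq_lintegral_rpow_enorm_toReal (by simpa using h0) (by simp)]
  rw [ENNReal.toReal_ofReal h0.le, ← ENNReal.rpow_mul]
  rw [one_div_mul_cancel h0.ne', ENNReal.rpow_one]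

lemma lintegral_fibers {ι : Type*} [Countable ι] [MeasurableSpace ι] [MeasurableSingletonClass ι]
    (Φ : ℝ → ι) (hΦ : Measurable Φ) (g : ℝ → ℝ≥0∞) :
    ∫⁻ t, g t = ∑' k, ∫⁻ t in Φ ⁻¹' {k}, g t := by
  rw [← lintegral_iUnion (fun k => hΦ (measurableSet_singleton k))]
  · rw [← Set.preimage_iUnion, Set.iUnion_of_singleton, Set.preimage_univ, setLIntegral_univ]
  · intro i j hij
    exact Disjoint.preimage _ (by simpa using hij)

lemma lp_of_bound {p : ℝ} (hp : 1 < p) (u : ℕ → ℝ) {C : ℝ≥0∞} (hC : C ≠ ∞)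
    (h : ∑' k, ‖u k‖ₑ ^ p ≤ C) : Memℓp u (ENNReal.ofReal p) := by
  have h0 : (0:ℝ) < p := by linarith
  rw [memℓp_gen_iff (by simp [ENNReal.toReal_ofReal h0.le, h0])]
  rw [ENNReal.toReal_ofReal h0.le]
  have h2 : ∑' k, ‖u k‖ₑ ^ p ≠ ∞ := ne_top_of_le_ne_top hC h
  have := ENNReal.summable_toReal h2
  simpa [← ENNReal.toReal_rpow] using this

lemma lp_enorm {p : ℝ} (hp : 1 < p) [Fact (1 ≤ ENNReal.ofReal p)]
    (u : lp (fun _ : ℕ => ℝ) (ENNReal.ofReal p)) :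
    ‖u‖ₑ ^ p = ∑' k, ‖u k‖ₑ ^ p := by
  have h0 : (0:ℝ) < p := by linarith
  have h1 : 0 < (ENNReal.ofReal p).toReal := by simp [ENNReal.toReal_ofReal h0.le, h0]
  have := lp.hasSum_norm h1 u
  rw [ENNReal.toReal_ofReal h0.le] at this
  have e : ∀ r : ℝ, 0 ≤ r → ENNReal.ofReal (r ^ p) = ENNReal.ofReal r ^ p := fun r hr =>
    (ENNReal.ofReal_rpow_of_nonneg hr h0.le).symm
  rw [← ofReal_norm, ← e _ (norm_nonneg _), ← this.tsum_eq,
    ENNReal.ofReal_tsum_of_nonneg (fun n => by positivity) this.summable]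
  congr 1; ext k; rw [e _ (norm_nonneg _), ofReal_norm]

lemma avg_le {p : ℝ} (hp : 1 < p) [Fact (1 ≤ ENNReal.ofReal p)] (A : Set ℝ)
    (hA : volume A < ∞) (x : ℝ → ℝ) (hx : AEStronglyMeasurable x volume) :
    ‖(volume A).toReal ^ (1 / p - 1) * ∫ t in A, x t‖ₑ ^ p ≤ ∫⁻ t in A, ‖x t‖ₑ ^ p := by
  have h0 : (0:ℝ) < p := by linarith
  by_cases hz : volume A = 0
  · have : volume.restrict A = 0 := by simpa using hz
    simp [this, h0]
  rw [← enorm_rpow_eq hp]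
  refine ENNReal.rpow_le_rpow ?_ h0.le
  have h1 := eLpNorm_le_eLpNorm_mul_rpow_measure_univ (μ := volume.restrict A) (f := x)
    (Fact.out : 1 ≤ ENNReal.ofReal p) hx.restrict
  rw [eLpNorm_one_eq_lintegral_enorm] at h1
  simp only [Measure.restrict_apply_univ, ENNReal.toReal_one, ENNReal.toReal_ofReal h0.le] at h1
  have h2 := (enorm_integral_le_lintegral_enorm (μ := volume.restrict A) x).trans h1
  rw [enorm_mul]
  have e : ‖(volume A).toReal ^ (1 / p - 1)‖ₑ = volume A ^ (1/p - 1) := by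
    rw [Real.enorm_of_nonneg (by positivity), ← ENNReal.ofReal_rpow_of_pos (ENNReal.toReal_pos hz hA.ne), ENNReal.ofReal_toReal hA.ne]
  rw [e]
  calc _ ≤ volume A ^ (1/p - 1) * (eLpNorm x (ENNReal.ofReal p) (volume.restrict A) * volume A ^ (1 / 1 - 1 / p)) := by gcongr
    _ = eLpNorm x (ENNReal.ofReal p) (volume.restrict A) * (volume A ^ (1/p - 1) * volume A ^ (1 / 1 - 1 / p)) := by ring
    _ = _ := by
      rw [← ENNReal.rpow_add _ _ hz hA.ne]; norm_num

lemma avg_eq {p : ℝ} (hp : 1 < p) (A : Set ℝ)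
    (hA : volume A < ∞) (x : ℝ → ℝ) (c : ℝ) (hx : ∀ᵐ t ∂(volume.restrict A), x t = c) :
    ‖(volume A).toReal ^ (1 / p - 1) * ∫ t in A, x t‖ₑ ^ p = ∫⁻ t in A, ‖x t‖ₑ ^ p := by
  have h0 : (0:ℝ) < p := by linarith
  by_cases hz : volume A = 0
  · have : volume.restrict A = 0 := by simpa using hz
    simp [this, h0]
  rw [integral_congr_ae hx, lintegral_congr_ae (g := fun _ => ‖c‖ₑ ^ p) (by filter_upwards [hx] with t ht; rw [ht])]
  simp only [integral_const, lintegral_const, Measure.restrict_apply_univ, smul_eq_mul,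
    measureReal_restrict_apply_univ]
  rw [← mul_assoc, enorm_mul, ENNReal.mul_rpow_of_nonneg _ _ h0.le, mul_comm]
  congr 1
  have hpos := ENNReal.toReal_pos hz hA.ne
  rw [measureReal_def, ← Real.rpow_add_one hpos.ne', Real.enorm_of_nonneg (by positivity),
    ← ENNReal.ofReal_rpow_of_pos hpos, ENNReal.ofReal_toReal hA.ne, ← ENNReal.rpow_mul]
  rw [sub_add_cancel, one_div_mul_cancel h0.ne', ENNReal.rpow_one]

lemma stepT {p : ℝ} (hp : 1 < p) [Fact (1 ≤ ENNReal.ofReal p)]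
    (Φ : ℝ → ℕ) (hΦ : Measurable Φ) (hfin : ∀ k, volume (Φ ⁻¹' {k}) < ∞) :
    ∃ T : Lp ℝ (ENNReal.ofReal p) (volume : Measure ℝ) →ₗ[ℝ] lp (fun _ : ℕ => ℝ) (ENNReal.ofReal p),
      (∀ x, ‖T x‖ ≤ ‖x‖) ∧
      ∀ (x : Lp ℝ (ENNReal.ofReal p) (volume : Measure ℝ)) (c : ℕ → ℝ),
        x =ᵐ[volume] (fun t => c (Φ t)) → ‖T x‖ = ‖x‖ := by
  have h0 : (0:ℝ) < p := by linarith
  have hx : ∀ x : Lp ℝ (ENNReal.ofReal p) (volume : Measure ℝ),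
      ‖x‖ₑ ^ p = ∑' k, ∫⁻ t in Φ ⁻¹' {k}, ‖x t‖ₑ ^ p := by
    intro x
    rw [Lp.enorm_def, enorm_rpow_eq hp, lintegral_fibers Φ hΦ]
  have hb : ∀ x : Lp ℝ (ENNReal.ofReal p) (volume : Measure ℝ),
      ∑' k, ‖(volume (Φ ⁻¹' {k})).toReal ^ (1 / p - 1) * ∫ t in Φ ⁻¹' {k}, x t‖ₑ ^ p ≤ ‖x‖ₑ ^ p := by
    intro x
    rw [hx]
    exact ENNReal.tsum_le_tsum fun k => avg_le hp _ (hfin k) x (Lp.aestronglyMeasurable x)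
  have hint : ∀ (x : Lp ℝ (ENNReal.ofReal p) (volume : Measure ℝ)) (k : ℕ),
      Integrable x (volume.restrict (Φ ⁻¹' {k})) := by
    intro x k
    have : IsFiniteMeasure (volume.restrict (Φ ⁻¹' {k})) := ⟨by simpa using hfin k⟩
    exact ((Lp.memLp x).restrict _).integrable Fact.out
  let T : Lp ℝ (ENNReal.ofReal p) (volume : Measure ℝ) →ₗ[ℝ] lp (fun _ : ℕ => ℝ) (ENNReal.ofReal p) :=
    { toFun := fun x => ⟨fun k => (volume (Φ ⁻¹' {k})).toReal ^ (1 / p - 1) * ∫ t in Φ ⁻¹' {k}, x t,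
        lp_of_bound hp _ (by simp [h0.le]) (hb x)⟩
      map_add' := by
        intro x y
        ext k
        have : ∫ t in Φ ⁻¹' {k}, (x + y : Lp ℝ (ENNReal.ofReal p) (volume : Measure ℝ)) t
          = (∫ t in Φ ⁻¹' {k}, x t) + ∫ t in Φ ⁻¹' {k}, y t := by
          rw [← integral_add (hint x k) (hint y k)]
          exact integral_congr_ae (ae_restrict_of_ae (Lp.coeFn_add x y))
        simp only [lp.coeFn_add, Pi.add_apply, this, mul_add]
      map_smul' := by
        intro r x
        ext k
        have : ∫ t in Φ ⁻¹' {k}, (r • x : Lp ℝ (ENNReal.ofReal p) (volume : Measure ℝ)) t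
          = r * (∫ t in Φ ⁻¹' {k}, x t) := by
          rw [← integral_const_mul]
          exact integral_congr_ae (ae_restrict_of_ae (Lp.coeFn_smul r x))
        simp only [lp.coeFn_smul, Pi.smul_apply, this, smul_eq_mul, RingHom.id_apply]
        ring }
  have hT : ∀ x, ‖T x‖ₑ ^ p = ∑' k, ‖(volume (Φ ⁻¹' {k})).toReal ^ (1 / p - 1) * ∫ t in Φ ⁻¹' {k}, x t‖ₑ ^ p :=
    fun x => lp_enorm hp (T x)
  refine ⟨T, fun x => ?_, fun x c hc => ?_⟩
  · have : ‖T x‖ₑ ≤ ‖x‖ₑ := by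
      rw [← ENNReal.rpow_le_rpow_iff h0, hT]; exact hb x
    exact enorm_le_iff_norm_le.mp this
  · have : ‖T x‖ₑ ^ p = ‖x‖ₑ ^ p := by
      rw [hT, hx]
      congr 1; ext k
      refine avg_eq hp _ (hfin k) x (c k) ?_
      filter_upwards [ae_restrict_of_ae hc, ae_restrict_mem (hΦ (measurableSet_singleton k))] with t ht hk
      rw [ht]; simp at hk; rw [hk]
    have := ENNReal.rpow_left_injective h0.ne' this
    rw [← ofReal_norm, ← ofReal_norm] at this
    exact (ENNReal.ofReal_eq_ofReal_iff (norm_nonneg _) (norm_nonneg _)).1 this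

lemma exists_joint (h : ℕ → SimpleFunc ℝ ℝ) (N : ℕ) :
    ∃ φ : ℝ → ℕ, Measurable φ ∧ ∀ i < N, ∃ c : ℕ → ℝ, ∀ t, h i t = c (φ t) := by
  induction N with
  | zero => exact ⟨fun _ => 0, measurable_const, by simp⟩
  | succ N ih =>
    obtain ⟨φ, hφ, hc⟩ := ih
    obtain ⟨e, he⟩ : ∃ e : ℝ → ℕ, Set.InjOn e (Set.range (h N)) :=
      Set.countable_iff_exists_injOn.1 (h N).finite_range.countable
    refine ⟨fun t => Nat.pair (φ t) (((h N).map e) t), ?_, ?_⟩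
    · exact (measurable_from_prod_countable_right (fun _ => measurable_of_countable _) :
        Measurable (fun z : ℕ × ℕ => Nat.pair z.1 z.2)).comp (hφ.prodMk ((h N).map e).measurable)
    · intro i hi
      rcases Nat.lt_succ_iff_lt_or_eq.1 hi with hi | rfl
      · obtain ⟨c, hc⟩ := hc i hi
        exact ⟨fun k => c k.unpair.1, fun t => by simp [hc]⟩
      · refine ⟨fun k => Function.invFunOn e (Set.range (h i)) k.unpair.2, fun t => ?_⟩
        simp only [SimpleFunc.map_apply, Nat.unpair_pair]
        exact (he.leftInvOn_invFunOn ⟨t, rfl⟩).symm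

lemma local_approx_s7 {p q : ℝ} (hpq : p.HolderConjugate q) [Fact (1 ≤ ENNReal.ofReal p)]
    (μ : Measure ℝ) (F : ℕ → ℝ → ℝ) (hF : ∀ i, MemLp (F i) (ENNReal.ofReal p) μ)
    (hsum : ∑' i, eLpNorm (F i) (ENNReal.ofReal p) μ ^ p ≠ ∞) {η : ℝ≥0∞} (hη : η ≠ 0) :
    ∃ φ : ℝ → ℕ, Measurable φ ∧ ∃ N : ℕ, ∀ (a : ℕ → ℝ) (C : ℝ≥0∞),
      ∑' i, ‖a i‖ₑ ^ q ≤ C ^ q → ∃ c : ℕ → ℝ, ∀ M ≥ N,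
        eLpNorm (fun t => (∑ i ∈ Finset.range M, a i * F i t) - c (φ t)) (ENNReal.ofReal p) μ
          ≤ η ^ (1 / p) * C := by
  have h0 : 0 < p := hpq.pos
  have hη2 : η / 2 ≠ 0 := by simp [hη]
  obtain ⟨β, hβ, hβs⟩ := ENNReal.exists_pos_sum_of_countable' hη2 ℕ
  obtain ⟨N, hN⟩ : ∃ N, ∑' i, eLpNorm (F (i + N)) (ENNReal.ofReal p) μ ^ p < η / 2 :=
    ((ENNReal.tendsto_sum_nat_add _ hsum).eventually (gt_mem_nhds (pos_iff_ne_zero.2 hη2))).exists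
  have hβ' : ∀ i, β i ^ (1 / p) ≠ 0 := fun i => by
    have := (hβ i).ne'
    simp [ENNReal.rpow_eq_zero_iff, this, h0.le, h0]
  choose h hh hhm using fun i => (hF i).exists_simpleFunc_eLpNorm_sub_lt (by simp) (hβ' i)
  obtain ⟨φ, hφ, hc⟩ := exists_joint h N
  refine ⟨φ, hφ, N, fun a C ha => ?_⟩
  choose! c hc using hc
  refine ⟨fun k => ∑ i ∈ Finset.range N, a i * c i k, fun M hM => ?_⟩
  let D : ℕ → ℝ → ℝ := fun i => if i < N then F i - h i else F i
  have hD : ∀ i, AEStronglyMeasurable (D i) μ := by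
    intro i
    by_cases hi : i < N
    · simpa [D, hi] using (hF i).1.sub (h i).aestronglyMeasurable
    · simpa [D, hi] using (hF i).1
  have hDs : ∑ i ∈ Finset.range M, eLpNorm (D i) (ENNReal.ofReal p) μ ^ p ≤ η := by
    calc _ ≤ ∑' i, eLpNorm (D i) (ENNReal.ofReal p) μ ^ p := ENNReal.sum_le_tsum _
      _ = ∑ i ∈ Finset.range N, eLpNorm (D i) (ENNReal.ofReal p) μ ^ p
          + ∑' i, eLpNorm (D (i + N)) (ENNReal.ofReal p) μ ^ p :=
        (ENNReal.summable.sum_add_tsum_nat_add' ).symm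
      _ ≤ η / 2 + η / 2 := by
        gcongr ?_ + ?_
        · refine le_trans ?_ ((ENNReal.sum_le_tsum (Finset.range N)).trans hβs.le)
          refine Finset.sum_le_sum fun i hi => ?_
          have hi := Finset.mem_range.1 hi
          simp only [D, hi, if_true]
          have := ENNReal.rpow_le_rpow (hh i).le h0.le
          rwa [← ENNReal.rpow_mul, one_div_mul_cancel h0.ne', ENNReal.rpow_one] at this
        · simpa [D] using hN.le
      _ = η := ENNReal.add_halves η
  have heq : (fun t => (∑ i ∈ Finset.range M, a i * F i t) - ∑ i ∈ Finset.range N, a i * c i (φ t))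
      = ∑ i ∈ Finset.range M, a i • D i := by
    ext t
    have : ∑ i ∈ Finset.range N, a i * c i (φ t)
        = ∑ i ∈ Finset.range M, if i < N then a i * c i (φ t) else 0 := by
      rw [← Finset.sum_filter]
      congr 1
      ext i; simp; omega
    rw [this, ← Finset.sum_sub_distrib]
    simp only [Finset.sum_apply, Pi.smul_apply, smul_eq_mul]
    refine Finset.sum_congr rfl fun i _ => ?_
    by_cases hi : i < N
    · simp [D, hi, hc i hi, mul_sub]
    · simp [D, hi]
  rw [heq]
  calc _ ≤ ∑ i ∈ Finset.range M, eLpNorm (a i • D i) (ENNReal.ofReal p) μ :=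
        eLpNorm_sum_le (fun i _ => (hD i).const_smul _) Fact.out
    _ = ∑ i ∈ Finset.range M, eLpNorm (D i) (ENNReal.ofReal p) μ * ‖a i‖ₑ := by
        simp only [eLpNorm_const_smul, mul_comm]
    _ ≤ _ := ENNReal.inner_le_Lp_mul_Lq _ _ _ hpq
    _ ≤ _ := by
        gcongr
        rw [one_div, ENNReal.rpow_inv_le_iff hpq.symm.pos]
        exact (ENNReal.sum_le_tsum _).trans ha

lemma translates_sum {p : ℝ} (hp : 1 < p) [Fact (1 ≤ ENNReal.ofReal p)]
    (f : Lp ℝ (ENNReal.ofReal p) (volume : Measure ℝ))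
    (lam : ℕ → ℝ) (δ : ℝ) (hlam : ∀ i j : ℕ, i ≠ j → δ ≤ |lam i - lam j|)
    (F : ℕ → Lp ℝ (ENNReal.ofReal p) (volume : Measure ℝ))
    (hF : ∀ i : ℕ, (F i : ℝ → ℝ) =ᵐ[volume] fun x => f (x - lam i))
    (I : Set ℝ) (hI : MeasurableSet I) (hd : ∀ s ∈ I, ∀ t ∈ I, |s - t| < δ) :
    ∑' i, eLpNorm (F i) (ENNReal.ofReal p) (volume.restrict I) ^ p ≠ ∞ := by
  have h0 : 0 < p := by linarith
  have h1 : ∀ i, eLpNorm (F i) (ENNReal.ofReal p) (volume.restrict I) ^ p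
      = ∫⁻ t in (fun t => t + lam i) ⁻¹' I, ‖f t‖ₑ ^ p := by
    intro i
    rw [enorm_rpow_eq hp]
    rw [lintegral_congr_ae (g := fun t => ‖f (t - lam i)‖ₑ ^ p)
      (by filter_upwards [ae_restrict_of_ae (hF i)] with t ht; rw [ht])]
    have := (measurePreserving_sub_right volume (lam i)).setLIntegral_comp_preimage_emb
      (MeasurableEquiv.subRight (lam i)).measurableEmbedding (fun t => ‖f t‖ₑ ^ p)
      ((fun t => t + lam i) ⁻¹' I)
    rw [← this]
    congr 2
    ext t; simp
  simp_rw [h1]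
  rw [← lintegral_iUnion (fun i => (measurable_add_const (lam i)) hI)]
  · refine ne_top_of_le_ne_top ?_ (setLIntegral_le_lintegral _ _)
    rw [← enorm_rpow_eq hp, ← Lp.enorm_def]
    simp [h0.le]
  · intro i j hij
    refine Set.disjoint_left.2 fun t hi hj => ?_
    have := hd _ hi _ hj
    have h2 := hlam i j hij
    simp only [add_sub_add_left_eq_sub] at this
    linarith

lemma global_approx
    (p q : ℝ) (hpq : p.HolderConjugate q)
    [Fact (1 ≤ ENNReal.ofReal p)]
    (f : Lp ℝ (ENNReal.ofReal p) (volume : Measure ℝ))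
    (lam : ℕ → ℝ) (δ : ℝ) (hδ : 0 < δ)
    (hlam : ∀ i j : ℕ, i ≠ j → δ ≤ |lam i - lam j|)
    (F : ℕ → Lp ℝ (ENNReal.ofReal p) (volume : Measure ℝ))
    (hF : ∀ i : ℕ, (F i : ℝ → ℝ) =ᵐ[volume] fun x => f (x - lam i))
    {η : ℝ≥0∞} (hη : η ≠ 0) :
    ∃ Φ : ℝ → ℕ, Measurable Φ ∧ (∀ k, volume (Φ ⁻¹' {k}) < ∞) ∧
      ∀ (x : Lp ℝ (ENNReal.ofReal p) (volume : Measure ℝ)) (a : ℕ → ℝ) (C : ℝ≥0∞),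
        ∑' i, ‖a i‖ₑ ^ q ≤ C ^ q →
        Tendsto (fun n : ℕ => ∑ i ∈ Finset.range n, a i • F i) atTop (𝓝 x) →
        ∃ c : ℕ → ℝ, eLpNorm (fun t => x t - c (Φ t)) (ENNReal.ofReal p) volume ≤ η * C := by
  have hp := hpq.lt
  have h0 : 0 < p := hpq.pos
  let ν : ℝ → ℤ := fun t => ⌊t / δ⌋
  have hν : Measurable ν := Int.measurable_floor.comp (measurable_id.div_const δ)
  let I : ℤ → Set ℝ := fun n => ν ⁻¹' {n}
  have hI : ∀ n, MeasurableSet (I n) := fun n => hν (measurableSet_singleton n)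
  have hd : ∀ n, ∀ s ∈ I n, ∀ t ∈ I n, |s - t| < δ := by
    intro n s hs t ht
    have hs : ⌊s / δ⌋ = n := hs
    have ht : ⌊t / δ⌋ = n := ht
    have := Int.abs_sub_lt_one_of_floor_eq_floor (hs.trans ht.symm)
    rwa [← sub_div, abs_div, abs_of_pos hδ, div_lt_one hδ] at this
  have hvol : ∀ n, volume (I n) < ∞ := by
    intro n
    refine lt_of_le_of_lt (measure_mono (t := Set.Icc (n * δ) ((n + 1) * δ)) ?_) (by simp)
    intro t ht
    have ht : ⌊t / δ⌋ = n := ht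
    rw [Int.floor_eq_iff, le_div_iff₀ hδ, div_lt_iff₀ hδ] at ht
    exact ⟨ht.1, ht.2.le⟩
  have hηp : η ^ p ≠ 0 := by simp [ENNReal.rpow_eq_zero_iff, hη, h0.le]
  obtain ⟨β, hβ, hβs⟩ := ENNReal.exists_pos_sum_of_countable' hηp ℤ
  choose φ hφ N hN using fun n => local_approx_s7 hpq (volume.restrict (I n)) (fun i => (F i : ℝ → ℝ))
    (fun i => (Lp.memLp (F i)).restrict _)
    (translates_sum hp f lam δ hlam F hF (I n) (hI n) (hd n)) (hβ n).ne'
  let Φ : ℝ → ℕ := fun t => Encodable.encode (ν t, φ (ν t) t)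
  have hΦ : Measurable Φ := by
    have h1 : Measurable (fun z : ℤ × ℝ => φ z.1 z.2) := measurable_from_prod_countable_right hφ
    have h2 : Measurable (fun z : ℤ × ℕ => Encodable.encode z) := measurable_of_countable _
    exact h2.comp (hν.prodMk (h1.comp (hν.prodMk measurable_id)))
  refine ⟨Φ, hΦ, ?_, ?_⟩
  · intro k
    rcases Set.eq_empty_or_nonempty (Φ ⁻¹' {k}) with h | ⟨s, hs⟩
    · simp [h]
    · refine lt_of_le_of_lt (measure_mono ?_) (hvol (ν s))
      intro t ht
      have h2 : Φ t = Φ s := ht.trans hs.symm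
      have := Encodable.encode_injective h2
      exact (Prod.ext_iff.1 this).1
  · intro x a C ha hx
    choose c hc using fun n => hN n a C ha
    let c' : ℕ → ℝ := fun k => match (Encodable.decode k : Option (ℤ × ℕ)) with
      | some z => c z.1 z.2
      | none => 0
    have hc' : ∀ t, c' (Φ t) = c (ν t) (φ (ν t) t) := by
      intro t; simp only [c', Φ, Encodable.encodek]
    have hmeas : Measurable (fun t => c' (Φ t)) := (measurable_of_countable c').comp hΦ
    refine ⟨c', ?_⟩
    have hloc : ∀ n, eLpNorm (fun t => x t - c' (Φ t)) (ENNReal.ofReal p) (volume.restrict (I n))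
        ≤ β n ^ (1 / p) * C := by
      intro n
      have hlim : Tendsto (fun M => ‖x - ∑ i ∈ Finset.range M, a i • F i‖ₑ + β n ^ (1 / p) * C)
          atTop (𝓝 (0 + β n ^ (1 / p) * C)) := by
        refine Tendsto.add ?_ tendsto_const_nhds
        have := (tendsto_const_nhds (x := x)).sub hx
        rw [sub_self] at this
        simpa using this.enorm
      rw [zero_add] at hlim
      refine ge_of_tendsto hlim ?_
      filter_upwards [eventually_ge_atTop (N n)] with M hM
      have h1 := hc n M hM
      have hsM : ((∑ i ∈ Finset.range M, a i • F i : Lp ℝ (ENNReal.ofReal p) (volume : Measure ℝ)) : ℝ → ℝ)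
          =ᵐ[volume] fun t => ∑ i ∈ Finset.range M, a i * F i t := by
        have e1 := Lp.coeFn_finsetSum (Finset.range M) (fun i => a i • F i)
        have e2 : ∀ᵐ t ∂volume, ∀ i, (a i • F i : Lp ℝ (ENNReal.ofReal p) (volume : Measure ℝ)) t = a i * F i t :=
          ae_all_iff.2 fun i => Lp.coeFn_smul (a i) (F i)
        filter_upwards [e1, e2] with t h1 h2
        rw [h1]; simp [h2]
      have h3 : (fun t => x t - c' (Φ t)) =ᵐ[volume.restrict (I n)]
          (x - ∑ i ∈ Finset.range M, a i • F i : Lp ℝ (ENNReal.ofReal p) (volume : Measure ℝ)) +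
          fun t => (∑ i ∈ Finset.range M, a i * F i t) - c n (φ n t) := by
        filter_upwards [ae_restrict_of_ae hsM, ae_restrict_mem (hI n),
          ae_restrict_of_ae (Lp.coeFn_sub x (∑ i ∈ Finset.range M, a i • F i))] with t h1 h2 h3
        have h2 : ν t = n := h2
        rw [Pi.add_apply, h3, Pi.sub_apply, h1, hc', h2]
        ring
      rw [eLpNorm_congr_ae h3]
      refine (eLpNorm_add_le (Lp.aestronglyMeasurable _).restrict ?_ Fact.out).trans ?_
      · refine AEStronglyMeasurable.sub ?_
          ((measurable_of_countable (c n)).comp (hφ n)).aestronglyMeasurable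
        exact ((Lp.aestronglyMeasurable _).congr hsM).restrict
      · refine add_le_add ?_ h1
        rw [Lp.enorm_def]
        exact eLpNorm_mono_measure _ Measure.restrict_le_self
    rw [← ENNReal.rpow_le_rpow_iff h0, enorm_rpow_eq hp, lintegral_fibers ν hν]
    calc _ ≤ ∑' n, β n * C ^ p := by
          refine ENNReal.tsum_le_tsum fun n => ?_
          rw [← enorm_rpow_eq hp]
          refine (ENNReal.rpow_le_rpow (hloc n) h0.le).trans_eq ?_
          rw [ENNReal.mul_rpow_of_nonneg _ _ h0.le, ← ENNReal.rpow_mul, one_div_mul_cancel h0.ne',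
            ENNReal.rpow_one]
      _ = (∑' n, β n) * C ^ p := ENNReal.tsum_mul_right
      _ ≤ η ^ p * C ^ p := by gcongr
      _ = _ := (ENNReal.mul_rpow_of_nonneg _ _ h0.le).symm

/-- Let `1 < p ≤ 2` with conjugate exponent `q`, and let `(f_i, g_i)` be a
Schauder frame for a closed subspace `X` of `L_p(ℝ)`, where the `f_i` are
uniformly discrete translates of a fixed `f ∈ L_p(ℝ)`.  If the frame admits a
lower `ℓ_q`-estimate, then `X` embeds almost isometrically into `ℓ_p`. -/
theorem translates_frame_lower_lq_estimate_embeds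
    (p q : ℝ) (hp : 1 < p) (hp2 : p ≤ 2) (hpq : 1 / p + 1 / q = 1)
    [Fact (1 ≤ ENNReal.ofReal p)] [Fact (1 ≤ ENNReal.ofReal q)]
    (f : Lp ℝ (ENNReal.ofReal p) (volume : Measure ℝ))
    (lam : ℕ → ℝ)
    (hlam : ∃ δ > (0 : ℝ), ∀ i j : ℕ, i ≠ j → δ ≤ |lam i - lam j|)
    (F : ℕ → Lp ℝ (ENNReal.ofReal p) (volume : Measure ℝ))
    (hF : ∀ i : ℕ, (F i : ℝ → ℝ) =ᵐ[volume] fun x => f (x - lam i))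
    (G : ℕ → Lp ℝ (ENNReal.ofReal q) (volume : Measure ℝ))
    (X : Submodule ℝ (Lp ℝ (ENNReal.ofReal p) (volume : Measure ℝ)))
    (hX : IsClosed (X : Set (Lp ℝ (ENNReal.ofReal p) (volume : Measure ℝ))))
    (hframe : ∀ x ∈ X,
      Tendsto (fun n : ℕ => ∑ i ∈ Finset.range n, (∫ t : ℝ, x t * G i t) • F i)
        atTop (𝓝 x))
    (hlower : ∃ K : ℝ, ∀ x ∈ X,
      Summable (fun i : ℕ => |∫ t : ℝ, x t * G i t| ^ q) ∧
      (∑' i : ℕ, |∫ t : ℝ, x t * G i t| ^ q) ^ (1 / q) ≤ K * ‖x‖) :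
    ∀ ε > (0 : ℝ), ∃ T : X →ₗ[ℝ] lp (fun _ : ℕ => ℝ) (ENNReal.ofReal p),
      ∀ x : X, (1 + ε)⁻¹ * ‖x‖ ≤ ‖T x‖ ∧ ‖T x‖ ≤ (1 + ε) * ‖x‖ := by
  intro ε hε
  obtain ⟨δ, hδ, hlam⟩ := hlam
  obtain ⟨K, hK⟩ := hlower
  have h0 : 0 < p := by linarith
  have hH : p.HolderConjugate q := Real.holderConjugate_iff.2 ⟨hp, by simpa using hpq⟩
  have hq0 : 0 < q := hH.symm.pos
  have hK' : 0 < |K| + 1 := by positivity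
  set ε1 : ℝ := ε / (2 * (1 + ε)) with hε1
  have hε1p : 0 < ε1 := by positivity
  have hη : ENNReal.ofReal (ε1 / (|K| + 1)) ≠ 0 := by
    have : 0 < ε1 / (|K| + 1) := by positivity
    simpa using this
  obtain ⟨Φ, hΦ, hfin, happ⟩ := global_approx p q hH f lam δ hδ hlam F hF hη
  obtain ⟨T, hT1, hT2⟩ := stepT hp Φ hΦ hfin
  refine ⟨T.comp X.subtype, fun x => ?_⟩
  obtain ⟨x, hx⟩ := x
  have hnorm : ‖(⟨x, hx⟩ : X)‖ = ‖x‖ := rfl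
  have hTx : (T.comp X.subtype) ⟨x, hx⟩ = T x := rfl
  rw [hnorm, hTx]
  have hsum : ∑' i, ‖∫ t : ℝ, x t * G i t‖ₑ ^ q ≤ (ENNReal.ofReal ((|K| + 1) * ‖x‖)) ^ q := by
    obtain ⟨hs, hb⟩ := hK x hx
    have e : ∀ i, ‖∫ t : ℝ, x t * G i t‖ₑ ^ q = ENNReal.ofReal (|∫ t : ℝ, x t * G i t| ^ q) := by
      intro i
      rw [← ENNReal.ofReal_rpow_of_nonneg (abs_nonneg _) hq0.le, ← Real.norm_eq_abs, ofReal_norm]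
    simp_rw [e]
    rw [← ENNReal.ofReal_tsum_of_nonneg (fun i => by positivity) hs,
      ENNReal.ofReal_rpow_of_nonneg (by positivity) hq0.le]
    refine ENNReal.ofReal_le_ofReal ?_
    have hb2 : (∑' i : ℕ, |∫ t : ℝ, x t * G i t| ^ q) ^ (1 / q) ≤ (|K| + 1) * ‖x‖ := by
      refine hb.trans ?_
      gcongr
      linarith [le_abs_self K]
    have hnn : 0 ≤ ∑' i : ℕ, |∫ t : ℝ, x t * G i t| ^ q := tsum_nonneg fun i => by positivity
    have := Real.rpow_le_rpow (by positivity) hb2 hq0.le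
    rwa [← Real.rpow_mul hnn, one_div_mul_cancel hq0.ne', Real.rpow_one] at this
  obtain ⟨c, hc⟩ := happ x _ _ hsum (hframe x hx)
  rw [← ENNReal.ofReal_mul (by positivity)] at hc
  have hrw : ε1 / (|K| + 1) * ((|K| + 1) * ‖x‖) = ε1 * ‖x‖ := by field_simp
  rw [hrw] at hc
  have hmeas : AEStronglyMeasurable (fun t => c (Φ t)) volume :=
    ((measurable_of_countable c).comp hΦ).aestronglyMeasurable
  have hmem : MemLp (fun t => x t - c (Φ t)) (ENNReal.ofReal p) volume :=
    ⟨(Lp.aestronglyMeasurable x).sub hmeas, hc.trans_lt ENNReal.ofReal_lt_top⟩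
  let z := hmem.toLp _
  have hz : ‖z‖ ≤ ε1 * ‖x‖ := by
    rw [Lp.norm_toLp]
    exact ENNReal.toReal_le_of_le_ofReal (by positivity) hc
  have hy : ‖T (x - z)‖ = ‖x - z‖ := by
    refine hT2 _ c ?_
    filter_upwards [Lp.coeFn_sub x z, hmem.coeFn_toLp] with t h1 h2
    rw [h1, Pi.sub_apply, h2]; ring
  have hx1 : ‖x‖ - ‖z‖ ≤ ‖x - z‖ := norm_sub_norm_le x z
  have hx2 : ‖T (x - z)‖ ≤ ‖T x‖ + ‖T z‖ := by rw [map_sub]; exact norm_sub_le _ _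
  have hx3 := hT1 z
  have hxn := norm_nonneg x
  constructor
  · have : (1 + ε)⁻¹ = 1 - 2 * ε1 := by rw [hε1]; field_simp; ring
    rw [this]
    linarith
  · have := hT1 x
    nlinarith
end

section
/- Let 1 < p < ∞ with conjugate exponent q. Let f ∈ L_p(ℝ), let (λ_i)_{i≥1} be uniformly discrete, set f_i = f_(λ_i), and suppose (f_i, g_i)_{i≥1} is a Schauder frame for the whole space L_p(ℝ). Then for every bounded measurable set B ⊆ ℝ of positive Lebesgue measure, Σ_{i=1}^∞ (∫_B |g_i|)^q = ∞. -/
open MeasureTheory ENNReal Filter Topology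

lemma aux_RL (B : Set ℝ) (hB : MeasurableSet B) (g : ℝ → ℝ) (hg : IntegrableOn g B) :
    Tendsto (fun n : ℕ => ∫ x in B, Real.cos (2 * Real.pi * (n * x)) * g x) atTop (𝓝 0) := by
  have h1 := Real.tendsto_integral_exp_smul_cocompact (B.indicator (fun x => (g x : ℂ)))
  have h2 : Tendsto (fun n : ℕ => (n : ℝ)) atTop (cocompact ℝ) :=
    tendsto_natCast_atTop_atTop.mono_right atTop_le_cocompact
  have h3 := (Complex.continuous_re.tendsto _).comp (h1.comp h2)
  simp only [Complex.zero_re] at h3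
  refine h3.congr fun n => ?_
  simp only [Function.comp]
  have hi : Integrable (B.indicator (fun x => (g x : ℂ))) :=
    (integrable_indicator_iff hB).2 hg.ofReal
  have hi2 : Integrable (fun v : ℝ => Real.fourierChar (-(v * (n:ℝ))) • B.indicator (fun x => (g x : ℂ)) v) := by
    refine hi.norm.mono' ?_ ?_
    · refine AEStronglyMeasurable.smul (f := fun v : ℝ => Real.fourierChar (-(v * (n:ℝ)))) ?_ hi.1
      exact (Real.continuous_fourierChar.comp (by fun_prop)).aestronglyMeasurable
    · exact ae_of_all _ fun x => by simp
  have := integral_re (𝕜 := ℂ) hi2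
  simp only [RCLike.re_eq_complex_re] at this
  rw [← this, ← integral_indicator hB]
  congr 1
  ext x
  by_cases hx : x ∈ B
  · simp only [Set.indicator_of_mem hx, Circle.smul_def, Real.fourierChar_apply, smul_eq_mul,
      Complex.re_mul_ofReal, Complex.exp_ofReal_mul_I_re]
    rw [← Real.cos_neg]
    congr 2
    ring
  · simp [hx]

lemma aux_count (lam : ℕ → ℝ) (δ : ℝ) (hδ : 0 < δ)
    (hlam : ∀ i j : ℕ, i ≠ j → δ ≤ |lam i - lam j|) (B : Set ℝ) (hB : Bornology.IsBounded B) :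
    ∃ K : ℕ, ∀ (y : ℝ) (s : Finset ℕ),
      ∑ i ∈ s, B.indicator (fun _ => (1 : ℝ≥0∞)) (y + lam i) ≤ K := by
  classical
  obtain ⟨R, hR⟩ := hB.subset_closedBall 0
  refine ⟨⌊2 * R / δ⌋₊ + 1, fun y s => ?_⟩
  simp only [Set.indicator_apply]
  rw [Finset.sum_boole]
  norm_cast
  rw [← Finset.card_range (⌊2 * R / δ⌋₊ + 1)]
  have hb : ∀ i, y + lam i ∈ B → 0 ≤ y + lam i + R ∧ y + lam i + R ≤ 2 * R := fun i hi => by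
    have := hR hi
    rw [Metric.mem_closedBall, Real.dist_eq, sub_zero, abs_le] at this
    constructor <;> linarith
  apply Finset.card_le_card_of_injOn (fun i => ⌊(y + lam i + R) / δ⌋₊)
  · intro i hi
    simp only [Finset.coe_filter, Set.mem_ofPred_eq] at hi
    simp only [Finset.coe_range, Set.mem_Iio, Nat.lt_succ_iff]
    apply Nat.floor_le_floor
    gcongr
    exact (hb i hi.2).2
  · intro i hi j hj hij
    simp only [Finset.coe_filter, Set.mem_ofPred_eq] at hi hj
    by_contra hne
    have h1 := hlam i j hne
    have a1 := Nat.floor_le (div_nonneg (hb i hi.2).1 hδ.le)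
    have a2 := Nat.lt_floor_add_one ((y + lam i + R) / δ)
    have b1 := Nat.floor_le (div_nonneg (hb j hj.2).1 hδ.le)
    have b2 := Nat.lt_floor_add_one ((y + lam j + R) / δ)
    simp only at hij
    rw [hij] at a1 a2
    have c : |(y + lam i + R) / δ - (y + lam j + R) / δ| < 1 := by
      rw [abs_lt]; constructor <;> linarith
    rw [← sub_div, abs_div, abs_of_pos hδ, div_lt_one hδ] at c
    have : y + lam i + R - (y + lam j + R) = lam i - lam j := by ring
    rw [this] at c
    linarith

lemma aux_L1 (p : ℝ) (hp : 1 < p) (B : Set ℝ) (u : ℝ → ℝ)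
    (hu : MemLp u (ENNReal.ofReal p) volume) (hBf : volume B ≠ ∞) :
    IntegrableOn u B := by
  have : IsFiniteMeasure (volume.restrict B) := ⟨by simpa using hBf.lt_top⟩
  have h := hu.restrict B
  exact memLp_one_iff_integrable.1 (h.mono_exponent (by simpa using ENNReal.ofReal_le_ofReal hp.le))

lemma aux_holder (p : ℝ) (hp : 1 < p) (B : Set ℝ) (u : ℝ → ℝ)
    (hu : MemLp u (ENNReal.ofReal p) volume) (hBf : volume B ≠ ∞) :
    ENNReal.ofReal (∫ x in B, |u x|) ≤
      eLpNorm u (ENNReal.ofReal p) (volume.restrict B) * volume B ^ (1 - 1 / p) := by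
  have hi := aux_L1 p hp B u hu hBf
  have h2 := eLpNorm_le_eLpNorm_mul_rpow_measure_univ (μ := volume.restrict B) (p := 1)
    (q := ENNReal.ofReal p) (by simpa using ENNReal.ofReal_le_ofReal hp.le) (hu.restrict B).1
  rw [eLpNorm_one_eq_lintegral_enorm, ← ofReal_integral_norm_eq_lintegral_enorm hi,
    ENNReal.toReal_ofReal (by linarith)] at h2
  simpa using h2

lemma aux_summable (p : ℝ) (hp : 1 < p)
    (f : Lp ℝ (ENNReal.ofReal p) (volume : Measure ℝ)) (lam : ℕ → ℝ)
    (hlam : ∃ δ > (0 : ℝ), ∀ i j : ℕ, i ≠ j → δ ≤ |lam i - lam j|)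
    (F : ℕ → Lp ℝ (ENNReal.ofReal p) (volume : Measure ℝ))
    (hF : ∀ i : ℕ, (F i : ℝ → ℝ) =ᵐ[volume] fun x => f (x - lam i))
    (B : Set ℝ) (hB : Bornology.IsBounded B) (hBm : MeasurableSet B) :
    Summable (fun i : ℕ => (∫ x in B, |F i x|) ^ p) := by
  have hBf : volume B ≠ ∞ := hB.measure_lt_top.ne
  have hp0 : 0 < p := by linarith
  obtain ⟨δ, hδ, hl⟩ := hlam
  obtain ⟨K, hK⟩ := aux_count lam δ hδ hl B hB
  have hfm : Measurable (f : ℝ → ℝ) := (Lp.stronglyMeasurable f).measurable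
  set N : ℝ≥0∞ := ∫⁻ y, ‖f y‖ₑ ^ p with hN
  have hNf : N ≠ ∞ := by
    have := (Lp.memLp f).2
    rw [eLpNorm_lt_top_iff_lintegral_rpow_enorm_lt_top (by simpa using hp0) (by simp),
      ENNReal.toReal_ofReal hp0.le] at this
    exact this.ne
  have hI : ∀ i, ∫⁻ x in B, ‖F i x‖ₑ ^ p
      = ∫⁻ y, B.indicator (fun _ => (1 : ℝ≥0∞)) (y + lam i) * ‖f y‖ₑ ^ p := by
    intro i
    have e1 : ∫⁻ x in B, ‖F i x‖ₑ ^ p = ∫⁻ x in B, ‖f (x - lam i)‖ₑ ^ p :=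
      lintegral_congr_ae ((ae_restrict_of_ae (hF i)).mono fun x hx => by simp only [hx])
    rw [e1, ← lintegral_indicator hBm, ← lintegral_add_right_eq_self _ (lam i)]
    congr 1
    ext y
    by_cases hy : y + lam i ∈ B <;> simp [hy]
  set C : ℝ≥0∞ := (volume B ^ (1 - 1 / p)) ^ p with hC
  have hCf : C ≠ ∞ := by
    have : 0 ≤ 1 - 1 / p := by
      rw [sub_nonneg, div_le_one hp0]; exact hp.le
    exact (ENNReal.rpow_lt_top_of_nonneg hp0.le (ENNReal.rpow_lt_top_of_nonneg this hBf).ne).ne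
  have hb : ∀ i, ENNReal.ofReal ((∫ x in B, |F i x|) ^ p) ≤ (∫⁻ x in B, ‖F i x‖ₑ ^ p) * C := by
    intro i
    have h := aux_holder p hp B (F i) (Lp.memLp _) hBf
    rw [← ENNReal.ofReal_rpow_of_nonneg (integral_nonneg fun _ => abs_nonneg _) hp0.le]
    refine (ENNReal.rpow_le_rpow h hp0.le).trans ?_
    rw [ENNReal.mul_rpow_of_nonneg _ _ hp0.le,
      eLpNorm_eq_lintegral_rpow_enorm_toReal (by simpa using hp0) (by simp),
      ENNReal.toReal_ofReal hp0.le, ← ENNReal.rpow_mul, one_div_mul_cancel hp0.ne',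
      ENNReal.rpow_one]
  refine summable_of_sum_le (c := (K * N * C).toReal)
    (fun i => Real.rpow_nonneg (integral_nonneg fun _ => abs_nonneg _) _) fun s => ?_
  have hfin : K * N * C ≠ ∞ := ENNReal.mul_ne_top (ENNReal.mul_ne_top (by simp) hNf) hCf
  rw [← ENNReal.ofReal_le_iff_le_toReal hfin, ENNReal.ofReal_sum_of_nonneg
    (fun i _ => Real.rpow_nonneg (integral_nonneg fun _ => abs_nonneg _) _)]
  refine (Finset.sum_le_sum fun i _ => hb i).trans ?_
  rw [← Finset.sum_mul]
  gcongr
  simp_rw [hI]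
  rw [← lintegral_finsetSum]
  · simp_rw [← Finset.sum_mul]
    refine (lintegral_mono fun y => mul_le_mul_left (hK y s) _).trans ?_
    rw [lintegral_const_mul _ (by fun_prop)]
  · intro i _
    refine Measurable.mul ?_ (by fun_prop)
    exact (measurable_const.indicator hBm).comp (measurable_id.add_const _)

lemma aux_bound (p : ℝ) (hp : 1 < p) [Fact (1 ≤ ENNReal.ofReal p)] (B : Set ℝ)
    (hBf : volume B ≠ ∞) :
    ∃ C : ℝ, ∀ u : Lp ℝ (ENNReal.ofReal p) (volume : Measure ℝ), ∫ x in B, |u x| ≤ C * ‖u‖ := by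
  have hp0 : 0 < p := by linarith
  have hCf : volume B ^ (1 - 1 / p) ≠ ∞ := by
    have : 0 ≤ 1 - 1 / p := by
      rw [sub_nonneg, div_le_one hp0]; exact hp.le
    exact (ENNReal.rpow_lt_top_of_nonneg this hBf).ne
  refine ⟨(volume B ^ (1 - 1 / p)).toReal, fun u => ?_⟩
  have h := aux_holder p hp B u (Lp.memLp _) hBf
  have h2 : ENNReal.ofReal (∫ x in B, |u x|) ≤
      volume B ^ (1 - 1 / p) * eLpNorm u (ENNReal.ofReal p) volume := by
    rw [mul_comm]
    exact h.trans (mul_le_mul_left (eLpNorm_mono_measure _ Measure.restrict_le_self) _)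
  rw [ENNReal.ofReal_le_iff_le_toReal (ENNReal.mul_ne_top hCf (Lp.memLp u).2.ne),
    ENNReal.toReal_mul] at h2
  exact h2

lemma aux_key (p : ℝ) (hp : 1 < p) [Fact (1 ≤ ENNReal.ofReal p)] (B : Set ℝ)
    (hBf : volume B ≠ ∞) (F : ℕ → Lp ℝ (ENNReal.ofReal p) (volume : Measure ℝ))
    (h : Lp ℝ (ENNReal.ofReal p) (volume : Measure ℝ)) (c : ℕ → ℝ)
    (hc : Tendsto (fun n : ℕ => ∑ i ∈ Finset.range n, c i • F i) atTop (𝓝 h))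
    (hs : Summable fun i => |c i| * ∫ x in B, |F i x|) :
    ∫ x in B, |h x| ≤ ∑' i, |c i| * ∫ x in B, |F i x| := by
  obtain ⟨C, hC⟩ := aux_bound p hp B hBf
  have hint : ∀ u : Lp ℝ (ENNReal.ofReal p) (volume : Measure ℝ),
      Integrable (fun x => |u x|) (volume.restrict B) := fun u =>
    (aux_L1 p hp B u (Lp.memLp u) hBf).abs
  have hadd : ∀ u v : Lp ℝ (ENNReal.ofReal p) (volume : Measure ℝ),
      ∫ x in B, |(u + v) x| ≤ (∫ x in B, |u x|) + ∫ x in B, |v x| := by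
    intro u v
    rw [← integral_add (hint u) (hint v)]
    refine integral_mono_ae (hint _) ((hint u).add (hint v)) ?_
    filter_upwards [ae_restrict_of_ae (Lp.coeFn_add u v)] with x hx
    rw [hx]
    exact abs_add_le _ _
  have hsmul : ∀ (a : ℝ) (u : Lp ℝ (ENNReal.ofReal p) (volume : Measure ℝ)),
      ∫ x in B, |(a • u) x| = |a| * ∫ x in B, |u x| := by
    intro a u
    rw [← integral_const_mul]
    refine integral_congr_ae ?_
    filter_upwards [ae_restrict_of_ae (Lp.coeFn_smul a u)] with x hx
    rw [hx]
    simp [abs_mul]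
  have hsum : ∀ n : ℕ, ∫ x in B, |(∑ i ∈ Finset.range n, c i • F i) x|
      ≤ ∑ i ∈ Finset.range n, |c i| * ∫ x in B, |F i x| := by
    intro n
    induction n with
    | zero =>
      simpa using hC 0
    | succ n ih =>
      rw [Finset.sum_range_succ, Finset.sum_range_succ, ← hsmul]
      exact (hadd _ _).trans (by gcongr)
  have hle : ∀ n : ℕ, ∫ x in B, |h x| ≤
      C * ‖h - ∑ i ∈ Finset.range n, c i • F i‖ + ∑' i, |c i| * ∫ x in B, |F i x| := by
    intro n
    have h1 := hadd (h - ∑ i ∈ Finset.range n, c i • F i) (∑ i ∈ Finset.range n, c i • F i)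
    rw [sub_add_cancel] at h1
    refine h1.trans (add_le_add (hC _) ((hsum n).trans (hs.sum_le_tsum _ fun i _ => ?_)))
    exact mul_nonneg (abs_nonneg _) (integral_nonneg fun _ => abs_nonneg _)
  have hlim : Tendsto (fun n : ℕ => C * ‖h - ∑ i ∈ Finset.range n, c i • F i‖
      + ∑' i, |c i| * ∫ x in B, |F i x|) atTop (𝓝 (C * ‖h - h‖
      + ∑' i, |c i| * ∫ x in B, |F i x|)) :=
    (((tendsto_const_nhds.sub hc).norm).const_mul C).add_const _
  simp only [sub_self, norm_zero, mul_zero, zero_add] at hlim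
  exact ge_of_tendsto' hlim hle

/-- Let `1 < p < ∞` with conjugate exponent `q`, and let `(f_i, g_i)` be a
Schauder frame for the whole space `L_p(ℝ)`, where the `f_i` are uniformly
discrete translates of a fixed `f ∈ L_p(ℝ)`.  Then for every bounded measurable
set `B` of positive measure, `Σ_i (∫_B |g_i|)^q = ∞`. -/
theorem frame_of_translates_lower_estimates_diverge
    (p q : ℝ) (hp : 1 < p) (hpq : 1 / p + 1 / q = 1)
    [Fact (1 ≤ ENNReal.ofReal p)] [Fact (1 ≤ ENNReal.ofReal q)]
    (f : Lp ℝ (ENNReal.ofReal p) (volume : Measure ℝ))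
    (lam : ℕ → ℝ)
    (hlam : ∃ δ > (0 : ℝ), ∀ i j : ℕ, i ≠ j → δ ≤ |lam i - lam j|)
    (F : ℕ → Lp ℝ (ENNReal.ofReal p) (volume : Measure ℝ))
    (hF : ∀ i : ℕ, (F i : ℝ → ℝ) =ᵐ[volume] fun x => f (x - lam i))
    (G : ℕ → Lp ℝ (ENNReal.ofReal q) (volume : Measure ℝ))
    (hframe : ∀ h : Lp ℝ (ENNReal.ofReal p) (volume : Measure ℝ),
      Tendsto (fun n : ℕ => ∑ i ∈ Finset.range n, (∫ t : ℝ, h t * G i t) • F i)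
        atTop (𝓝 h)) :
    ∀ B : Set ℝ, Bornology.IsBounded B → MeasurableSet B → 0 < volume B →
      ¬ Summable (fun i : ℕ => (∫ x in B, |G i x|) ^ q) := by
  intro B hB hBm hBpos hsumG
  have hBf : volume B ≠ ∞ := hB.measure_lt_top.ne
  have hfm : IsFiniteMeasure (volume.restrict B) := ⟨by simpa using hBf.lt_top⟩
  have hconj : p.HolderConjugate q := Real.holderConjugate_iff.2 ⟨hp, by simpa using hpq⟩
  have hq : 1 < q := hconj.symm.lt
  have hsumF := aux_summable p hp f lam hlam F hF B hB hBm
  have ha : ∀ i, 0 ≤ ∫ x in B, |G i x| := fun i => integral_nonneg fun _ => abs_nonneg _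
  have hb : ∀ i, 0 ≤ ∫ x in B, |F i x| := fun i => integral_nonneg fun _ => abs_nonneg _
  have hsum : Summable fun i => (∫ x in B, |G i x|) * ∫ x in B, |F i x| :=
    Real.summable_mul_of_Lp_Lq_of_nonneg hconj.symm ha hb hsumG hsumF
  have hGi : ∀ i, IntegrableOn (G i) B := fun i => aux_L1 q hq B (G i) (Lp.memLp _) hBf
  -- the test functions
  let w : ℕ → ℝ → ℝ := fun n x => Real.cos (2 * Real.pi * (n * x))
  have hwc : ∀ n, Continuous (w n) := fun n => by fun_prop
  have hw1 : ∀ n x, |w n x| ≤ 1 := fun n x => Real.abs_cos_le_one _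
  have hmem : ∀ n, MemLp (B.indicator (w n)) (ENNReal.ofReal p) volume := fun n => by
    rw [memLp_indicator_iff_restrict hBm]
    exact MemLp.of_bound (hwc n).aestronglyMeasurable 1 (ae_of_all _ fun x => hw1 n x)
  let h : ℕ → Lp ℝ (ENNReal.ofReal p) (volume : Measure ℝ) := fun n => (hmem n).toLp _
  have hh : ∀ n, (h n : ℝ → ℝ) =ᵐ[volume] B.indicator (w n) := fun n => (hmem n).coeFn_toLp
  let c : ℕ → ℕ → ℝ := fun n i => ∫ t : ℝ, h n t * G i t
  have hc : ∀ n i, c n i = ∫ x in B, w n x * G i x := by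
    intro n i
    rw [← integral_indicator hBm]
    refine integral_congr_ae ?_
    filter_upwards [hh n] with x hx
    rw [hx]
    by_cases hxB : x ∈ B <;> simp [hxB]
  have hca : ∀ n i, |c n i| ≤ ∫ x in B, |G i x| := by
    intro n i
    rw [hc]
    refine (abs_integral_le_integral_abs).trans ?_
    refine integral_mono_of_nonneg (ae_of_all _ fun _ => abs_nonneg _) (hGi i).abs
      (ae_of_all _ fun x => ?_)
    simp only [abs_mul]
    exact mul_le_of_le_one_left (abs_nonneg _) (hw1 n x)
  have hc0 : ∀ i, Tendsto (fun n => c n i) atTop (𝓝 0) := by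
    intro i
    simp_rw [hc]
    exact aux_RL B hBm (G i) (hGi i)
  have hdom : ∀ n i, |c n i| * (∫ x in B, |F i x|)
      ≤ (∫ x in B, |G i x|) * ∫ x in B, |F i x| := fun n i =>
    mul_le_mul_of_nonneg_right (hca n i) (hb i)
  have hlim : Tendsto (fun n => ∑' i, |c n i| * ∫ x in B, |F i x|) atTop (𝓝 0) := by
    have := tendsto_tsum_of_dominated_convergence (𝓕 := atTop)
      (f := fun n i => |c n i| * ∫ x in B, |F i x|) (g := fun _ => (0 : ℝ)) hsum
      (fun i => by simpa using ((hc0 i).abs).mul_const (∫ x in B, |F i x|))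
      (Eventually.of_forall fun n i => by
        rw [Real.norm_of_nonneg (mul_nonneg (abs_nonneg _) (hb i))]
        exact hdom n i)
    simpa using this
  have hkey : ∀ n, ∫ x in B, |w n x| ≤ ∑' i, |c n i| * ∫ x in B, |F i x| := by
    intro n
    have := aux_key p hp B hBf F (h n) (c n) (hframe (h n))
      (hsum.of_nonneg_of_le (fun i => mul_nonneg (abs_nonneg _) (hb i)) (hdom n))
    refine le_trans (le_of_eq ?_) this
    refine integral_congr_ae ?_
    filter_upwards [ae_restrict_of_ae (hh n), ae_restrict_mem hBm] with x hx hxB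
    rw [hx, Set.indicator_of_mem hxB]
  have hone : IntegrableOn (fun _ : ℝ => (1 : ℝ)) B := integrable_const _
  have hwi : ∀ n, IntegrableOn (w n) B := fun n =>
    Integrable.of_bound (hwc n).aestronglyMeasurable 1 (ae_of_all _ fun x => hw1 n x)
  have hlow : ∀ n, (volume.real B) / 2 + (∫ x in B, w (2 * n) x) / 2 ≤ ∫ x in B, |w n x| := by
    intro n
    have e : (volume.real B) / 2 + (∫ x in B, w (2 * n) x) / 2
        = ∫ x in B, (1 / 2 + w (2 * n) x / 2) := by
      rw [integral_add (integrable_const _) ((hwi _).div_const 2), setIntegral_const,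
        integral_div 2 (w (2 * n)), smul_eq_mul]
      ring
    rw [e]
    refine integral_mono ((integrable_const _).add ((hwi _).div_const 2)) (hwi n).abs fun x => ?_
    have e2 : 1 / 2 + w (2 * n) x / 2 = |w n x| ^ 2 := by
      simp only [w]
      rw [sq_abs, Real.cos_sq]
      push_cast
      ring_nf
    simp only [e2]
    nlinarith [hw1 n x, abs_nonneg (w n x)]
  have hRL : Tendsto (fun n : ℕ => ∫ x in B, w (2 * n) x) atTop (𝓝 0) := by
    have h1 := aux_RL B hBm (fun _ => 1) hone
    simp only [mul_one] at h1
    exact h1.comp (tendsto_id.const_mul_atTop' (by norm_num : 0 < 2))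
  have hlim2 : Tendsto (fun n : ℕ => (volume.real B) / 2 + (∫ x in B, w (2 * n) x) / 2) atTop
      (𝓝 ((volume.real B) / 2 + 0 / 2)) := (hRL.div_const 2).const_add _
  have hfin := le_of_tendsto_of_tendsto' hlim2 hlim fun n => (hlow n).trans (hkey n)
  have hpos : 0 < volume.real B := ENNReal.toReal_pos hBpos.ne' hBf
  linarith
end

section
/- Let 2 < p ≤ 4, let f ∈ L_p(ℝ), let (λ_i)_{i≥1} be a sequence of distinct reals, suppose (f_(λ_i))_{i≥1} is an unconditional basic sequence in L_p(ℝ), and let X be its closed linear span. Then X embeds isomorphically into ℓ_p: there exist constants 0 < c ≤ C and a linear map T : X → ℓ_p with c‖x‖_p ≤ ‖Tx‖ ≤ C‖x‖_p for all x ∈ X. -/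
open MeasureTheory ENNReal

namespace TransLp

theorem sum_rpow_ge {r : ℝ} (hr : 1 ≤ r) (s : Finset ℕ) (x : ℕ → ℝ) (hx : ∀ i, 0 ≤ x i) :
    ∑ i ∈ s, x i ^ r ≤ (∑ i ∈ s, x i) ^ r := by
  classical
  induction s using Finset.induction_on with
  | empty => simp; positivity
  | insert j s hj ih =>
    rw [Finset.sum_insert hj, Finset.sum_insert hj]
    have h1 := Real.add_rpow_le_rpow_add (hx j) (Finset.sum_nonneg (s := s) fun i _ => hx i) hr
    linarith

theorem sum_rpow_le {r : ℝ} (hr0 : 0 < r) (hr : r ≤ 1) (s : Finset ℕ) (x : ℕ → ℝ)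
    (hx : ∀ i, 0 ≤ x i) :
    (∑ i ∈ s, x i) ^ r ≤ ∑ i ∈ s, x i ^ r := by
  classical
  induction s using Finset.induction_on with
  | empty => simp [Real.zero_rpow hr0.ne']
  | insert j s hj ih =>
    rw [Finset.sum_insert hj, Finset.sum_insert hj]
    have h1 := Real.rpow_add_le_add_rpow (hx j) (Finset.sum_nonneg (s := s) fun i _ => hx i) hr0.le hr
    linarith

theorem sq_rpow (t p : ℝ) : (t ^ 2) ^ (p / 2) = |t| ^ p := by
  rw [← sq_abs, ← Real.rpow_natCast, ← Real.rpow_mul (abs_nonneg t)]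
  congr 1; push_cast; ring

theorem pow4_rpow (t p : ℝ) : (t ^ 4) ^ (p / 4) = |t| ^ p := by
  have : t ^ 4 = |t| ^ 4 := (Even.pow_abs (by decide) t).symm
  rw [this, ← Real.rpow_natCast, ← Real.rpow_mul (abs_nonneg t)]
  congr 1; push_cast; ring

theorem P1 {p : ℝ} (hp : 2 < p) (s : Finset ℕ) (t : ℕ → ℝ) :
    ∑ i ∈ s, |t i| ^ p ≤ (∑ i ∈ s, t i ^ 2) ^ (p / 2) := by
  have := sum_rpow_ge (r := p / 2) (by linarith) s (fun i => t i ^ 2) (fun i => sq_nonneg _)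
  simpa only [sq_rpow] using this

theorem P2 {p : ℝ} (hp : 2 < p) (hp4 : p ≤ 4) (s : Finset ℕ) (a d : ℕ → ℝ) :
    (∑ i ∈ s, (a i * d i) ^ 2) ^ (p / 2) ≤ (∑ i ∈ s, |a i| ^ p) * ∑ i ∈ s, |d i| ^ p := by
  have h1 := Finset.sum_mul_sq_le_sq_mul_sq s (fun i => a i ^ 2) (fun i => d i ^ 2)
  have ha := sum_rpow_le (r := p / 4) (by linarith) (by linarith) s (fun i => a i ^ 4)
    (fun i => by positivity)
  have hd := sum_rpow_le (r := p / 4) (by linarith) (by linarith) s (fun i => d i ^ 4)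
    (fun i => by positivity)
  simp only [pow4_rpow] at ha hd
  have e : (∑ i ∈ s, (a i * d i) ^ 2) ^ (p / 2) = ((∑ i ∈ s, a i ^ 2 * d i ^ 2) ^ 2) ^ (p / 4) := by
    rw [← Real.rpow_natCast, ← Real.rpow_mul (Finset.sum_nonneg fun i _ => by positivity)]
    simp only [mul_pow]; congr 1; push_cast; ring
  rw [e]
  calc _ ≤ ((∑ i ∈ s, (a i ^ 2) ^ 2) * ∑ i ∈ s, (d i ^ 2) ^ 2) ^ (p / 4) :=
        Real.rpow_le_rpow (by positivity) h1 (by linarith)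
    _ = (∑ i ∈ s, a i ^ 4) ^ (p / 4) * (∑ i ∈ s, d i ^ 4) ^ (p / 4) := by
        rw [Real.mul_rpow (Finset.sum_nonneg fun i _ => by positivity)
          (Finset.sum_nonneg fun i _ => by positivity)]
        simp only [← pow_mul]
    _ ≤ _ := mul_le_mul ha hd (by positivity) (Finset.sum_nonneg fun i _ => by positivity)

theorem P3 {p : ℝ} (hp : 2 < p) (hp4 : p ≤ 4) (s : Finset ℕ) (u v : ℕ → ℝ) :
    (∑ i ∈ s, u i ^ 2) ^ (p / 2) ≤
      16 * ((∑ i ∈ s, v i ^ 2) ^ (p / 2) + (∑ i ∈ s, (u i - v i) ^ 2) ^ (p / 2)) := by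
  set U := ∑ i ∈ s, v i ^ 2
  set V := ∑ i ∈ s, (u i - v i) ^ 2
  have hU : 0 ≤ U := Finset.sum_nonneg fun i _ => by positivity
  have hV : 0 ≤ V := Finset.sum_nonneg fun i _ => by positivity
  have h : ∑ i ∈ s, u i ^ 2 ≤ 2 * (U + V) := by
    rw [← Finset.sum_add_distrib, Finset.mul_sum]
    refine Finset.sum_le_sum fun i _ => ?_
    nlinarith [sq_nonneg (u i - 2 * v i)]
  have h2 : ∑ i ∈ s, u i ^ 2 ≤ 4 * max U V := by
    have := le_max_left U V
    have := le_max_right U V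
    linarith
  have h4 : (4 : ℝ) ^ (p / 2) ≤ 16 := by
    calc (4 : ℝ) ^ (p / 2) ≤ 4 ^ (2 : ℝ) := Real.rpow_le_rpow_of_exponent_le (by norm_num) (by linarith)
      _ = 16 := by norm_num
  calc _ ≤ (4 * max U V) ^ (p / 2) :=
        Real.rpow_le_rpow (Finset.sum_nonneg fun i _ => by positivity) h2 (by linarith)
    _ = 4 ^ (p / 2) * (max U V) ^ (p / 2) := Real.mul_rpow (by norm_num) (by positivity)
    _ ≤ 16 * (max U V) ^ (p / 2) := by gcongr
    _ ≤ _ := by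
      gcongr
      rcases max_choice U V with h | h <;> rw [h]
      · have : 0 ≤ V ^ (p / 2) := by positivity
        linarith
      · have : 0 ≤ U ^ (p / 2) := by positivity
        linarith

/-- the sign attached to a finite set -/
noncomputable def sg (A : Finset ℕ) (i : ℕ) : ℝ := if i ∈ A then 1 else -1

theorem sg_or (A : Finset ℕ) (i : ℕ) : sg A i = 1 ∨ sg A i = -1 := by
  unfold sg; split_ifs <;> simp

theorem sg_mul_self (A : Finset ℕ) (i : ℕ) : sg A i * sg A i = 1 := by
  rcases sg_or A i with h | h <;> rw [h] <;> norm_num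

theorem sum_signs_insert (φ : ℝ → ℝ) (s : Finset ℕ) (j : ℕ) (hj : j ∉ s) (t : ℕ → ℝ) :
    ∑ A ∈ (insert j s).powerset, φ (∑ i ∈ insert j s, sg A i * t i) =
      ∑ A ∈ s.powerset, (φ (-t j + ∑ i ∈ s, sg A i * t i) + φ (t j + ∑ i ∈ s, sg A i * t i)) := by
  rw [Finset.sum_powerset_insert hj, ← Finset.sum_add_distrib]
  refine Finset.sum_congr rfl fun A hA => ?_
  have hjA : j ∉ A := fun h => hj (Finset.mem_powerset.1 hA h)
  rw [Finset.sum_insert hj, Finset.sum_insert hj]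
  congr 2
  · simp [sg, hjA]
  · congr 1
    · simp [sg]
    · refine Finset.sum_congr rfl fun i hi => ?_
      have : i ≠ j := fun h => hj (h ▸ hi)
      simp [sg, this]

theorem moment2 (s : Finset ℕ) (t : ℕ → ℝ) :
    ∑ A ∈ s.powerset, (∑ i ∈ s, sg A i * t i) ^ 2 = 2 ^ s.card * ∑ i ∈ s, t i ^ 2 := by
  classical
  induction s using Finset.induction_on with
  | empty => simp
  | insert j s hj ih =>
    rw [sum_signs_insert (fun x => x ^ 2) s j hj, Finset.sum_insert hj, Finset.card_insert_of_notMem hj]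
    have : ∀ A ∈ s.powerset, ((-t j + ∑ i ∈ s, sg A i * t i) ^ 2 + (t j + ∑ i ∈ s, sg A i * t i) ^ 2)
        = 2 * t j ^ 2 + 2 * (∑ i ∈ s, sg A i * t i) ^ 2 := fun A _ => by ring
    rw [Finset.sum_congr rfl this, Finset.sum_add_distrib, Finset.sum_const, ← Finset.mul_sum, ih]
    simp only [Finset.card_powerset, nsmul_eq_mul]
    push_cast; ring

theorem moment4 (s : Finset ℕ) (t : ℕ → ℝ) :
    ∑ A ∈ s.powerset, (∑ i ∈ s, sg A i * t i) ^ 4 ≤ 3 * 2 ^ s.card * (∑ i ∈ s, t i ^ 2) ^ 2 := by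
  classical
  induction s using Finset.induction_on with
  | empty => simp
  | insert j s hj ih =>
    rw [sum_signs_insert (fun x => x ^ 4) s j hj, Finset.sum_insert hj, Finset.card_insert_of_notMem hj]
    have : ∀ A ∈ s.powerset, ((-t j + ∑ i ∈ s, sg A i * t i) ^ 4 + (t j + ∑ i ∈ s, sg A i * t i) ^ 4)
        = 2 * t j ^ 4 + (12 * t j ^ 2 * (∑ i ∈ s, sg A i * t i) ^ 2
          + 2 * (∑ i ∈ s, sg A i * t i) ^ 4) := fun A _ => by ring
    rw [Finset.sum_congr rfl this, Finset.sum_add_distrib, Finset.sum_add_distrib,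
      Finset.sum_const, ← Finset.mul_sum, ← Finset.mul_sum, moment2]
    simp only [Finset.card_powerset, nsmul_eq_mul]
    push_cast
    have h0 : 0 ≤ (2 : ℝ) ^ s.card * t j ^ 4 := by positivity
    rw [pow_succ (2 : ℝ)]
    nlinarith

theorem K_low {p : ℝ} (hp : 2 < p) (s : Finset ℕ) (t : ℕ → ℝ) :
    2 ^ s.card * (∑ i ∈ s, t i ^ 2) ^ (p / 2) ≤
      ∑ A ∈ s.powerset, |∑ i ∈ s, sg A i * t i| ^ p := by
  have h := Real.rpow_arith_mean_le_arith_mean_rpow s.powerset (fun _ => ((2 : ℝ) ^ s.card)⁻¹)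
    (fun A => (∑ i ∈ s, sg A i * t i) ^ 2) (fun _ _ => by positivity)
    (by simp) (fun _ _ => by positivity)
    (p := p / 2) (by linarith)
  rw [← Finset.mul_sum, ← Finset.mul_sum, moment2, inv_mul_cancel_left₀ (by positivity)] at h
  simp only [sq_rpow] at h
  rwa [le_inv_mul_iff₀ (by positivity)] at h

theorem K_up {p : ℝ} (hp : 2 < p) (hp4 : p ≤ 4) (s : Finset ℕ) (t : ℕ → ℝ) :
    ∑ A ∈ s.powerset, |∑ i ∈ s, sg A i * t i| ^ p ≤
      3 * 2 ^ s.card * (∑ i ∈ s, t i ^ 2) ^ (p / 2) := by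
  have h := Real.rpow_arith_mean_le_arith_mean_rpow s.powerset (fun _ => ((2 : ℝ) ^ s.card)⁻¹)
    (fun A => |∑ i ∈ s, sg A i * t i| ^ p) (fun _ _ => by positivity)
    (by simp) (fun _ _ => by positivity)
    (p := 4 / p) (by rw [le_div_iff₀ (by linarith)]; linarith)
  rw [← Finset.mul_sum, ← Finset.mul_sum] at h
  have e : ∀ A : Finset ℕ, (|∑ i ∈ s, sg A i * t i| ^ p) ^ (4 / p) = (∑ i ∈ s, sg A i * t i) ^ 4 := by
    intro A
    rw [← Real.rpow_mul (abs_nonneg _), mul_div_cancel₀ _ (by linarith : p ≠ 0)]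
    norm_cast
    exact Even.pow_abs (by decide) _
  simp only [e] at h
  set M := ((2 : ℝ) ^ s.card)⁻¹ * ∑ A ∈ s.powerset, |∑ i ∈ s, sg A i * t i| ^ p with hM
  have hM0 : 0 ≤ M := by positivity
  have h2 : M ^ (4 / p) ≤ 3 * (∑ i ∈ s, t i ^ 2) ^ 2 := by
    refine h.trans ?_
    rw [inv_mul_le_iff₀ (by positivity)]
    have := moment4 s t
    linarith
  have h3 : M ≤ 3 * (∑ i ∈ s, t i ^ 2) ^ (p / 2) := by
    have hS : 0 ≤ ∑ i ∈ s, t i ^ 2 := Finset.sum_nonneg fun i _ => by positivity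
    calc M = (M ^ (4 / p)) ^ (p / 4) := by
          rw [← Real.rpow_mul hM0, div_mul_div_cancel₀ (by linarith : p ≠ 0)]; simp
      _ ≤ (3 * (∑ i ∈ s, t i ^ 2) ^ 2) ^ (p / 4) :=
          Real.rpow_le_rpow (by positivity) h2 (by linarith)
      _ = 3 ^ (p / 4) * (∑ i ∈ s, t i ^ 2) ^ (p / 2) := by
          rw [Real.mul_rpow (by norm_num) (by positivity), ← Real.rpow_natCast (_ : ℝ) 2,
            ← Real.rpow_mul hS]
          congr 2; push_cast; ring
      _ ≤ 3 ^ (1 : ℝ) * (∑ i ∈ s, t i ^ 2) ^ (p / 2) := by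
          gcongr
          · norm_num
          · linarith
      _ = _ := by simp
  rw [hM, inv_mul_le_iff₀ (by positivity)] at h3
  linarith

end TransLp

namespace TransLp

theorem joint (σ : ℕ → SimpleFunc ℝ ℝ) (N : ℕ) :
    ∃ S : SimpleFunc ℝ (ℕ → ℝ), ∀ x i, S x i = if i < N then σ i x else 0 := by
  induction N with
  | zero => exact ⟨SimpleFunc.const _ 0, fun x i => by simp⟩
  | succ N ih =>
    obtain ⟨S, hS⟩ := ih
    refine ⟨(S.pair (σ N)).map (fun q => Function.update q.1 N q.2), fun x i => ?_⟩
    simp only [SimpleFunc.map_apply, SimpleFunc.pair_apply]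
    by_cases h : i = N
    · subst h; simp
    · rw [Function.update_of_ne h, hS]
      have : i < N ↔ i < N + 1 := by omega
      simp only [this]

/-- p-energy -/
noncomputable def en (p : ℝ) (μ : Measure ℝ) (g : ℝ → ℝ) : ℝ≥0∞ :=
  ∫⁻ x, ENNReal.ofReal (|g x| ^ p) ∂μ

theorem en_eq {p : ℝ} (hp : 0 < p) (μ : Measure ℝ) (g : ℝ → ℝ) :
    en p μ g = eLpNorm g (ENNReal.ofReal p) μ ^ p := by
  rw [eLpNorm_eq_lintegral_rpow_enorm_toReal (by simpa using hp) (by simp), ← ENNReal.rpow_mul,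
    ENNReal.toReal_ofReal hp.le]
  simp only [one_div, inv_mul_cancel₀ hp.ne', ENNReal.rpow_one, en]
  refine lintegral_congr fun x => ?_
  rw [← ENNReal.ofReal_rpow_of_nonneg (abs_nonneg _) hp.le, ← Real.norm_eq_abs, ofReal_norm]

theorem approx {p : ℝ} (hp : 0 < p) (μ : Measure ℝ) (g : ℕ → ℝ → ℝ)
    (hg : ∀ i, MemLp (g i) (ENNReal.ofReal p) μ) (hsum : ∑' i, en p μ (g i) ≠ ∞)
    {η : ℝ≥0∞} (hη : η ≠ 0) :
    ∃ (N : ℕ) (S : SimpleFunc ℝ (ℕ → ℝ)), (∀ x i, N ≤ i → S x i = 0) ∧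
      ∑' i, en p μ (fun x => g i x - S x i) ≤ η := by
  have hη2 : η / 2 ≠ 0 := by simpa using hη
  obtain ⟨N, hN⟩ : ∃ N, ∑' i, en p μ (g (i + N)) ≤ η / 2 := by
    have := ENNReal.tendsto_sum_nat_add (fun i => en p μ (g i)) hsum
    have h2 := this.eventually (ge_mem_nhds (pos_iff_ne_zero.2 hη2))
    exact h2.exists
  obtain ⟨δ, hδ, hδs⟩ := ENNReal.exists_pos_sum_of_countable' hη2 ℕ
  have : ∀ i, ∃ s : SimpleFunc ℝ ℝ, en p μ (fun x => g i x - s x) ≤ δ i := by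
    intro i
    have : (δ i) ^ (1 / p) ≠ 0 := by
      simp only [ne_eq, ENNReal.rpow_eq_zero_iff, not_or, not_and]
      exact ⟨fun h => absurd h (hδ i).ne', fun h => by simp [hp.le]⟩
    obtain ⟨s, hs, -⟩ := (hg i).exists_simpleFunc_eLpNorm_sub_lt (by simp) this
    refine ⟨s, ?_⟩
    rw [en_eq hp]
    calc _ ≤ ((δ i) ^ (1 / p)) ^ p := ENNReal.rpow_le_rpow hs.le hp.le
      _ = δ i := by rw [← ENNReal.rpow_mul]; simp [hp.ne']
  choose σ hσ using this
  obtain ⟨S, hS⟩ := joint σ N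
  refine ⟨N, S, fun x i hi => by rw [hS, if_neg (by omega)], ?_⟩
  rw [← ENNReal.summable.sum_add_tsum_nat_add' (k := N)]
  have e1 : ∀ i ∈ Finset.range N, en p μ (fun x => g i x - S x i) ≤ δ i := by
    intro i hi
    have : (fun x => g i x - S x i) = fun x => g i x - σ i x := by
      ext x; rw [hS, if_pos (Finset.mem_range.1 hi)]
    rw [this]; exact hσ i
  have e2 : ∀ i, en p μ (fun x => g (i + N) x - S x (i + N)) = en p μ (g (i + N)) := by
    intro i; congr 1; ext x; rw [hS, if_neg (by omega), sub_zero]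
  simp only [e2]
  calc _ ≤ ∑ i ∈ Finset.range N, δ i + η / 2 := add_le_add (Finset.sum_le_sum e1) hN
    _ ≤ η / 2 + η / 2 := by gcongr; exact (ENNReal.sum_le_tsum _).trans hδs.le
    _ = η := ENNReal.add_halves η

/-- square function energy -/
noncomputable def Q (p : ℝ) (μ : Measure ℝ) (s : Finset ℕ) (a : ℕ → ℝ) (g : ℝ → ℕ → ℝ) : ℝ≥0∞ :=
  ∫⁻ x, ENNReal.ofReal ((∑ i ∈ s, (a i * g x i) ^ 2) ^ (p / 2)) ∂μ

theorem Q_perturb {p : ℝ} (hp : 2 < p) (hp4 : p ≤ 4) (μ : Measure ℝ) (s : Finset ℕ) (a : ℕ → ℝ)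
    (g h : ℝ → ℕ → ℝ) (hg : ∀ i, AEMeasurable (fun x => g x i) μ)
    (hh : ∀ i, AEMeasurable (fun x => h x i) μ) :
    Q p μ s a g ≤ 16 * (Q p μ s a h + ENNReal.ofReal (∑ i ∈ s, |a i| ^ p) *
      ∑' i, en p μ (fun x => g x i - h x i)) := by
  have hm : AEMeasurable (fun x => ENNReal.ofReal ((∑ i ∈ s, (a i * h x i) ^ 2) ^ (p / 2))) μ := by
    refine AEMeasurable.ennreal_ofReal (AEMeasurable.pow_const ?_ _)
    exact Finset.aemeasurable_fun_sum _ fun i _ => ((hh i).const_mul _).pow_const _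
  have hm2 : ∀ i, AEMeasurable (fun x => ENNReal.ofReal (|g x i - h x i| ^ p)) μ := fun i => by
    have := (hg i).sub (hh i)
    refine AEMeasurable.ennreal_ofReal (AEMeasurable.pow_const ?_ _)
    exact this.abs
  calc Q p μ s a g ≤ ∫⁻ x, 16 * (ENNReal.ofReal ((∑ i ∈ s, (a i * h x i) ^ 2) ^ (p / 2)) +
        ENNReal.ofReal (∑ i ∈ s, |a i| ^ p) * ∑ i ∈ s, ENNReal.ofReal (|g x i - h x i| ^ p)) ∂μ := by
        refine lintegral_mono fun x => ?_
        rw [← ENNReal.ofReal_sum_of_nonneg (fun i _ => by positivity),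
          ← ENNReal.ofReal_mul (Finset.sum_nonneg fun i _ => by positivity),
          ← ENNReal.ofReal_add (by positivity) (by positivity),
          show (16 : ℝ≥0∞) = ENNReal.ofReal 16 by simp, ← ENNReal.ofReal_mul (by norm_num)]
        refine ENNReal.ofReal_le_ofReal ?_
        have h1 := P3 hp hp4 s (fun i => a i * g x i) (fun i => a i * h x i)
        have h2 := P2 hp hp4 s a (fun i => g x i - h x i)
        simp only [← mul_sub] at h1
        linarith
    _ = 16 * (Q p μ s a h + ENNReal.ofReal (∑ i ∈ s, |a i| ^ p) *
          ∑ i ∈ s, en p μ (fun x => g x i - h x i)) := by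
        rw [lintegral_const_mul' _ _ (by simp), lintegral_add_left' hm,
          lintegral_const_mul' _ _ (by simp), lintegral_finsetSum' _ fun i _ => hm2 i]
        rfl
    _ ≤ _ := by gcongr; exact ENNReal.sum_le_tsum _

/-- coordinate functional -/
noncomputable def coord (p : ℝ) (μ : Measure ℝ) (N : ℕ) (S : SimpleFunc ℝ (ℕ → ℝ))
    (q : Finset ℕ × (ℕ → ℝ)) : (ℕ →₀ ℝ) →ₗ[ℝ] ℝ :=
  ((μ.real (S ⁻¹' {q.2}) * ((2 : ℝ) ^ N)⁻¹) ^ (1 / p)) •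
    ∑ i ∈ Finset.range N, (sg q.1 i * q.2 i) • Finsupp.lapply i

theorem coord_sum {p : ℝ} (hp : 0 < p) (μ : Measure ℝ) [IsFiniteMeasure μ] (N : ℕ)
    (S : SimpleFunc ℝ (ℕ → ℝ)) (a : ℕ →₀ ℝ) :
    ∑ q ∈ (Finset.range N).powerset ×ˢ S.range, ENNReal.ofReal (|coord p μ N S q a| ^ p) =
      ∫⁻ x, ENNReal.ofReal (((2 : ℝ) ^ N)⁻¹ * ∑ A ∈ (Finset.range N).powerset,
        |∑ i ∈ Finset.range N, sg A i * (a i * S x i)| ^ p) ∂μ := by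
  let G : (ℕ → ℝ) → ℝ≥0∞ := fun v => ENNReal.ofReal (((2 : ℝ) ^ N)⁻¹ *
    ∑ A ∈ (Finset.range N).powerset, |∑ i ∈ Finset.range N, sg A i * (a i * v i)| ^ p)
  have e : ∫⁻ x, G (S x) ∂μ = ∑ v ∈ S.range, G v * μ (S ⁻¹' {v}) := by
    rw [← SimpleFunc.map_lintegral, ← SimpleFunc.lintegral_eq_lintegral]
    rfl
  change _ = ∫⁻ x, G (S x) ∂μ
  rw [e, Finset.sum_product_right]
  refine Finset.sum_congr rfl fun v _ => ?_
  rw [← ENNReal.ofReal_sum_of_nonneg (fun i _ => by positivity), ← ofReal_measureReal (by finiteness),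
    ← ENNReal.ofReal_mul (by positivity)]
  congr 1
  rw [mul_assoc, Finset.sum_mul, Finset.mul_sum]
  refine Finset.sum_congr rfl fun A _ => ?_
  simp only [coord, LinearMap.smul_apply, LinearMap.sum_apply, Finsupp.lapply_apply, smul_eq_mul]
  rw [abs_mul, Real.mul_rpow (abs_nonneg _) (abs_nonneg _), abs_of_nonneg (by positivity),
    ← Real.rpow_mul (by positivity), one_div, inv_mul_cancel₀ hp.ne', Real.rpow_one]
  have : ∀ i, sg A i * v i * a i = sg A i * (a i * v i) := fun i => by ring
  simp only [this]
  ring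

theorem coord_bounds {p : ℝ} (hp : 2 < p) (hp4 : p ≤ 4) (μ : Measure ℝ) [IsFiniteMeasure μ] (N : ℕ)
    (S : SimpleFunc ℝ (ℕ → ℝ)) (hS : ∀ x i, N ≤ i → S x i = 0) (a : ℕ →₀ ℝ) :
    Q p μ a.support a (fun x => S x) ≤
      ∑ q ∈ (Finset.range N).powerset ×ˢ S.range, ENNReal.ofReal (|coord p μ N S q a| ^ p) ∧
    ∑ q ∈ (Finset.range N).powerset ×ˢ S.range, ENNReal.ofReal (|coord p μ N S q a| ^ p) ≤
      3 * Q p μ a.support a (fun x => S x) := by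
  have e : ∀ x, ∑ i ∈ a.support, (a i * S x i) ^ 2 = ∑ i ∈ Finset.range N, (a i * S x i) ^ 2 := by
    intro x
    rw [Finset.sum_subset (Finset.subset_union_left (s₁ := a.support) (s₂ := Finset.range N)),
      Finset.sum_subset (Finset.subset_union_right (s₁ := a.support) (s₂ := Finset.range N))]
    · intro i _ hi
      rw [hS x i (by simpa using hi)]; simp
    · intro i _ hi
      rw [Finsupp.notMem_support_iff.1 hi]; simp
  simp only [Q, e]
  rw [coord_sum (by linarith)]
  constructor
  · refine lintegral_mono fun x => ENNReal.ofReal_le_ofReal ?_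
    rw [le_inv_mul_iff₀ (by positivity)]
    simpa using K_low hp (Finset.range N) (fun i => a i * S x i)
  · rw [← lintegral_const_mul' _ _ (by simp)]
    refine lintegral_mono fun x => ?_
    rw [show (3 : ℝ≥0∞) = ENNReal.ofReal 3 by simp, ← ENNReal.ofReal_mul (by norm_num)]
    refine ENNReal.ofReal_le_ofReal ?_
    rw [inv_mul_le_iff₀ (by positivity)]
    have := K_up hp hp4 (Finset.range N) (fun i => a i * S x i)
    rw [Finset.card_range] at this
    linarith

end TransLp

namespace TransLp

theorem extend_lp {p : ℝ} (hp : 0 < p) [Fact (1 ≤ ENNReal.ofReal p)]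
    {V : Type*} [NormedAddCommGroup V] [NormedSpace ℝ V]
    {E : Type*} [AddCommGroup E] [Module ℝ E] (e : E →ₗ[ℝ] V) (hd : DenseRange e)
    {J : Type*} [Countable J] (φ : J → E →ₗ[ℝ] ℝ) (b B : ℝ) (hb : 0 < b) (hB : 0 < B)
    (h1 : ∀ a, ENNReal.ofReal (‖e a‖ ^ p) ≤ ENNReal.ofReal b *
      ∑' j, ENNReal.ofReal (|φ j a| ^ p))
    (h2 : ∀ a, ∑' j, ENNReal.ofReal (|φ j a| ^ p) ≤ ENNReal.ofReal (B * ‖e a‖ ^ p)) :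
    ∃ c C : ℝ, 0 < c ∧ c ≤ C ∧ ∃ T : V →ₗ[ℝ] lp (fun _ : ℕ => ℝ) (ENNReal.ofReal p),
        ∀ x, c * ‖x‖ ≤ ‖T x‖ ∧ ‖T x‖ ≤ C * ‖x‖ := by
  obtain ⟨g, hg⟩ := Countable.exists_injective_nat J
  let ψ : ℕ → E →ₗ[ℝ] ℝ := Function.extend g φ 0
  have hpt : (ENNReal.ofReal p).toReal = p := ENNReal.toReal_ofReal hp.le
  have hψ : ∀ a, ∑' k, ENNReal.ofReal (|ψ k a| ^ p) = ∑' j, ENNReal.ofReal (|φ j a| ^ p) := by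
    intro a
    rw [← hg.tsum_eq (f := fun k => ENNReal.ofReal (|ψ k a| ^ p))]
    · simp only [ψ, hg.extend_apply]
    · intro k hk
      by_contra hne
      apply hk
      have : ψ k = 0 := by
        simp only [ψ]
        rw [Function.extend_apply' _ _ _ (by simpa using hne)]; rfl
      simp [this, Real.zero_rpow hp.ne']
  have hfin : ∀ a, ∑' k, ENNReal.ofReal (|ψ k a| ^ p) ≠ ∞ := fun a => by
    rw [hψ]; exact ne_top_of_le_ne_top (by simp) (h2 a)
  have hsm : ∀ a, Summable fun k => |ψ k a| ^ p := fun a => by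
    have := ENNReal.summable_toReal (hfin a)
    refine this.congr fun k => ?_
    rw [ENNReal.toReal_ofReal (by positivity)]
  have hmem : ∀ a, Memℓp (E := fun _ : ℕ => ℝ) (fun k => ψ k a) (ENNReal.ofReal p) := fun a => by
    refine memℓp_gen ?_
    rw [hpt]; simpa only [Real.norm_eq_abs] using hsm a
  let T0 : E →ₗ[ℝ] lp (fun _ : ℕ => ℝ) (ENNReal.ofReal p) :=
    { toFun := fun a => ⟨fun k => ψ k a, hmem a⟩
      map_add' := fun a a' => by ext k; exact map_add (ψ k) a a'
      map_smul' := fun r a => by ext k; exact map_smul (ψ k) r a }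
  have hT0 : ∀ a, ENNReal.ofReal (‖T0 a‖ ^ p) = ∑' j, ENNReal.ofReal (|φ j a| ^ p) := fun a => by
    have := lp.norm_rpow_eq_tsum (p := ENNReal.ofReal p) (by rw [hpt]; exact hp) (T0 a)
    rw [hpt] at this
    have h3 : ∑' k, ‖T0 a k‖ ^ p = ∑' k, |ψ k a| ^ p := rfl
    rw [this, ← hψ, h3, ENNReal.ofReal_tsum_of_nonneg (fun k => by positivity) (hsm a)]
  have hup : ∀ a, ‖T0 a‖ ≤ B ^ (1 / p) * ‖e a‖ := fun a => by
    have := h2 a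
    rw [← hT0, ENNReal.ofReal_le_ofReal_iff (by positivity)] at this
    have h3 := Real.rpow_le_rpow (by positivity) this (by positivity : 0 ≤ 1 / p)
    rwa [Real.mul_rpow (by positivity) (by positivity), ← Real.rpow_mul (by positivity),
      ← Real.rpow_mul (by positivity), mul_one_div_cancel hp.ne', Real.rpow_one, Real.rpow_one] at h3
  have hlow : ∀ a, ‖e a‖ ≤ b ^ (1 / p) * ‖T0 a‖ := fun a => by
    have := h1 a
    rw [← hT0, ← ENNReal.ofReal_mul hb.le, ENNReal.ofReal_le_ofReal_iff (by positivity)] at this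
    have h3 := Real.rpow_le_rpow (by positivity) this (by positivity : 0 ≤ 1 / p)
    rwa [Real.mul_rpow (by positivity) (by positivity), ← Real.rpow_mul (by positivity),
      ← Real.rpow_mul (by positivity), mul_one_div_cancel hp.ne', Real.rpow_one, Real.rpow_one] at h3
  let T := T0.extendOfNorm e
  have hTe : ∀ a, T (e a) = T0 a := T0.extendOfNorm_eq hd ⟨_, hup⟩
  have hTup : ∀ x, ‖T x‖ ≤ B ^ (1 / p) * ‖x‖ := T0.norm_extendOfNorm_apply_le hd _ hup
  have hTlow : ∀ x, ‖x‖ ≤ b ^ (1 / p) * ‖T x‖ := by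
    intro x
    refine hd.induction_on (p := fun x => ‖x‖ ≤ b ^ (1 / p) * ‖T x‖) x ?_ ?_
    · exact isClosed_le continuous_norm (continuous_const.mul (T.continuous.norm))
    · intro a; rw [hTe]; exact hlow a
  have hb' : 0 < b ^ (1 / p) := by positivity
  refine ⟨(b ^ (1 / p))⁻¹, max (B ^ (1 / p)) (b ^ (1 / p))⁻¹, by positivity, le_max_right _ _,
    T.toLinearMap, fun x => ⟨?_, ?_⟩⟩
  · rw [inv_mul_le_iff₀ hb']; exact hTlow x
  · refine (hTup x).trans ?_
    gcongr; exact le_max_left _ _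

section
variable {p : ℝ} [Fact (1 ≤ ENNReal.ofReal p)]

theorem en_Lp (hp : 0 < p) (g : Lp ℝ (ENNReal.ofReal p) (volume : Measure ℝ)) :
    en p volume g = ENNReal.ofReal (‖g‖ ^ p) := by
  rw [en_eq hp, Lp.norm_def, ← ENNReal.ofReal_rpow_of_nonneg (by positivity) hp.le,
    ENNReal.ofReal_toReal (Lp.eLpNorm_ne_top g)]

theorem en_comb (hp : 0 < p) (F : ℕ → Lp ℝ (ENNReal.ofReal p) (volume : Measure ℝ))
    (s : Finset ℕ) (c : ℕ → ℝ) :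
    en p volume (fun x => ∑ i ∈ s, c i * F i x) = ENNReal.ofReal (‖∑ i ∈ s, c i • F i‖ ^ p) := by
  rw [← en_Lp hp]
  refine lintegral_congr_ae ?_
  have h : ⇑(∑ i ∈ s, c i • F i) =ᵐ[volume] fun x => ∑ i ∈ s, c i * F i x := by
    classical
    induction s using Finset.induction_on with
    | empty =>
      simp only [Finset.sum_empty]
      exact Lp.coeFn_zero _ _ _
    | insert j s hj ih =>
      simp only [Finset.sum_insert hj]
      filter_upwards [Lp.coeFn_add (c j • F j) (∑ i ∈ s, c i • F i), ih,
        Lp.coeFn_smul (c j) (F j)] with x h1 h2 h3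
      rw [h1, Pi.add_apply, h2, h3]; rfl
  filter_upwards [h] with x hx
  rw [hx]

theorem meas_F (F : ℕ → Lp ℝ (ENNReal.ofReal p) (volume : Measure ℝ)) (i : ℕ) :
    Measurable (F i : ℝ → ℝ) := (Lp.stronglyMeasurable (F i)).measurable

theorem Q_le_norm (hp : 2 < p) (F : ℕ → Lp ℝ (ENNReal.ofReal p) (volume : Measure ℝ))
    (C : ℝ) (hC : 1 ≤ C) (hunc : ∀ (a : ℕ → ℝ) (s : Finset ℕ) (sgn : ℕ → ℝ),
      (∀ i, sgn i = 1 ∨ sgn i = -1) →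
      ‖∑ i ∈ s, (sgn i * a i) • F i‖ ≤ C * ‖∑ i ∈ s, a i • F i‖) (s : Finset ℕ) (a : ℕ → ℝ) :
    Q p volume s a (fun x i => F i x) ≤ ENNReal.ofReal (C ^ p * ‖∑ i ∈ s, a i • F i‖ ^ p) := by
  have hp0 : 0 < p := by linarith
  have key : (2 : ℝ≥0∞) ^ s.card * Q p volume s a (fun x i => F i x) ≤
      2 ^ s.card * ENNReal.ofReal (C ^ p * ‖∑ i ∈ s, a i • F i‖ ^ p) := by
    calc _ = ∫⁻ x, 2 ^ s.card * ENNReal.ofReal ((∑ i ∈ s, (a i * F i x) ^ 2) ^ (p / 2)) := by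
          rw [lintegral_const_mul' _ _ (by finiteness)]; rfl
      _ ≤ ∫⁻ x, ∑ A ∈ s.powerset, ENNReal.ofReal (|∑ i ∈ s, (sg A i * a i) * F i x| ^ p) := by
          refine lintegral_mono fun x => ?_
          rw [← ENNReal.ofReal_sum_of_nonneg (fun i _ => by positivity),
            show (2 : ℝ≥0∞) = ENNReal.ofReal 2 by simp, ← ENNReal.ofReal_pow (by norm_num),
            ← ENNReal.ofReal_mul (by positivity)]
          refine ENNReal.ofReal_le_ofReal ?_
          simpa only [mul_assoc] using K_low hp s (fun i => a i * F i x)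
      _ = ∑ A ∈ s.powerset, en p volume (fun x => ∑ i ∈ s, (sg A i * a i) * F i x) := by
          rw [lintegral_finsetSum]
          · rfl
          · intro A _
            refine Measurable.ennreal_ofReal (Measurable.pow_const ?_ _)
            exact (Finset.measurable_fun_sum _ fun i _ => (meas_F F i).const_mul _).abs
      _ ≤ ∑ A ∈ s.powerset, ENNReal.ofReal (C ^ p * ‖∑ i ∈ s, a i • F i‖ ^ p) := by
          refine Finset.sum_le_sum fun A _ => ?_
          rw [en_comb hp0, ← Real.mul_rpow (by linarith) (norm_nonneg _)]
          exact ENNReal.ofReal_le_ofReal (Real.rpow_le_rpow (norm_nonneg _)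
            (hunc a s (sg A) (sg_or A)) hp0.le)
      _ = _ := by simp
  exact (ENNReal.mul_le_mul_iff_right (by positivity) (by finiteness)).1 key

theorem norm_le_Q (hp : 2 < p) (hp4 : p ≤ 4)
    (F : ℕ → Lp ℝ (ENNReal.ofReal p) (volume : Measure ℝ))
    (C : ℝ) (hC : 1 ≤ C) (hunc : ∀ (a : ℕ → ℝ) (s : Finset ℕ) (sgn : ℕ → ℝ),
      (∀ i, sgn i = 1 ∨ sgn i = -1) →
      ‖∑ i ∈ s, (sgn i * a i) • F i‖ ≤ C * ‖∑ i ∈ s, a i • F i‖) (s : Finset ℕ) (a : ℕ → ℝ) :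
    ENNReal.ofReal (‖∑ i ∈ s, a i • F i‖ ^ p) ≤
      ENNReal.ofReal (3 * C ^ p) * Q p volume s a (fun x i => F i x) := by
  have hp0 : 0 < p := by linarith
  have key : (2 : ℝ≥0∞) ^ s.card * ENNReal.ofReal (‖∑ i ∈ s, a i • F i‖ ^ p) ≤
      2 ^ s.card * (ENNReal.ofReal (3 * C ^ p) * Q p volume s a (fun x i => F i x)) := by
    calc _ = ∑ A ∈ s.powerset, ENNReal.ofReal (‖∑ i ∈ s, a i • F i‖ ^ p) := by simp
      _ ≤ ∑ A ∈ s.powerset, ENNReal.ofReal (C ^ p) *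
            en p volume (fun x => ∑ i ∈ s, (sg A i * a i) * F i x) := by
          refine Finset.sum_le_sum fun A _ => ?_
          rw [en_comb hp0, ← ENNReal.ofReal_mul (by positivity),
            ← Real.mul_rpow (by linarith) (norm_nonneg _)]
          refine ENNReal.ofReal_le_ofReal (Real.rpow_le_rpow (norm_nonneg _) ?_ hp0.le)
          have := hunc (fun i => sg A i * a i) s (sg A) (sg_or A)
          simpa only [← mul_assoc, sg_mul_self, one_mul] using this
      _ = ENNReal.ofReal (C ^ p) * ∫⁻ x, ∑ A ∈ s.powerset,
            ENNReal.ofReal (|∑ i ∈ s, (sg A i * a i) * F i x| ^ p) := by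
          rw [← Finset.mul_sum, lintegral_finsetSum]
          · rfl
          · intro A _
            refine Measurable.ennreal_ofReal (Measurable.pow_const ?_ _)
            exact (Finset.measurable_fun_sum _ fun i _ => (meas_F F i).const_mul _).abs
      _ ≤ ENNReal.ofReal (C ^ p) * ∫⁻ x, ENNReal.ofReal (3 * 2 ^ s.card) *
            ENNReal.ofReal ((∑ i ∈ s, (a i * F i x) ^ 2) ^ (p / 2)) := by
          gcongr with x
          rw [← ENNReal.ofReal_sum_of_nonneg (fun i _ => by positivity),
            ← ENNReal.ofReal_mul (by positivity)]
          refine ENNReal.ofReal_le_ofReal ?_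
          simpa only [mul_assoc] using K_up hp hp4 s (fun i => a i * F i x)
      _ = _ := by
          rw [lintegral_const_mul' _ _ (by finiteness), ENNReal.ofReal_mul (by norm_num),
            ENNReal.ofReal_mul (by norm_num), ENNReal.ofReal_pow (by norm_num)]
          simp only [Q, ENNReal.ofReal_ofNat]
          ring
  exact (ENNReal.mul_le_mul_iff_right (by positivity) (by finiteness)).1 key

theorem coef_le_Q (hp : 2 < p) (F : ℕ → Lp ℝ (ENNReal.ofReal p) (volume : Measure ℝ))
    (m : ℝ) (hm : ∀ i, ‖F i‖ ^ p = m) (s : Finset ℕ) (a : ℕ → ℝ) :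
    ENNReal.ofReal ((∑ i ∈ s, |a i| ^ p) * m) ≤ Q p volume s a (fun x i => F i x) := by
  have hp0 : 0 < p := by linarith
  calc _ = ∑ i ∈ s, ENNReal.ofReal (|a i| ^ p) * en p volume (F i) := by
        rw [Finset.sum_mul, ENNReal.ofReal_sum_of_nonneg]
        · refine Finset.sum_congr rfl fun i _ => ?_
          rw [en_Lp hp0, hm, ENNReal.ofReal_mul (by positivity)]
        · intro i _; rw [← hm i]; positivity
    _ = ∫⁻ x, ∑ i ∈ s, ENNReal.ofReal (|a i| ^ p) * ENNReal.ofReal (|F i x| ^ p) := by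
        rw [lintegral_finsetSum]
        · refine Finset.sum_congr rfl fun i _ => ?_
          rw [lintegral_const_mul' _ _ (by finiteness)]; rfl
        · intro i _
          exact (Measurable.ennreal_ofReal ((meas_F F i).abs.pow_const _)).const_mul _
    _ ≤ _ := by
        refine lintegral_mono fun x => ?_
        have : ∀ i, ENNReal.ofReal (|a i| ^ p) * ENNReal.ofReal (|F i x| ^ p) =
            ENNReal.ofReal (|a i * F i x| ^ p) := fun i => by
          rw [← ENNReal.ofReal_mul (by positivity), abs_mul,
            Real.mul_rpow (abs_nonneg _) (abs_nonneg _)]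
        simp only [this]
        rw [← ENNReal.ofReal_sum_of_nonneg (fun i _ => by positivity)]
        exact ENNReal.ofReal_le_ofReal (P1 hp s fun i => a i * F i x)

end

theorem F_eq {p : ℝ} [Fact (1 ≤ ENNReal.ofReal p)]
    (f : Lp ℝ (ENNReal.ofReal p) (volume : Measure ℝ)) (lam : ℕ → ℝ)
    (F : ℕ → Lp ℝ (ENNReal.ofReal p) (volume : Measure ℝ))
    (hF : ∀ i : ℕ, (F i : ℝ → ℝ) =ᵐ[volume] fun x => f (x - lam i)) (i : ℕ) :
    F i = DomAddAct.mk (-lam i) +ᵥ f := by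
  apply Lp.ext
  filter_upwards [hF i, DomAddAct.vadd_Lp_ae_eq (DomAddAct.mk (-lam i)) f] with x h1 h2
  rw [h1, h2]
  simp [sub_eq_neg_add]

theorem translate_small {p : ℝ} [Fact (1 ≤ ENNReal.ofReal p)]
    (f : Lp ℝ (ENNReal.ofReal p) (volume : Measure ℝ)) (lam : ℕ → ℝ)
    (F : ℕ → Lp ℝ (ENNReal.ofReal p) (volume : Measure ℝ))
    (hF : ∀ i : ℕ, (F i : ℝ → ℝ) =ᵐ[volume] fun x => f (x - lam i)) {κ : ℝ} (hκ : 0 < κ) :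
    ∃ δ > 0, ∀ i j, |lam i - lam j| < δ → ‖F i - F j‖ < κ := by
  have : Fact (ENNReal.ofReal p ≠ ∞) := ⟨by simp⟩
  have hFm := F_eq f lam F hF
  have hc : Continuous fun h : ℝ => DomAddAct.mk h +ᵥ f := by
    have : Continuous fun h : ℝ => (DomAddAct.mk h : ℝᵈᵃᵃ) := DomAddAct.continuous_mk
    exact this.vadd continuous_const
  obtain ⟨δ, hδ, h⟩ := Metric.continuous_iff.1 hc 0 κ hκ
  refine ⟨δ, hδ, fun i j hij => ?_⟩
  have h2 := h (lam j - lam i) (by rw [Real.dist_eq, sub_zero, abs_sub_comm]; exact hij)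
  rw [← dist_eq_norm, hFm i, hFm j]
  have e1 : DomAddAct.mk (-lam i) +ᵥ f = DomAddAct.mk (-lam j) +ᵥ (DomAddAct.mk (lam j - lam i) +ᵥ f) := by
    rw [← add_vadd]; congr 1
    rw [← DomAddAct.mk_add]; congr 1; ring
  have e0 : (DomAddAct.mk (0 : ℝ) : ℝᵈᵃᵃ) +ᵥ f = f := by
    rw [DomAddAct.mk_zero, zero_vadd]
  rw [e0] at h2
  rw [e1, DomAddAct.dist_vadd_Lp]
  exact h2

end TransLp

namespace TransLp

theorem local_sum {p : ℝ} [Fact (1 ≤ ENNReal.ofReal p)] (hp : 0 < p)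
    (f : Lp ℝ (ENNReal.ofReal p) (volume : Measure ℝ)) (lam : ℕ → ℝ)
    (F : ℕ → Lp ℝ (ENNReal.ofReal p) (volume : Measure ℝ))
    (hF : ∀ i : ℕ, (F i : ℝ → ℝ) =ᵐ[volume] fun x => f (x - lam i)) {δ : ℝ}
    (hsep : ∀ i j, i ≠ j → δ ≤ |lam i - lam j|) (u v : ℝ) (huv : v - u ≤ δ) :
    ∑' i, en p (volume.restrict (Set.Ico u v)) (F i) ≠ ∞ := by
  let J : ℕ → Set ℝ := fun i => (fun x => x + lam i) ⁻¹' Set.Ico u v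
  have hJ : ∀ i, MeasurableSet (J i) := fun i => measurableSet_Ico.preimage (measurable_add_const _)
  have hd : Pairwise (Function.onFun Disjoint J) := by
    intro i j hij
    refine Set.disjoint_left.2 fun x hx hy => ?_
    have := hsep i j hij
    simp only [J, Set.mem_preimage, Set.mem_Ico] at hx hy
    rcases le_abs.1 this with h | h <;> linarith [hx.1, hx.2, hy.1, hy.2]
  have e : ∀ i, en p (volume.restrict (Set.Ico u v)) (F i) =
      ∫⁻ x in J i, ENNReal.ofReal (|f x| ^ p) := by
    intro i
    have h1 : en p (volume.restrict (Set.Ico u v)) (F i) =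
        ∫⁻ x in Set.Ico u v, ENNReal.ofReal (|f (x - lam i)| ^ p) := by
      refine lintegral_congr_ae ?_
      filter_upwards [ae_restrict_of_ae (hF i)] with x hx
      rw [hx]
    rw [h1, ← lintegral_indicator measurableSet_Ico, ← lintegral_indicator (hJ i),
      ← lintegral_add_right_eq_self _ (lam i)]
    refine lintegral_congr fun x => ?_
    simp only [Set.indicator, J, Set.mem_preimage, add_sub_cancel_right]
  simp only [e]
  rw [← lintegral_iUnion hJ hd]
  refine ne_top_of_le_ne_top ?_ (setLIntegral_le_lintegral _ _)
  change en p volume f ≠ ∞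
  rw [en_Lp hp]; simp

end TransLp

open TransLp

theorem unconditional_translates_span_embeds_lp
    (p : ℝ) (hp : 2 < p) (hp4 : p ≤ 4)
    [Fact (1 ≤ ENNReal.ofReal p)]
    (f : Lp ℝ (ENNReal.ofReal p) (volume : Measure ℝ))
    (lam : ℕ → ℝ) (hlam : Function.Injective lam)
    (F : ℕ → Lp ℝ (ENNReal.ofReal p) (volume : Measure ℝ))
    (hF : ∀ i : ℕ, (F i : ℝ → ℝ) =ᵐ[volume] fun x => f (x - lam i))
    (hFne : ∀ i, F i ≠ 0)
    (hunc : ∃ C : ℝ, ∀ (a : ℕ → ℝ) (s : Finset ℕ) (sgn : ℕ → ℝ),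
      (∀ i, sgn i = 1 ∨ sgn i = -1) →
      ‖∑ i ∈ s, (sgn i * a i) • F i‖ ≤ C * ‖∑ i ∈ s, a i • F i‖)
    (hbasic : ∃ K : ℝ, ∀ (a : ℕ → ℝ) (m n : ℕ), m ≤ n →
      ‖∑ i ∈ Finset.range m, a i • F i‖ ≤ K * ‖∑ i ∈ Finset.range n, a i • F i‖) :
    ∃ c C : ℝ, 0 < c ∧ c ≤ C ∧
      ∃ T : (Submodule.span ℝ (Set.range F)).topologicalClosure →ₗ[ℝ]
          lp (fun _ : ℕ => ℝ) (ENNReal.ofReal p),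
        ∀ x, c * ‖x‖ ≤ ‖T x‖ ∧ ‖T x‖ ≤ C * ‖x‖ := by
  have hp0 : 0 < p := by linarith
  obtain ⟨C, hunc⟩ := hunc
  have hC : 1 ≤ C := by
    have h := hunc (fun _ => 1) {0} (fun _ => 1) (fun _ => Or.inl rfl)
    simp only [mul_one, one_smul, Finset.sum_singleton] at h
    have h0 := norm_pos_iff.2 (hFne 0)
    nlinarith
  have hnorm : ∀ i, ‖F i‖ = ‖f‖ := fun i => by
    rw [F_eq f lam F hF i, DomAddAct.norm_vadd_Lp]
  have hf : 0 < ‖f‖ := by rw [← hnorm 0]; exact norm_pos_iff.2 (hFne 0)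
  set m : ℝ := ‖f‖ ^ p with hm
  have hm0 : 0 < m := by positivity
  have hFm : ∀ i, ‖F i‖ ^ p = m := fun i => by rw [hnorm]
  have hQ1 := Q_le_norm hp F C hC hunc
  have hQ2 := norm_le_Q hp hp4 F C hC hunc
  have hQ3 := coef_le_Q hp F m hFm
  have hCp : 0 < C ^ p := by positivity
  -- uniform discreteness
  obtain ⟨δ, hδ, hsep⟩ : ∃ δ > 0, ∀ i j, i ≠ j → δ ≤ |lam i - lam j| := by
    obtain ⟨δ, hδ, h⟩ := translate_small f lam F hF (κ := ‖f‖ / C) (by positivity)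
    refine ⟨δ, hδ, fun i j hij => ?_⟩
    by_contra hlt
    have h1 := h i j (not_le.1 hlt)
    have h2 := (hQ3 {i, j} (fun k => if k = i then 1 else -1)).trans (hQ1 _ _)
    rw [ENNReal.ofReal_le_ofReal_iff (by positivity)] at h2
    simp only [Finset.sum_pair hij, if_neg hij.symm, if_true, abs_one, abs_neg, Real.one_rpow,
      one_smul, neg_smul, ← sub_eq_add_neg] at h2
    rw [lt_div_iff₀ (by positivity)] at h1
    have h3 : (‖F i - F j‖ * C) ^ p ≤ m := Real.rpow_le_rpow (by positivity) h1.le hp0.le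
    rw [Real.mul_rpow (by positivity) (by positivity)] at h3
    linarith
  let I : ℤ → Set ℝ := fun n => Set.Ico (n • δ) ((n + 1) • δ)
  let μ : ℤ → Measure ℝ := fun n => volume.restrict (I n)
  have hμf : ∀ n, IsFiniteMeasure (μ n) := fun n => by
    dsimp only [μ, I]; infer_instance
  have hvol : (volume : Measure ℝ) = Measure.sum μ := by
    rw [← Measure.restrict_iUnion (Set.pairwise_disjoint_Ico_zsmul δ) (fun n => measurableSet_Ico),
      iUnion_Ico_zsmul hδ, Measure.restrict_univ]
  have hη : ENNReal.ofReal (m / 32) ≠ 0 := by simpa using hm0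
  obtain ⟨η, hη0, hηs⟩ := ENNReal.exists_pos_sum_of_countable' hη ℤ
  have happ : ∀ n, ∃ (N : ℕ) (S : SimpleFunc ℝ (ℕ → ℝ)), (∀ x i, N ≤ i → S x i = 0) ∧
      ∑' i, en p (μ n) (fun x => F i x - S x i) ≤ η n := fun n =>
    approx hp0 (μ n) (fun i => F i) (fun i => (Lp.memLp (F i)).restrict _)
      (local_sum hp0 f lam F hF hsep _ _ (by rw [add_smul, one_smul]; linarith)) (hη0 n).ne'
  choose N S hS0 hS using happ
  have hQsum : ∀ a : ℕ →₀ ℝ, Q p volume a.support a (fun x i => F i x) =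
      ∑' n, Q p (μ n) a.support a (fun x i => F i x) := fun a => by
    simp only [Q]
    rw [← lintegral_sum_measure, ← hvol]
  have hmS : ∀ n i, Measurable fun x => S n x i := fun n i =>
    ((S n).map (fun v : ℕ → ℝ => v i)).measurable
  have hA : ∀ a : ℕ →₀ ℝ, Q p volume a.support a (fun x i => F i x) ≤
      32 * ∑' n, Q p (μ n) a.support a (fun x => S n x) ∧
      ∑' n, Q p (μ n) a.support a (fun x => S n x) ≤
      32 * Q p volume a.support a (fun x i => F i x) := by
    intro a
    set α := ∑ i ∈ a.support, |a i| ^ p with hα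
    have hα0 : 0 ≤ α := Finset.sum_nonneg fun i _ => by positivity
    have herr : ∑' n, ENNReal.ofReal α * η n ≤ ENNReal.ofReal (α * m / 32) := by
      rw [ENNReal.tsum_mul_left, mul_div_assoc, ENNReal.ofReal_mul hα0]
      gcongr
    have b1 : Q p volume a.support a (fun x i => F i x) ≤
        16 * (∑' n, Q p (μ n) a.support a (fun x => S n x) + ENNReal.ofReal (α * m / 32)) := by
      rw [hQsum]
      refine le_trans (ENNReal.tsum_le_tsum fun n => (Q_perturb hp hp4 (μ n) a.support a
        (fun x i => F i x) (fun x => S n x) (fun i => (meas_F F i).aemeasurable)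
        (fun i => (hmS n i).aemeasurable)).trans
        (mul_le_mul_right (add_le_add_right (mul_le_mul_right (hS n) _) _) _)) ?_
      rw [ENNReal.tsum_mul_left, ENNReal.tsum_add]
      gcongr
    have b2 : ∑' n, Q p (μ n) a.support a (fun x => S n x) ≤
        16 * (Q p volume a.support a (fun x i => F i x) + ENNReal.ofReal (α * m / 32)) := by
      rw [hQsum]
      have hS' : ∀ n, ∑' i, en p (μ n) (fun x => S n x i - F i x) ≤ η n := fun n => by
        refine le_of_eq_of_le ?_ (hS n)
        simp only [en, abs_sub_comm]
      refine le_trans (ENNReal.tsum_le_tsum fun n => (Q_perturb hp hp4 (μ n) a.support a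
        (fun x => S n x) (fun x i => F i x) (fun i => (hmS n i).aemeasurable)
        (fun i => (meas_F F i).aemeasurable)).trans
        (mul_le_mul_right (add_le_add_right (mul_le_mul_right (hS' n) _) _) _)) ?_
      rw [ENNReal.tsum_mul_left, ENNReal.tsum_add]
      gcongr
    have b3 := hQ3 a.support a
    have b4 : Q p volume a.support a (fun x i => F i x) ≠ ∞ :=
      ne_top_of_le_ne_top (by simp) (hQ1 a.support a)
    rw [← hα] at b3
    have b5 : ∑' n, Q p (μ n) a.support a (fun x => S n x) ≠ ∞ :=
      ne_top_of_le_ne_top (by finiteness) b2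
    generalize Q p volume a.support a (fun x i => F i x) = X at *
    generalize ∑' n, Q p (μ n) a.support a (fun x => S n x) = Y at *
    lift X to NNReal using b4
    lift Y to NNReal using b5
    have hαm : 0 ≤ α * m := by positivity
    have c1 : (X : ℝ) ≤ 16 * (Y + α * m / 32) := by
      have := ENNReal.toReal_mono (by finiteness) b1
      rwa [ENNReal.toReal_mul, ENNReal.toReal_add (by finiteness) (by finiteness),
        ENNReal.toReal_ofReal (by positivity)] at this
    have c2 : (Y : ℝ) ≤ 16 * (X + α * m / 32) := by
      have := ENNReal.toReal_mono (by finiteness) b2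
      rwa [ENNReal.toReal_mul, ENNReal.toReal_add (by finiteness) (by finiteness),
        ENNReal.toReal_ofReal (by positivity)] at this
    have c3 : α * m ≤ X := by
      have := ENNReal.toReal_mono (by finiteness) b3
      rwa [ENNReal.toReal_ofReal (by positivity)] at this
    have hX : (0 : ℝ) ≤ X := X.2
    constructor
    · have : (X : ℝ) ≤ 32 * Y := by linarith
      exact_mod_cast this
    · have : (Y : ℝ) ≤ 32 * X := by linarith
      exact_mod_cast this
  -- the coordinates
  let J := Σ n : ℤ, ((Finset.range (N n)).powerset ×ˢ (S n).range : Finset _)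
  let φ : J → (ℕ →₀ ℝ) →ₗ[ℝ] ℝ := fun j => coord p (μ j.1) (N j.1) (S j.1) j.2.1
  have hφ : ∀ a : ℕ →₀ ℝ, ∑' j, ENNReal.ofReal (|φ j a| ^ p) =
      ∑' n, ∑ q ∈ (Finset.range (N n)).powerset ×ˢ (S n).range,
        ENNReal.ofReal (|coord p (μ n) (N n) (S n) q a| ^ p) := fun a => by
    rw [ENNReal.tsum_sigma']
    refine tsum_congr fun n => ?_
    exact Finset.tsum_subtype _ (fun q => ENNReal.ofReal (|coord p (μ n) (N n) (S n) q a| ^ p))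
  have hφ1 : ∀ a : ℕ →₀ ℝ, ∑' n, Q p (μ n) a.support a (fun x => S n x) ≤
      ∑' j, ENNReal.ofReal (|φ j a| ^ p) := fun a => by
    rw [hφ]
    exact ENNReal.tsum_le_tsum fun n => (coord_bounds hp hp4 (μ n) (N n) (S n) (hS0 n) a).1
  have hφ2 : ∀ a : ℕ →₀ ℝ, ∑' j, ENNReal.ofReal (|φ j a| ^ p) ≤
      3 * ∑' n, Q p (μ n) a.support a (fun x => S n x) := fun a => by
    rw [hφ, ← ENNReal.tsum_mul_left]
    exact ENNReal.tsum_le_tsum fun n => (coord_bounds hp hp4 (μ n) (N n) (S n) (hS0 n) a).2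
  -- the dense map
  have hrange : LinearMap.range (Finsupp.linearCombination ℝ F) = Submodule.span ℝ (Set.range F) :=
    Finsupp.range_linearCombination ℝ
  let e : (ℕ →₀ ℝ) →ₗ[ℝ] (Submodule.span ℝ (Set.range F)).topologicalClosure :=
    (Finsupp.linearCombination ℝ F).codRestrict _ fun a =>
      Submodule.le_topologicalClosure _ (hrange ▸ LinearMap.mem_range_self _ a)
  have hen : ∀ a, ‖e a‖ = ‖∑ i ∈ a.support, a i • F i‖ := fun a => rfl
  have hd : DenseRange e := by
    rintro ⟨x, hx⟩
    rw [closure_subtype]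
    refine closure_mono ?_ hx
    intro y hy
    rw [SetLike.mem_coe, ← hrange] at hy
    obtain ⟨a, rfl⟩ := hy
    exact ⟨e a, ⟨a, rfl⟩, rfl⟩
  refine extend_lp hp0 e hd φ (3 * C ^ p * 32) (3 * 32 * C ^ p) (by positivity) (by positivity)
    (fun a => ?_) (fun a => ?_)
  · rw [hen]
    refine (hQ2 a.support a).trans ?_
    rw [ENNReal.ofReal_mul (by positivity : 0 ≤ 3 * C ^ p), mul_assoc]
    gcongr
    refine (hA a).1.trans ?_
    simp only [ENNReal.ofReal_ofNat]
    gcongr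
    exact hφ1 a
  · rw [hen]
    refine (hφ2 a).trans ?_
    refine (mul_le_mul_right ((hA a).2.trans (mul_le_mul_right (hQ1 a.support a) 32)) 3).trans ?_
    rw [mul_assoc (3 * 32 : ℝ), ENNReal.ofReal_mul (p := 3 * 32) (by norm_num),
      ENNReal.ofReal_mul (p := 3) (by norm_num)]
    simp only [ENNReal.ofReal_ofNat, mul_assoc]
    exact le_rfl
end
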